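/- arXiv:2508.12717 — 2 statements merged into one kernel-verified Lean document; each statement's English description precedes it below -/
import Mathlib

section
/- For every integer r ≥ 1 and every n ≥ 1, the pair (exc_r, den_r) is equidistributed with (rdes, rmaj) over S_n; that is, for all integers a, b, the number of σ ∈ S_n with exc_r(σ) = a and den_r(σ) = b equals the number of σ ∈ S_n with rdes(σ) = a and rmaj(σ) = b. (Theorem 1.1, Huang–Lin–Yan: (exc_r, den_r) is r-Euler–Mahonian.) -/
open Finset

namespace PaperStmt

/-- 1-based position of `i : Fin n` (so positions run through `1,…,n`). -/
def pos1 {n : ℕ} (i : Fin n) : ℕ := (i : ℕ) + 1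

/-- 1-based value `σ_i` of the permutation `σ` at position `i`. -/
def val1 {n : ℕ} (σ : Equiv.Perm (Fin n)) (i : Fin n) : ℕ := (σ i : ℕ) + 1

/-- The number of inversions of the subsequence of `σ` consisting of the letters at the
positions satisfying `P`: pairs of positions `i < j`, both satisfying `P`,
with `σ_i > σ_j`. -/
def invOn {n : ℕ} (σ : Equiv.Perm (Fin n)) (P : Fin n → Prop) [DecidablePred P] : ℕ :=
  (univ.filter fun p : Fin n × Fin n =>
    p.1 < p.2 ∧ P p.1 ∧ P p.2 ∧ val1 σ p.2 < val1 σ p.1).card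

/-- `inv σ`: the number of inversions of `σ`. -/
def inv {n : ℕ} (σ : Equiv.Perm (Fin n)) : ℕ := invOn σ (fun _ => True)

/-- `Exc(σ)`: the set of excedances, i.e. positions `i` with `σ_i > i`. -/
def excSet {n : ℕ} (σ : Equiv.Perm (Fin n)) : Finset (Fin n) :=
  univ.filter fun i => pos1 i < val1 σ i

/-- `exc σ`: the number of excedances. -/
def exc {n : ℕ} (σ : Equiv.Perm (Fin n)) : ℕ := (excSet σ).card

/-- `exc_r(σ)`: the number of `r`-level excedances, i.e. positions `i ≥ r` with `σ_i > i`. -/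
def excLvl {n : ℕ} (r : ℕ) (σ : Equiv.Perm (Fin n)) : ℕ :=
  (univ.filter fun i => pos1 i < val1 σ i ∧ r ≤ pos1 i).card

/-- Denert's statistic `den σ`. -/
def den {n : ℕ} (σ : Equiv.Perm (Fin n)) : ℕ :=
  ((univ.filter fun i => pos1 i < val1 σ i).sum pos1)
  + invOn σ (fun i => pos1 i < val1 σ i)
  + invOn σ (fun i => ¬ pos1 i < val1 σ i)

/-- The `h`-level Denert statistic `den_h(σ)`. -/
def denLvl {n : ℕ} (h : ℕ) (σ : Equiv.Perm (Fin n)) : ℕ :=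
  ((univ.filter fun i => pos1 i < val1 σ i ∧ h ≤ val1 σ i).sum pos1)
  + invOn σ (fun i => pos1 i < val1 σ i ∧ h ≤ val1 σ i)
  + invOn σ (fun i => ¬ (pos1 i < val1 σ i ∧ h ≤ val1 σ i))

/-- `g exc_ℓ(σ)`: the number of `g`-gap `ℓ`-level excedances,
i.e. positions `i ≥ ℓ` with `σ_i ≥ i + g`. -/
def gexc {n : ℕ} (g l : ℕ) (σ : Equiv.Perm (Fin n)) : ℕ :=
  (univ.filter fun i => pos1 i + g ≤ val1 σ i ∧ l ≤ pos1 i).card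

/-- `gExclp_h(σ)`: the set of `g`-gap `h`-level excedance-letter positions,
i.e. positions `i` with `σ_i ≥ i + g` and `σ_i ≥ h`. -/
def gExclpSet {n : ℕ} (g h : ℕ) (σ : Equiv.Perm (Fin n)) : Finset (Fin n) :=
  univ.filter fun i => pos1 i + g ≤ val1 σ i ∧ h ≤ val1 σ i

/-- The `g`-gap `h`-level Denert statistic `g den_h(σ)`. -/
def gden {n : ℕ} (g h : ℕ) (σ : Equiv.Perm (Fin n)) : ℕ :=
  ((univ.filter fun i => pos1 i + g ≤ val1 σ i ∧ h ≤ val1 σ i).sum fun i => pos1 i + g - 1)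
  + invOn σ (fun i => pos1 i + g ≤ val1 σ i ∧ h ≤ val1 σ i)
  + invOn σ (fun i => ¬ (pos1 i + g ≤ val1 σ i ∧ h ≤ val1 σ i))

/-- `rexc σ`: the number of `r`-excedances, i.e. positions `i` with `σ_i ≥ i + r`. -/
def rexc {n : ℕ} (r : ℕ) (σ : Equiv.Perm (Fin n)) : ℕ :=
  (univ.filter fun i => pos1 i + r ≤ val1 σ i).card

/-- The `r`-Denert statistic `rden σ`. -/
def rden {n : ℕ} (r : ℕ) (σ : Equiv.Perm (Fin n)) : ℕ :=
  ((univ.filter fun i => pos1 i + r ≤ val1 σ i).sum fun i => pos1 i + r - 1)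
  + invOn σ (fun i => pos1 i + r ≤ val1 σ i)
  + invOn σ (fun i => ¬ pos1 i + r ≤ val1 σ i)

/-- Pairs `(i, i+1)` of adjacent positions forming an `r`-descent: `σ_i ≥ σ_{i+1} + r`. -/
def rdesPairs {n : ℕ} (r : ℕ) (σ : Equiv.Perm (Fin n)) : Finset (Fin n × Fin n) :=
  univ.filter fun p => pos1 p.2 = pos1 p.1 + 1 ∧ val1 σ p.2 + r ≤ val1 σ p.1

/-- `rdes σ`: the number of `r`-descents. -/
def rdes {n : ℕ} (r : ℕ) (σ : Equiv.Perm (Fin n)) : ℕ := (rdesPairs r σ).card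

/-- `rmaj σ`: the sum of the `r`-descents plus the number of pairs `i < j`
with `σ_j < σ_i < σ_j + r`. -/
def rmaj {n : ℕ} (r : ℕ) (σ : Equiv.Perm (Fin n)) : ℕ :=
  ((rdesPairs r σ).sum fun p => pos1 p.1)
  + (univ.filter fun p : Fin n × Fin n =>
      p.1 < p.2 ∧ val1 σ p.2 < val1 σ p.1 ∧ val1 σ p.1 < val1 σ p.2 + r).card

/-- `des σ`: the number of descents, i.e. positions `i ∈ [n-1]` with `σ_i > σ_{i+1}`. -/
def des {n : ℕ} (σ : Equiv.Perm (Fin n)) : ℕ :=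
  (univ.filter fun p : Fin n × Fin n =>
    pos1 p.2 = pos1 p.1 + 1 ∧ val1 σ p.2 < val1 σ p.1).card

/-- `maj σ`: the major index, i.e. the sum of the descents of `σ`. -/
def maj {n : ℕ} (σ : Equiv.Perm (Fin n)) : ℕ :=
  ((univ.filter fun p : Fin n × Fin n =>
    pos1 p.2 = pos1 p.1 + 1 ∧ val1 σ p.2 < val1 σ p.1).sum fun p => pos1 p.1)


/-- The subset of `Fin (n + 1)` consisting of `A` and the last element. -/
def withLast {n : ℕ} (A : Finset (Fin n)) : Finset (Fin (n + 1)) :=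
  insert (Fin.last n) (A.map Fin.castSuccEmb)

lemma castSucc_mem_withLast {n : ℕ} {A : Finset (Fin n)} {v : Fin n} :
    v.castSucc ∈ withLast A ↔ v ∈ A := by
  simp [withLast, Fin.castSucc_ne_last]

lemma last_mem_withLast {n : ℕ} (A : Finset (Fin n)) : Fin.last n ∈ withLast A := by
  simp [withLast]

lemma withLast_injective {n : ℕ} : Function.Injective (withLast (n := n)) := by
  intro A B hAB
  ext v
  rw [← castSucc_mem_withLast, hAB, castSucc_mem_withLast]

/-- The increment of the Mahonian statistic produced by an insertion at `x`, when `withLast A` is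
the set of insertion places which leave the Eulerian statistic unchanged. -/
def gap {n : ℕ} (A : Finset (Fin n)) (x : Fin (n + 1)) : ℕ :=
  (if x ∈ withLast A then 0 else (x : ℕ) + 1) + #{v ∈ A | x ≤ v.castSucc}

lemma gap_le_card_of_mem {n : ℕ} {A : Finset (Fin n)} {x : Fin (n + 1)} (hx : x ∈ withLast A) :
    gap A x ≤ #A := by
  simp only [gap, hx, if_true, zero_add]
  exact card_filter_le _ _

lemma gap_add_card_of_notMem {n : ℕ} {A : Finset (Fin n)} {x : Fin (n + 1)}
    (hx : x ∉ withLast A) :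
    gap A x + #{v ∈ A | v.castSucc < x} = x + 1 + #A := by
  have h := card_filter_add_card_filter_not (s := A) (fun v => x ≤ v.castSucc)
  simp only [not_le] at h
  simp only [gap, hx, if_false]
  omega

lemma card_filter_castSucc_lt_le {n : ℕ} (A : Finset (Fin n)) (x : Fin (n + 1)) :
    #{v ∈ A | v.castSucc < x} ≤ x := by
  calc #{v ∈ A | v.castSucc < x} ≤ #(range (x : ℕ)) :=
        card_le_card_of_injOn (fun v => (v : ℕ)) (by
          intro v hv
          simp only [coe_filter, Set.mem_ofPred_eq] at hv
          simpa [Fin.lt_def] using hv.2) (fun a _ b _ hab => Fin.ext hab)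
    _ = x := card_range _

lemma card_lt_gap_of_notMem {n : ℕ} {A : Finset (Fin n)} {x : Fin (n + 1)}
    (hx : x ∉ withLast A) : #A < gap A x := by
  have h₁ := gap_add_card_of_notMem hx
  have h₂ := card_filter_castSucc_lt_le A x
  omega

lemma gap_le {n : ℕ} (A : Finset (Fin n)) (x : Fin (n + 1)) : gap A x ≤ n := by
  by_cases hx : x ∈ withLast A
  · exact (gap_le_card_of_mem hx).trans (by simpa using card_le_univ A)
  · have h : #{v ∈ A | x ≤ v.castSucc} ≤ #(Ioo (x : ℕ) n) :=
      card_le_card_of_injOn (fun v => (v : ℕ)) (by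
        intro v hv
        simp only [coe_filter, Set.mem_ofPred_eq] at hv
        have hne : x ≠ v.castSucc := fun h => hx (h ▸ castSucc_mem_withLast.2 hv.1)
        have := lt_of_le_of_ne hv.2 hne
        simpa [Fin.lt_def] using this) (fun a _ b _ hab => Fin.ext hab)
    rw [Nat.card_Ioo] at h
    have hlt : (x : ℕ) < n := by
      have : x ≠ Fin.last n := fun h => hx (h ▸ last_mem_withLast A)
      simpa [Fin.lt_def] using Fin.lt_last_iff_ne_last.2 this
    simp only [gap, hx, if_false]
    omega

lemma gap_ne_of_lt {n : ℕ} {A : Finset (Fin n)} {x y : Fin (n + 1)} (hxy : x < y) :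
    gap A x ≠ gap A y := by
  by_cases hx : x ∈ withLast A <;> by_cases hy : y ∈ withLast A
  · obtain ⟨u, rfl⟩ := Fin.exists_castSucc_eq.2 (hxy.trans_le (Fin.le_last y)).ne
    simp only [gap, hx, hy, if_true, zero_add]
    refine (card_lt_card ?_).ne'
    rw [ssubset_iff_of_subset (fun v hv => ?_)]
    · exact ⟨u, by simpa using castSucc_mem_withLast.1 hx, by simpa using fun _ => hxy⟩
    · simp only [mem_filter] at hv ⊢
      exact ⟨hv.1, hxy.le.trans hv.2⟩
  · exact ((gap_le_card_of_mem hx).trans_lt (card_lt_gap_of_notMem hy)).ne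
  · exact ((gap_le_card_of_mem hy).trans_lt (card_lt_gap_of_notMem hx)).ne'
  · have h₁ := gap_add_card_of_notMem hx
    have h₂ := gap_add_card_of_notMem hy
    have h₃ : #{v ∈ A | v.castSucc < y} ≤ #({v ∈ A | v.castSucc < x}) + #(Ioo (x : ℕ) y) := by
      rw [← card_filter_add_card_filter_not (s := {v ∈ A | v.castSucc < y})
        (fun v => v.castSucc < x)]
      refine add_le_add (card_le_card fun v hv => ?_)
        (card_le_card_of_injOn (fun v => (v : ℕ)) ?_ (fun a _ b _ hab => Fin.ext hab))
      · simp only [mem_filter] at hv ⊢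
        exact ⟨hv.1.1, hv.2⟩
      · intro v hv
        simp only [coe_filter, Set.mem_ofPred_eq, mem_filter, not_lt] at hv
        have hne : x ≠ v.castSucc := fun h => hx (h ▸ castSucc_mem_withLast.2 hv.1.1)
        exact mem_coe.2 (mem_Ioo.2 ⟨(lt_of_le_of_ne hv.2 hne : x < v.castSucc), hv.1.2⟩)
    rw [Nat.card_Ioo] at h₃
    have : (x : ℕ) < y := hxy
    omega

lemma sum_gap {n : ℕ} (A : Finset (Fin n)) (F : ℕ → ℕ) :
    ∑ x, F (gap A x) = ∑ j ∈ range (n + 1), F j := by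
  have hinj : Function.Injective (gap A) := fun x y hxy => by
    by_contra hne
    rcases lt_or_gt_of_ne hne with h | h
    · exact gap_ne_of_lt h hxy
    · exact gap_ne_of_lt h hxy.symm
  have himage : univ.image (gap A) = range (n + 1) := by
    refine eq_of_subset_of_card_le (fun j hj => ?_) ?_
    · obtain ⟨x, -, rfl⟩ := mem_image.1 hj
      simpa [Nat.lt_succ_iff] using gap_le A x
    · rw [card_image_of_injective _ hinj]
      simp
  rw [← himage, sum_image hinj.injOn]


lemma val_succAbove {n : ℕ} (x : Fin (n + 1)) (i : Fin n) :
    (x.succAbove i : ℕ) = if (i : ℕ) < x then (i : ℕ) else i + 1 := by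
  simp only [Fin.succAbove, Fin.lt_def, Fin.val_castSucc]
  split_ifs <;> simp

lemma insertNth_injective {n : ℕ} {α : Type*} {x : Fin (n + 1)} {e : α} {f : Fin n → α}
    (hf : Function.Injective f) (he : ∀ i, f i ≠ e) :
    Function.Injective (x.insertNth (α := fun _ => α) e f) := by
  intro p q hpq
  induction p using x.succAboveCases with
  | x =>
    induction q using x.succAboveCases with
    | x => rfl
    | p j =>
      simp only [Fin.insertNth_apply_same, Fin.insertNth_apply_succAbove] at hpq
      exact absurd hpq.symm (he j)
  | p i =>
    induction q using x.succAboveCases with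
    | x =>
      simp only [Fin.insertNth_apply_same, Fin.insertNth_apply_succAbove] at hpq
      exact absurd hpq (he i)
    | p j =>
      simp only [Fin.insertNth_apply_succAbove] at hpq
      rw [hf hpq]

lemma sum_perm_eq_sum_insert {n : ℕ}
    {ins : Equiv.Perm (Fin n) → Fin (n + 1) → Equiv.Perm (Fin (n + 1))}
    (hins : Function.Injective2 ins) (G : Equiv.Perm (Fin (n + 1)) → ℕ) :
    ∑ ω, G ω = ∑ σ, ∑ x, G (ins σ x) := by
  have hbij : Function.Bijective (Function.uncurry ins) := by
    rw [Fintype.bijective_iff_injective_and_card]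
    refine ⟨Function.Injective2.uncurry hins, ?_⟩
    simp [Fintype.card_perm, Nat.factorial_succ, mul_comm]
  rw [← hbij.sum_comp, Fintype.sum_prod_type]
  rfl

/-- Insertion of the largest letter at position `x`. -/
noncomputable def insertMax {n : ℕ} (σ : Equiv.Perm (Fin n)) (x : Fin (n + 1)) :
    Equiv.Perm (Fin (n + 1)) :=
  Equiv.ofBijective (x.insertNth (α := fun _ => Fin (n + 1)) (Fin.last n) fun i => (σ i).castSucc)
    (Finite.injective_iff_bijective.1 (insertNth_injective
      ((Fin.castSucc_injective n).comp σ.injective) fun _ => Fin.castSucc_ne_last _))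

lemma insertMax_self {n : ℕ} (σ : Equiv.Perm (Fin n)) (x : Fin (n + 1)) :
    insertMax σ x x = Fin.last n := by
  simp [insertMax]

lemma insertMax_succAbove {n : ℕ} (σ : Equiv.Perm (Fin n)) (x : Fin (n + 1)) (i : Fin n) :
    insertMax σ x (x.succAbove i) = (σ i).castSucc := by
  simp [insertMax]

lemma insertMax_injective {n : ℕ} : Function.Injective2 (insertMax (n := n)) := by
  intro σ τ x y h
  have hxy : x = y := by
    apply (insertMax τ y).injective
    rw [insertMax_self, ← h, insertMax_self]
  subst hxy
  refine ⟨Equiv.ext fun i => Fin.castSucc_injective n ?_, rfl⟩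
  rw [← insertMax_succAbove, ← insertMax_succAbove, h]

/-- Position `j` carries the bottom of an `r`-descent. -/
def IsDescBottom {n : ℕ} (r : ℕ) (σ : Equiv.Perm (Fin n)) (j : Fin n) : Prop :=
  ∃ i : Fin n, (i : ℕ) + 1 = j ∧ (σ j : ℕ) + r ≤ σ i

instance {n : ℕ} (r : ℕ) (σ : Equiv.Perm (Fin n)) : DecidablePred (IsDescBottom r σ) :=
  fun _ => inferInstanceAs (Decidable (∃ _, _))

lemma mem_rdesPairs {n r : ℕ} {σ : Equiv.Perm (Fin n)} {p : Fin n × Fin n} :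
    p ∈ rdesPairs r σ ↔ (p.1 : ℕ) + 1 = p.2 ∧ (σ p.2 : ℕ) + r ≤ σ p.1 := by
  rw [rdesPairs, mem_filter, and_iff_right (mem_univ p), pos1, pos1, val1, val1]
  omega

lemma sum_rdesPairs {n : ℕ} (r : ℕ) (σ : Equiv.Perm (Fin n)) (f : ℕ → ℕ) :
    ∑ p ∈ rdesPairs r σ, f (pos1 p.1) = ∑ j, if IsDescBottom r σ j then f j else 0 := by
  rw [← sum_filter]
  refine sum_bij (fun p _ => p.2) ?_ ?_ ?_ ?_
  · rintro ⟨i, j⟩ h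
    rw [mem_rdesPairs] at h
    exact mem_filter.2 ⟨mem_univ j, i, h⟩
  · rintro ⟨i, j⟩ h ⟨i', j'⟩ h' rfl
    rw [mem_rdesPairs] at h h'
    exact Prod.ext (Fin.ext (Nat.succ_injective (h.1.trans h'.1.symm))) rfl
  · intro j hj
    obtain ⟨i, h⟩ := (mem_filter.1 hj).2
    exact ⟨(i, j), mem_rdesPairs.2 h, rfl⟩
  · rintro ⟨i, j⟩ h
    rw [mem_rdesPairs] at h
    rw [pos1, h.1]

lemma rdes_eq_sum {n : ℕ} (r : ℕ) (σ : Equiv.Perm (Fin n)) :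
    rdes r σ = ∑ j, if IsDescBottom r σ j then 1 else 0 := by
  rw [rdes, card_eq_sum_ones, ← sum_rdesPairs r σ fun _ => 1]

lemma rmaj_eq_sum {n : ℕ} (r : ℕ) (σ : Equiv.Perm (Fin n)) :
    rmaj r σ = (∑ j, if IsDescBottom r σ j then (j : ℕ) else 0) +
      ∑ i, ∑ j, if i < j ∧ σ j < σ i ∧ (σ i : ℕ) < σ j + r then 1 else 0 := by
  rw [rmaj, ← sum_rdesPairs r σ fun j => j, card_filter, Fintype.sum_prod_type]
  simp only [val1, Fin.lt_def, add_lt_add_iff_right, add_right_comm]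

lemma not_isDescBottom_insertMax_self {n r : ℕ} (hr : 1 ≤ r) (σ : Equiv.Perm (Fin n))
    (x : Fin (n + 1)) : ¬ IsDescBottom r (insertMax σ x) x := by
  rintro ⟨i, -, h⟩
  rw [insertMax_self, Fin.val_last] at h
  omega

lemma isDescBottom_insertMax_succAbove {n : ℕ} (r : ℕ) (σ : Equiv.Perm (Fin n))
    (x : Fin (n + 1)) (j : Fin n) :
    IsDescBottom r (insertMax σ x) (x.succAbove j) ↔
      if j.castSucc = x then (σ j : ℕ) + r ≤ n else IsDescBottom r σ j := by
  have hsucc : ∀ i : Fin n, (x.succAbove i : ℕ) + 1 = x.succAbove j ↔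
      (i : ℕ) + 1 = j ∧ j.castSucc ≠ x := by
    intro i
    simp only [val_succAbove, Ne, Fin.ext_iff, Fin.val_castSucc]
    split_ifs <;> omega
  have hself : (x : ℕ) + 1 = x.succAbove j ↔ j.castSucc = x := by
    simp only [val_succAbove, Fin.ext_iff, Fin.val_castSucc]
    split_ifs <;> omega
  simp only [IsDescBottom, Fin.exists_iff_succAbove x, insertMax_self, insertMax_succAbove,
    hsucc, hself, Fin.val_last, Fin.val_castSucc]
  split_ifs with h <;> simp [h]

/-- The positions of the letters in front of which the insertion of the largest letter creates no
new `r`-descent. -/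
def descNeutral {n : ℕ} (r : ℕ) (σ : Equiv.Perm (Fin n)) : Finset (Fin n) :=
  {j | IsDescBottom r σ j ∨ n < σ j + r}

lemma ite_mem_withLast {n : ℕ} (A : Finset (Fin n)) (x : Fin (n + 1)) (c : ℕ) :
    (if x ∈ withLast A then 0 else c) = ∑ j, if j.castSucc = x ∧ j ∉ A then c else 0 := by
  induction x using Fin.lastCases with
  | last => simp [last_mem_withLast, Fin.castSucc_ne_last]
  | cast u => simp [castSucc_mem_withLast, Fin.castSucc_inj, ite_and]

lemma gap_eq_sum {n : ℕ} (A : Finset (Fin n)) (x : Fin (n + 1)) :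
    gap A x = (∑ j, if j.castSucc = x ∧ j ∉ A then (x : ℕ) + 1 else 0) +
      ∑ j, if j ∈ A ∧ x ≤ j.castSucc then 1 else 0 := by
  rw [gap, ite_mem_withLast, sum_boole, Nat.cast_id]
  congr 2
  ext
  simp

lemma IsDescBottom.add_le {n r : ℕ} {σ : Equiv.Perm (Fin n)} {j : Fin n}
    (h : IsDescBottom r σ j) : (σ j : ℕ) + r ≤ n := by
  obtain ⟨i, -, hi⟩ := h
  exact hi.trans (σ i).is_lt.le

lemma rdes_insertMax {n r : ℕ} (hr : 1 ≤ r) (σ : Equiv.Perm (Fin n)) (x : Fin (n + 1)) :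
    rdes r (insertMax σ x) = rdes r σ + if x ∈ withLast (descNeutral r σ) then 0 else 1 := by
  rw [rdes_eq_sum, Fin.sum_univ_succAbove _ x, if_neg (not_isDescBottom_insertMax_self hr σ x),
    zero_add, rdes_eq_sum, ite_mem_withLast, ← sum_add_distrib]
  refine sum_congr rfl fun j _ => ?_
  have := IsDescBottom.add_le (r := r) (σ := σ) (j := j)
  simp only [isDescBottom_insertMax_succAbove, descNeutral, mem_filter, mem_univ, true_and]
  by_cases hj : j.castSucc = x <;> by_cases hD : IsDescBottom r σ j <;>
    by_cases hG : n < σ j + r <;> simp_all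

lemma rmaj_insertMax {n r : ℕ} (hr : 1 ≤ r) (σ : Equiv.Perm (Fin n)) (x : Fin (n + 1)) :
    rmaj r (insertMax σ x) = rmaj r σ + gap (descNeutral r σ) x := by
  have hpos : ∀ j, ((if IsDescBottom r (insertMax σ x) (x.succAbove j) then
        (x.succAbove j : ℕ) else 0) +
      if x < x.succAbove j ∧ (σ j).castSucc < Fin.last n ∧ n < σ j + r then 1 else 0) =
      (if IsDescBottom r σ j then (j : ℕ) else 0) +
      ((if j.castSucc = x ∧ j ∉ descNeutral r σ then (x : ℕ) + 1 else 0) +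
        if j ∈ descNeutral r σ ∧ x ≤ j.castSucc then 1 else 0) := by
    intro j
    have := IsDescBottom.add_le (r := r) (σ := σ) (j := j)
    simp only [isDescBottom_insertMax_succAbove, descNeutral, mem_filter, mem_univ, true_and,
      Fin.lt_def, Fin.le_def, Fin.ext_iff, val_succAbove, Fin.val_castSucc, Fin.val_last,
      (σ j).is_lt]
    grind
  have hsum := sum_congr rfl fun j (_ : j ∈ univ) => hpos j
  simp only [sum_add_distrib] at hsum
  rw [rmaj_eq_sum, rmaj_eq_sum, Fin.sum_univ_succAbove _ x, Fin.sum_univ_succAbove _ x,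
    if_neg (not_isDescBottom_insertMax_self hr σ x), gap_eq_sum]
  simp only [Fin.sum_univ_succAbove _ x, insertMax_self, insertMax_succAbove, Fin.val_last,
    Fin.val_castSucc, lt_self_iff_false, false_and, if_false, zero_add,
    Fin.succAbove_lt_succAbove_iff, Fin.castSucc_lt_castSucc_iff, (Fin.castSucc_lt_last _).not_gt,
    and_false]
  omega

lemma card_descNeutral {n h : ℕ} (hn : h ≤ n) (σ : Equiv.Perm (Fin n)) :
    #(descNeutral (h + 1) σ) = rdes (h + 1) σ + h := by
  rw [descNeutral, filter_or, card_union_of_disjoint, rdes_eq_sum, sum_boole, Nat.cast_id]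
  · congr 1
    trans #(univ.image fun i : Fin h => σ.symm ⟨n - h + i, by omega⟩)
    · congr 1
      ext j
      simp only [mem_filter, mem_univ, true_and, mem_image]
      constructor
      · intro hj
        refine ⟨⟨σ j - (n - h), by omega⟩, ?_⟩
        rw [Equiv.symm_apply_eq]; ext; simp only; omega
      · rintro ⟨i, rfl⟩
        rw [Equiv.apply_symm_apply]; simp only; omega
    · rw [card_image_of_injective, card_univ, Fintype.card_fin]
      intro i j hij
      simpa [Fin.ext_iff] using hij
  · rw [disjoint_filter]
    intro j _ hj
    have := hj.add_le
    omega

lemma sum_insertMax {n h : ℕ} (hn : h ≤ n) (σ : Equiv.Perm (Fin n)) (f : ℕ → ℕ → ℕ) :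
    ∑ x, f (rdes (h + 1) (insertMax σ x)) (rmaj (h + 1) (insertMax σ x)) =
      ∑ j ∈ range (n + 1), f (rdes (h + 1) σ + if rdes (h + 1) σ + h < j then 1 else 0)
        (rmaj (h + 1) σ + j) := by
  rw [← sum_gap (descNeutral (h + 1) σ)]
  refine sum_congr rfl fun x _ => ?_
  rw [rdes_insertMax le_add_self, rmaj_insertMax le_add_self, ← card_descNeutral hn]
  congr 2
  by_cases hx : x ∈ withLast (descNeutral (h + 1) σ)
  · simp [hx, gap_le_card_of_mem hx]
  · simp [hx, card_lt_gap_of_notMem hx]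

/-- The letter at position `i` is an excedance letter of level `h`. -/
def IsExc {n : ℕ} (h : ℕ) (σ : Equiv.Perm (Fin n)) (i : Fin n) : Prop :=
  (i : ℕ) < σ i ∧ h ≤ σ i

instance {n : ℕ} (h : ℕ) (σ : Equiv.Perm (Fin n)) : DecidablePred (IsExc h σ) :=
  fun _ => inferInstanceAs (Decidable (_ ∧ _))

lemma excLvl_eq_sum {n : ℕ} (h : ℕ) (σ : Equiv.Perm (Fin n)) :
    excLvl (h + 1) σ = ∑ i, if IsExc h σ i ∧ h ≤ (i : ℕ) then 1 else 0 := by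
  rw [excLvl, card_filter]
  refine sum_congr rfl fun i _ => if_congr ?_ rfl rfl
  simp only [pos1, val1, IsExc]
  omega

lemma denLvl_eq_sum {n : ℕ} (h : ℕ) (σ : Equiv.Perm (Fin n)) :
    denLvl (h + 1) σ = (∑ i, if IsExc h σ i then (i : ℕ) + 1 else 0) +
      ∑ i, ∑ j, if i < j ∧ (IsExc h σ i ↔ IsExc h σ j) ∧ σ j < σ i then 1 else 0 := by
  have hE : ∀ i, (pos1 i < val1 σ i ∧ h + 1 ≤ val1 σ i) ↔ IsExc h σ i := by
    intro i
    simp only [pos1, val1, IsExc]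
    omega
  simp only [denLvl, invOn, hE, sum_filter, card_filter, Fintype.sum_prod_type, add_assoc]
  simp only [← sum_add_distrib]
  refine sum_congr rfl fun i _ => congrArg _ <| sum_congr rfl fun j _ => ?_
  simp only [val1, Fin.lt_def]
  by_cases hi : IsExc h σ i <;> by_cases hj : IsExc h σ j <;> simp [hi, hj]

/-- The excedance letters of level `h`. -/
def excLetters {n : ℕ} (h : ℕ) (σ : Equiv.Perm (Fin n)) : Finset (Fin n) :=
  {v | IsExc h σ (σ.symm v)}

lemma apply_mem_excLetters {n h : ℕ} {σ : Equiv.Perm (Fin n)} {i : Fin n} :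
    σ i ∈ excLetters h σ ↔ IsExc h σ i := by
  simp [excLetters]

/-- The least element of `withLast A` which is at least `x`. -/
def nextPlace {n : ℕ} (A : Finset (Fin n)) (x : Fin (n + 1)) : Fin (n + 1) :=
  ((withLast A).filter (x ≤ ·)).min'
    ⟨Fin.last n, mem_filter.2 ⟨last_mem_withLast A, Fin.le_last x⟩⟩

lemma nextPlace_mem {n : ℕ} (A : Finset (Fin n)) (x : Fin (n + 1)) :
    nextPlace A x ∈ withLast A :=
  (mem_filter.1 (min'_mem ((withLast A).filter (x ≤ ·)) _)).1

lemma le_nextPlace {n : ℕ} (A : Finset (Fin n)) (x : Fin (n + 1)) : x ≤ nextPlace A x :=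
  (mem_filter.1 (min'_mem ((withLast A).filter (x ≤ ·)) _)).2

lemma nextPlace_le {n : ℕ} {A : Finset (Fin n)} {x y : Fin (n + 1)} (hy : y ∈ withLast A)
    (hxy : x ≤ y) : nextPlace A x ≤ y :=
  min'_le _ _ (mem_filter.2 ⟨hy, hxy⟩)

lemma nextPlace_eq_self {n : ℕ} {A : Finset (Fin n)} {x : Fin (n + 1)} :
    nextPlace A x = x ↔ x ∈ withLast A :=
  ⟨fun h => h ▸ nextPlace_mem A x, fun h => (nextPlace_le h le_rfl).antisymm (le_nextPlace A x)⟩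

/-- The letter replacing `v` when `nextPlace A x` is inserted: the elements of `A` from `x` on move
to the next element of `withLast A`. -/
def raise {n : ℕ} (A : Finset (Fin n)) (x : Fin (n + 1)) (v : Fin n) : Fin (n + 1) :=
  if v ∈ A ∧ x ≤ v.castSucc then nextPlace A v.succ else v.castSucc

lemma castSucc_lt_raise {n : ℕ} {A : Finset (Fin n)} {x : Fin (n + 1)} {v : Fin n}
    (hv : v ∈ A) (hx : x ≤ v.castSucc) : v.castSucc < raise A x v := by
  rw [raise, if_pos ⟨hv, hx⟩]
  exact Fin.castSucc_lt_succ.trans_le (le_nextPlace A _)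

lemma raise_of_lt {n : ℕ} (A : Finset (Fin n)) {x : Fin (n + 1)} {v : Fin n}
    (hx : v.castSucc < x) : raise A x v = v.castSucc :=
  if_neg fun h => h.2.not_gt hx

lemma raise_of_notMem {n : ℕ} {A : Finset (Fin n)} (x : Fin (n + 1)) {v : Fin n}
    (hv : v ∉ A) : raise A x v = v.castSucc :=
  if_neg fun h => hv h.1

lemma raise_mem_withLast {n : ℕ} {A : Finset (Fin n)} {x : Fin (n + 1)} {v : Fin n} :
    raise A x v ∈ withLast A ↔ v ∈ A := by
  rw [raise]
  split_ifs with h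
  · simp [h.1, nextPlace_mem]
  · exact castSucc_mem_withLast

lemma raise_lt_raise_of_mem {n : ℕ} {A : Finset (Fin n)} {x : Fin (n + 1)} {u v : Fin n}
    (hv : v ∈ A) (huv : u < v) : raise A x u < raise A x v := by
  have huv' : u.succ ≤ v.castSucc := huv
  by_cases hx : x ≤ v.castSucc
  · refine lt_of_le_of_lt ?_ (castSucc_lt_raise hv hx)
    rw [raise]
    split_ifs
    · exact nextPlace_le (castSucc_mem_withLast.2 hv) huv'
    · exact Fin.castSucc_le_castSucc_iff.2 huv.le
  · rw [not_le] at hx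
    have hlt := Fin.castSucc_lt_castSucc_iff.2 huv
    rwa [raise_of_lt A hx, raise_of_lt A (hlt.trans hx)]

lemma raise_lt_raise_iff {n : ℕ} {A : Finset (Fin n)} {x : Fin (n + 1)} {u v : Fin n}
    (h : u ∈ A ↔ v ∈ A) : raise A x u < raise A x v ↔ u < v := by
  by_cases hv : v ∈ A
  · refine ⟨fun hlt => ?_, raise_lt_raise_of_mem hv⟩
    by_contra hle
    rcases (not_lt.1 hle).lt_or_eq with h' | rfl
    · exact hlt.not_gt (raise_lt_raise_of_mem (h.2 hv) h')
    · exact hlt.false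
  · rw [raise_of_notMem x hv, raise_of_notMem x (mt h.1 hv), Fin.castSucc_lt_castSucc_iff]

lemma raise_injective {n : ℕ} (A : Finset (Fin n)) (x : Fin (n + 1)) :
    Function.Injective (raise A x) := by
  intro u v huv
  have hA : u ∈ A ↔ v ∈ A := by rw [← raise_mem_withLast (x := x), huv, raise_mem_withLast]
  by_contra hne
  rcases lt_or_gt_of_ne hne with h | h
  · exact ((raise_lt_raise_iff (x := x) hA).2 h).ne huv
  · exact ((raise_lt_raise_iff (x := x) hA.symm).2 h).ne' huv

lemma nextPlace_lt_raise {n : ℕ} {A : Finset (Fin n)} {x : Fin (n + 1)} {v : Fin n}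
    (hv : v ∈ A) : nextPlace A x < raise A x v ↔ x ≤ v.castSucc := by
  refine ⟨fun h => ?_, fun h =>
    (nextPlace_le (castSucc_mem_withLast.2 hv) h).trans_lt (castSucc_lt_raise hv h)⟩
  by_contra hlt
  rw [not_le] at hlt
  rw [raise_of_lt A hlt] at h
  exact (h.trans hlt).not_ge (le_nextPlace A x)

lemma raise_ne_nextPlace {n : ℕ} (A : Finset (Fin n)) (x : Fin (n + 1)) (v : Fin n) :
    raise A x v ≠ nextPlace A x := by
  by_cases hv : v ∈ A
  · by_cases hx : x ≤ v.castSucc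
    · exact ((nextPlace_lt_raise hv).2 hx).ne'
    · rw [not_le] at hx
      rw [raise_of_lt A hx]
      exact (hx.trans_le (le_nextPlace A x)).ne
  · intro h
    exact hv (raise_mem_withLast.1 (h ▸ nextPlace_mem A x))

/-- Insertion at position `x` of the next possible excedance letter, the larger excedance letters
being shifted. -/
noncomputable def insertExc {n : ℕ} (h : ℕ) (σ : Equiv.Perm (Fin n)) (x : Fin (n + 1)) :
    Equiv.Perm (Fin (n + 1)) :=
  Equiv.ofBijective (x.insertNth (α := fun _ => Fin (n + 1)) (nextPlace (excLetters h σ) x)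
      fun i => raise (excLetters h σ) x (σ i))
    (Finite.injective_iff_bijective.1 (insertNth_injective
      ((raise_injective _ x).comp σ.injective) fun _ => raise_ne_nextPlace _ _ _))

lemma insertExc_self {n : ℕ} (h : ℕ) (σ : Equiv.Perm (Fin n)) (x : Fin (n + 1)) :
    insertExc h σ x x = nextPlace (excLetters h σ) x := by
  simp [insertExc]

lemma insertExc_succAbove {n : ℕ} (h : ℕ) (σ : Equiv.Perm (Fin n)) (x : Fin (n + 1))
    (i : Fin n) : insertExc h σ x (x.succAbove i) = raise (excLetters h σ) x (σ i) := by
  simp [insertExc]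

lemma le_of_mem_excLetters {n h : ℕ} {σ : Equiv.Perm (Fin n)} {v : Fin n}
    (hv : v ∈ excLetters h σ) : h ≤ v := by
  obtain ⟨i, rfl⟩ := σ.surjective v
  exact (apply_mem_excLetters.1 hv).2

lemma le_of_mem_withLast_excLetters {n h : ℕ} (hn : h ≤ n) {σ : Equiv.Perm (Fin n)}
    {x : Fin (n + 1)} (hx : x ∈ withLast (excLetters h σ)) : h ≤ x := by
  induction x using Fin.lastCases with
  | last => simpa using hn
  | cast v => exact (le_of_mem_excLetters (castSucc_mem_withLast.1 hx) :)

lemma isExc_insertExc_self {n h : ℕ} (hn : h ≤ n) (σ : Equiv.Perm (Fin n)) (x : Fin (n + 1)) :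
    IsExc h (insertExc h σ x) x ↔ x ∉ withLast (excLetters h σ) := by
  have hle := le_of_mem_withLast_excLetters hn (nextPlace_mem (excLetters h σ) x)
  rw [IsExc, insertExc_self, and_iff_left hle, ← nextPlace_eq_self, ← Fin.lt_def,
    (le_nextPlace _ x).lt_iff_ne, ne_comm]

lemma isExc_insertExc_succAbove {n : ℕ} (h : ℕ) (σ : Equiv.Perm (Fin n)) (x : Fin (n + 1))
    (i : Fin n) : IsExc h (insertExc h σ x) (x.succAbove i) ↔ IsExc h σ i := by
  rw [IsExc, insertExc_succAbove, val_succAbove]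
  by_cases hi : IsExc h σ i
  · have hA := apply_mem_excLetters.2 hi
    rw [iff_true_right hi]
    by_cases hx : x ≤ (σ i).castSucc
    · have := castSucc_lt_raise hA hx
      simp only [Fin.lt_def, Fin.val_castSucc] at this
      unfold IsExc at hi
      split_ifs <;> omega
    · rw [not_le] at hx
      rw [raise_of_lt _ hx]
      simp only [Fin.lt_def, Fin.val_castSucc] at hx ⊢
      unfold IsExc at hi
      split_ifs <;> omega
  · rw [raise_of_notMem x (mt apply_mem_excLetters.1 hi), Fin.val_castSucc]
    unfold IsExc at *
    split_ifs <;> omega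

lemma sum_cross_eq {n : ℕ} (σ : Equiv.Perm (Fin n)) (x : ℕ) :
    (∑ i : Fin n, if x ≤ i ∧ (σ i : ℕ) < x then 1 else 0) =
      ∑ i : Fin n, if (i : ℕ) < x ∧ x ≤ σ i then 1 else 0 := by
  have h := Equiv.sum_comp σ fun i : Fin n => if (i : ℕ) < x then 1 else 0
  have h' : ∀ i : Fin n, (if x ≤ i ∧ (σ i : ℕ) < x then 1 else 0) + (if (i : ℕ) < x then 1 else 0)
      = (if (σ i : ℕ) < x then 1 else 0) + if (i : ℕ) < x ∧ x ≤ σ i then 1 else 0 := by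
    intro i
    split_ifs <;> omega
  have h'' := sum_congr rfl fun i (_ : i ∈ univ) => h' i
  simp only [sum_add_distrib] at h''
  omega

lemma sum_new_pairs_insertExc {n h : ℕ} (hn : h ≤ n) (σ : Equiv.Perm (Fin n))
    (x : Fin (n + 1)) :
    (∑ i : Fin n, if IsExc h σ i ∧ x ≤ i.castSucc then 1 else 0) +
      ((∑ i, if x < x.succAbove i ∧ (x ∉ withLast (excLetters h σ) ↔ IsExc h σ i) ∧
          raise (excLetters h σ) x (σ i) < nextPlace (excLetters h σ) x then 1 else 0) +
        ∑ i, if x.succAbove i < x ∧ (IsExc h σ i ↔ x ∉ withLast (excLetters h σ)) ∧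
          nextPlace (excLetters h σ) x < raise (excLetters h σ) x (σ i) then 1 else 0) =
      ∑ i, if IsExc h σ i ∧ x ≤ (σ i).castSucc then 1 else 0 := by
  have hlt : ∀ i, x < x.succAbove i ↔ (x : ℕ) ≤ i := by
    intro i
    rw [Fin.lt_def, val_succAbove]
    split_ifs <;> omega
  have hgt : ∀ i, x.succAbove i < x ↔ (i : ℕ) < x := by
    intro i
    rw [Fin.lt_def, val_succAbove]
    split_ifs <;> omega
  by_cases hx : x ∈ withLast (excLetters h σ)
  · have hhx := le_of_mem_withLast_excLetters hn hx
    have hcross := sum_cross_eq σ x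
    rw [nextPlace_eq_self.2 hx]
    simp only [hx, not_true_eq_false, false_iff, iff_false, hlt, hgt]
    have h₁ : ∀ i : Fin n, ((i : ℕ) < x ∧ ¬ IsExc h σ i ∧ x < raise (excLetters h σ) x (σ i)) ↔
        False := by
      refine fun i => iff_false_intro ?_
      rintro ⟨hi, hE, hr⟩
      rw [raise_of_notMem x (mt apply_mem_excLetters.1 hE), Fin.lt_def, Fin.val_castSucc] at hr
      unfold IsExc at hE
      omega
    have h₂ : ∀ i : Fin n, ((x : ℕ) ≤ i ∧ ¬ IsExc h σ i ∧ raise (excLetters h σ) x (σ i) < x) ↔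
        ((x : ℕ) ≤ i ∧ (σ i : ℕ) < x) := by
      intro i
      by_cases hE : IsExc h σ i
      · simp only [hE, not_true_eq_false, false_and, and_false, false_iff]
        unfold IsExc at hE
        omega
      · rw [raise_of_notMem x (mt apply_mem_excLetters.1 hE), Fin.lt_def, Fin.val_castSucc]
        simp [hE]
    simp only [h₁, h₂, if_false, sum_const_zero, add_zero, hcross, ← sum_add_distrib]
    refine sum_congr rfl fun i _ => ?_
    simp only [IsExc, Fin.le_def, Fin.val_castSucc]
    grind
  · simp only [hx, not_false_eq_true, true_iff, iff_true, hlt, hgt, ← sum_add_distrib]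
    refine sum_congr rfl fun i _ => ?_
    by_cases hE : IsExc h σ i
    · have hA := apply_mem_excLetters.2 hE
      have hr : raise (excLetters h σ) x (σ i) < nextPlace (excLetters h σ) x ↔
          ¬ x ≤ (σ i).castSucc := by
        rw [← nextPlace_lt_raise hA, not_lt, (raise_ne_nextPlace _ _ _).le_iff_lt]
      simp only [nextPlace_lt_raise hA, hr, hE, true_and, Fin.le_def, Fin.val_castSucc]
      unfold IsExc at hE
      grind
    · simp [hE]

lemma denLvl_insertExc {n h : ℕ} (hn : h ≤ n) (σ : Equiv.Perm (Fin n)) (x : Fin (n + 1)) :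
    denLvl (h + 1) (insertExc h σ x) = denLvl (h + 1) σ + gap (excLetters h σ) x := by
  have hnew := sum_new_pairs_insertExc hn σ x
  have hgap : #{v ∈ excLetters h σ | x ≤ v.castSucc} =
      ∑ i, if IsExc h σ i ∧ x ≤ (σ i).castSucc then 1 else 0 := by
    simp only [← apply_mem_excLetters (σ := σ)]
    rw [Equiv.sum_comp σ fun v => if v ∈ excLetters h σ ∧ x ≤ v.castSucc then 1 else 0, sum_boole,
      Nat.cast_id]
    congr 1
    ext
    simp
  have hpos : (∑ i, if IsExc h σ i then (x.succAbove i : ℕ) + 1 else 0) =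
      (∑ i, if IsExc h σ i then (i : ℕ) + 1 else 0) +
        ∑ i : Fin n, if IsExc h σ i ∧ x ≤ i.castSucc then 1 else 0 := by
    rw [← sum_add_distrib]
    refine sum_congr rfl fun i _ => ?_
    simp only [val_succAbove, Fin.le_def, Fin.val_castSucc]
    grind
  have hpairs : ∀ i j, (i < j ∧ (IsExc h σ i ↔ IsExc h σ j) ∧
      raise (excLetters h σ) x (σ j) < raise (excLetters h σ) x (σ i)) ↔
      (i < j ∧ (IsExc h σ i ↔ IsExc h σ j) ∧ σ j < σ i) := by
    intro i j
    refine and_congr_right fun _ => and_congr_right fun hij => raise_lt_raise_iff ?_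
    rw [apply_mem_excLetters, apply_mem_excLetters, hij]
  have hself : (if x ∉ withLast (excLetters h σ) then (x : ℕ) + 1 else 0) =
      if x ∈ withLast (excLetters h σ) then 0 else (x : ℕ) + 1 := by
    split_ifs <;> simp_all
  rw [denLvl_eq_sum, denLvl_eq_sum, Fin.sum_univ_succAbove _ x, Fin.sum_univ_succAbove _ x, gap,
    hgap]
  simp only [Fin.sum_univ_succAbove _ x, isExc_insertExc_self hn, isExc_insertExc_succAbove,
    insertExc_self, insertExc_succAbove, lt_self_iff_false, false_and, if_false, zero_add,
    Fin.succAbove_lt_succAbove_iff, hpairs, hpos, sum_add_distrib, hself]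
  omega

lemma mem_excLetters_insertExc {n h : ℕ} (hn : h ≤ n) {σ : Equiv.Perm (Fin n)}
    {x v : Fin (n + 1)} :
    v ∈ excLetters h (insertExc h σ x) ↔ v ∈ withLast (excLetters h σ) ∧ v ≠ x := by
  obtain ⟨p, rfl⟩ := (insertExc h σ x).surjective v
  rw [apply_mem_excLetters]
  induction p using x.succAboveCases with
  | x =>
    rw [isExc_insertExc_self hn, insertExc_self, Ne, nextPlace_eq_self,
      and_iff_right (nextPlace_mem _ _)]
  | p i =>
    rw [isExc_insertExc_succAbove, insertExc_succAbove, raise_mem_withLast, apply_mem_excLetters,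
      iff_self_and]
    intro hi
    rcases le_or_gt x (σ i).castSucc with hx | hx
    · exact (hx.trans_lt (castSucc_lt_raise (apply_mem_excLetters.2 hi) hx)).ne'
    · rw [raise_of_lt _ hx]
      exact hx.ne

lemma insertExc_ne_of_lt {n h : ℕ} (hn : h ≤ n) (σ τ : Equiv.Perm (Fin n)) {x y : Fin (n + 1)}
    (hxy : x < y) : insertExc h σ x ≠ insertExc h τ y := by
  intro hω
  obtain ⟨i, rfl⟩ := Fin.exists_succAbove_eq hxy.ne'
  have hval : (x.succAbove i : ℕ) = i + 1 := by
    rw [Fin.lt_def, val_succAbove] at hxy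
    rw [val_succAbove]
    split_ifs at hxy ⊢ <;> omega
  have hi : (x : ℕ) ≤ i := by
    rw [Fin.lt_def] at hxy
    omega
  have heq : raise (excLetters h σ) x (σ i) = nextPlace (excLetters h τ) (x.succAbove i) := by
    rw [← insertExc_succAbove, hω, insertExc_self]
  have hE : IsExc h σ i := by
    by_contra hE
    have h₁ := le_of_mem_withLast_excLetters hn (nextPlace_mem (excLetters h τ) (x.succAbove i))
    have h₂ := le_nextPlace (excLetters h τ) (x.succAbove i)
    rw [← heq, raise_of_notMem x (mt apply_mem_excLetters.1 hE)] at h₁ h₂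
    rw [Fin.le_def, hval] at h₂
    exact hE ⟨h₂, h₁⟩
  have hA := apply_mem_excLetters.2 hE
  have hlt : x < (σ i).castSucc := hi.trans_lt hE.1
  have hmem : (σ i).castSucc ∈ excLetters h (insertExc h σ x) :=
    (mem_excLetters_insertExc hn).2 ⟨castSucc_mem_withLast.2 hA, hlt.ne'⟩
  rw [hω, mem_excLetters_insertExc hn] at hmem
  have hle : x.succAbove i ≤ (σ i).castSucc := by
    rw [Fin.le_def, hval]
    exact hE.1
  exact (castSucc_lt_raise hA hlt.le).not_ge (heq.trans_le (nextPlace_le hmem.1 hle))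

lemma insertExc_injective {n h : ℕ} (hn : h ≤ n) :
    Function.Injective2 (insertExc h (n := n)) := by
  intro σ τ x y hω
  obtain rfl : x = y := by
    by_contra hne
    rcases lt_or_gt_of_ne hne with hlt | hlt
    · exact insertExc_ne_of_lt hn σ τ hlt hω
    · exact insertExc_ne_of_lt hn τ σ hlt hω.symm
  have hA : excLetters h σ = excLetters h τ := by
    apply withLast_injective
    ext v
    by_cases hv : v = x
    · rw [hv, ← nextPlace_eq_self, ← nextPlace_eq_self, ← insertExc_self, ← insertExc_self, hω]
    · have h₁ := mem_excLetters_insertExc hn (σ := σ) (x := x) (v := v)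
      rw [hω, mem_excLetters_insertExc hn] at h₁
      simpa [hv] using h₁.symm
  refine ⟨Equiv.ext fun i => raise_injective (excLetters h σ) x ?_, rfl⟩
  rw [← insertExc_succAbove, hω, insertExc_succAbove, hA]

/-- The number of letters at least `h` among the first `h` positions. -/
def numLarge {n : ℕ} (h : ℕ) (σ : Equiv.Perm (Fin n)) : ℕ :=
  ∑ i : Fin n, if (i : ℕ) < h ∧ h ≤ (σ i : ℕ) then 1 else 0

lemma numLarge_le {n : ℕ} (h : ℕ) (σ : Equiv.Perm (Fin n)) : numLarge h σ ≤ h := by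
  rw [numLarge, sum_boole, Nat.cast_id]
  calc #{i : Fin n | (i : ℕ) < h ∧ h ≤ (σ i : ℕ)} ≤ #(range h) :=
        card_le_card_of_injOn (fun i => (i : ℕ)) (by
          intro i hi
          simp only [coe_filter, Set.mem_ofPred_eq] at hi
          simpa using hi.2.1) (fun a _ b _ hab => Fin.ext hab)
    _ = h := card_range h

lemma card_excLetters {n : ℕ} (h : ℕ) (σ : Equiv.Perm (Fin n)) :
    #(excLetters h σ) = excLvl (h + 1) σ + numLarge h σ := by
  have hcard : #(excLetters h σ) = ∑ v, if v ∈ excLetters h σ then 1 else 0 := by simp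
  rw [hcard, ← Equiv.sum_comp σ, excLvl_eq_sum, numLarge, ← sum_add_distrib]
  refine sum_congr rfl fun i _ => ?_
  simp only [apply_mem_excLetters, IsExc]
  grind

lemma excLvl_insertExc_of_le {n h : ℕ} (hn : h ≤ n) (σ : Equiv.Perm (Fin n)) {x : Fin (n + 1)}
    (hx : h ≤ (x : ℕ)) :
    excLvl (h + 1) (insertExc h σ x) =
      excLvl (h + 1) σ + if x ∈ withLast (excLetters h σ) then 0 else 1 := by
  rw [excLvl_eq_sum, excLvl_eq_sum, Fin.sum_univ_succAbove _ x, add_comm]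
  simp only [isExc_insertExc_self hn, isExc_insertExc_succAbove, hx, and_true, ite_not]
  congr 1
  refine sum_congr rfl fun i _ => if_congr (and_congr_right fun _ => ?_) rfl rfl
  rw [val_succAbove]
  split_ifs <;> omega

lemma notMem_withLast_of_lt {n h : ℕ} (hn : h ≤ n) (σ : Equiv.Perm (Fin n)) {x : Fin (n + 1)}
    (hx : (x : ℕ) < h) : x ∉ withLast (excLetters h σ) :=
  fun hmem => (le_of_mem_withLast_excLetters hn hmem).not_gt hx

lemma excLvl_insertExc_of_lt {n h : ℕ} (σ : Equiv.Perm (Fin n)) {l : Fin n}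
    (hl : (l : ℕ) + 1 = h) {x : Fin (n + 1)} (hx : (x : ℕ) < h) :
    excLvl (h + 1) (insertExc h σ x) =
      excLvl (h + 1) σ + if h ≤ (σ l : ℕ) then 1 else 0 := by
  have hite : (if h ≤ (σ l : ℕ) then 1 else 0) =
      ∑ i, if i = l then if h ≤ (σ i : ℕ) then 1 else 0 else 0 := by
    simp
  rw [excLvl_eq_sum, excLvl_eq_sum, Fin.sum_univ_succAbove _ x, hite, ← sum_add_distrib,
    if_neg fun hE => hE.2.not_gt hx, zero_add]
  refine sum_congr rfl fun i _ => ?_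
  simp only [isExc_insertExc_succAbove, val_succAbove, Fin.ext_iff]
  unfold IsExc
  split_ifs <;> omega

lemma excLvl_insertExc_of_le_eq_gap {n h : ℕ} (hn : h ≤ n) (σ : Equiv.Perm (Fin n))
    {x : Fin (n + 1)} (hx : h ≤ (x : ℕ)) :
    excLvl (h + 1) (insertExc h σ x) = excLvl (h + 1) σ +
      if excLvl (h + 1) σ + h < gap (excLetters h σ) x then 1 else 0 := by
  rw [excLvl_insertExc_of_le hn σ hx]
  congr 1
  have hcard := card_excLetters h σ
  by_cases hmem : x ∈ withLast (excLetters h σ)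
  · have h₁ := gap_le_card_of_mem hmem
    have h₂ := numLarge_le h σ
    rw [if_pos hmem, if_neg (by omega)]
  · have h₁ := gap_add_card_of_notMem hmem
    have h₂ : #{v ∈ excLetters h σ | v.castSucc < x} ≤ #(Ico h (x : ℕ)) :=
      card_le_card_of_injOn (fun v => (v : ℕ)) (by
        intro v hv
        simp only [coe_filter, Set.mem_ofPred_eq] at hv
        exact mem_coe.2 (mem_Ico.2 ⟨le_of_mem_excLetters hv.1, hv.2⟩))
        (fun a _ b _ hab => Fin.ext hab)
    rw [Nat.card_Ico] at h₂
    rw [if_neg hmem, if_pos (by omega)]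

lemma gap_excLetters_of_lt {n h : ℕ} (hn : h ≤ n) (σ : Equiv.Perm (Fin n)) {x : Fin (n + 1)}
    (hx : (x : ℕ) < h) :
    gap (excLetters h σ) x = excLvl (h + 1) σ + numLarge h σ + 1 + x := by
  have h₁ := gap_add_card_of_notMem (notMem_withLast_of_lt hn σ hx)
  have h₂ : #{v ∈ excLetters h σ | v.castSucc < x} = 0 := by
    rw [card_eq_zero, filter_eq_empty_iff]
    intro v hv hlt
    have := le_of_mem_excLetters hv
    rw [Fin.lt_def, Fin.val_castSucc] at hlt
    omega
  rw [card_excLetters] at h₁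
  omega

/-- The order on letters in which the letters larger than `l` come first. -/
def key {n : ℕ} (l v : Fin n) : ℕ := if l < v then v else v + n

lemma key_injective {n : ℕ} (l : Fin n) : Function.Injective (key l) := by
  intro u v huv
  unfold key at huv
  split_ifs at huv <;> omega

/-- The number of inversions among the letters in positions up to `l`, with respect to `key l`. -/
def firstInv {n : ℕ} (l : Fin n) (σ : Equiv.Perm (Fin n)) : ℕ :=
  ∑ p, ∑ q, if p < q ∧ q ≤ l ∧ key l (σ q) < key l (σ p) then 1 else 0

/-- The part of the Denert statistic which involves positions beyond `l`. -/
def denRest {n : ℕ} (l : Fin n) (σ : Equiv.Perm (Fin n)) : ℕ :=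
  (∑ q, if l < q ∧ IsExc (l + 1) σ q then (q : ℕ) + 1 else 0) +
    ∑ p, ∑ q, if p < q ∧ l < q ∧ (IsExc (l + 1) σ p ↔ IsExc (l + 1) σ q) ∧ σ q < σ p
      then 1 else 0

lemma two_mul_sum_pairs {n : ℕ} (P : Fin n → Prop) [DecidablePred P] :
    2 * (∑ p, ∑ q, if p ≤ q ∧ P p ∧ P q then 1 else 0) =
      (∑ p, if P p then 1 else 0) ^ 2 + ∑ p, if P p then 1 else 0 := by
  have hdiag : (∑ p, if P p then 1 else 0) = ∑ p, ∑ q, if p = q ∧ P p then 1 else 0 := by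
    simp [ite_and]
  have hswap : (∑ p, ∑ q, if p ≤ q ∧ P p ∧ P q then 1 else 0) =
      ∑ p, ∑ q, if q ≤ p ∧ P p ∧ P q then 1 else 0 := by
    rw [sum_comm]
    simp only [and_comm]
  rw [sq, sum_mul_sum, two_mul]
  nth_rw 2 [hswap]
  rw [hdiag]
  simp only [← sum_add_distrib]
  refine sum_congr rfl fun p _ => sum_congr rfl fun q _ => ?_
  by_cases hp : P p <;> by_cases hq : P q <;> grind

lemma two_mul_denLvl {n : ℕ} (l : Fin n) (σ : Equiv.Perm (Fin n)) :
    2 * denLvl (l + 1 + 1) σ = 2 * (firstInv l σ + denRest l σ) +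
      (numLarge (l + 1) σ ^ 2 + numLarge (l + 1) σ) := by
  have hpair : ∀ p q : Fin n, (if q ≤ l ∧ IsExc (l + 1) σ q ∧ p ≤ q then 1 else 0) +
      (if p < q ∧ (IsExc (l + 1) σ p ↔ IsExc (l + 1) σ q) ∧ σ q < σ p then 1 else 0) =
      (if p < q ∧ q ≤ l ∧ key l (σ q) < key l (σ p) then 1 else 0) +
      (if p < q ∧ l < q ∧ (IsExc (l + 1) σ p ↔ IsExc (l + 1) σ q) ∧ σ q < σ p then 1 else 0) +
      if p ≤ q ∧ ((p : ℕ) < l + 1 ∧ l + 1 ≤ (σ p : ℕ)) ∧ (q : ℕ) < l + 1 ∧ l + 1 ≤ (σ q : ℕ)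
        then 1 else 0 := by
    intro p q
    have hp := (σ p).is_lt
    have hq := (σ q).is_lt
    simp only [IsExc, key, Fin.lt_def, Fin.le_def]
    rcases le_or_gt (q : ℕ) l with hql | hql
    · rcases lt_trichotomy (p : ℕ) q with h | h | h
      · by_cases h₁ : (l : ℕ) < σ p <;> by_cases h₂ : (l : ℕ) < σ q <;> grind
      · by_cases h₁ : (l : ℕ) < σ p <;> by_cases h₂ : (l : ℕ) < σ q <;> grind
      · grind
    · grind
  have hpos : ∀ q : Fin n, (q : ℕ) + 1 = ∑ p, if p ≤ q then 1 else 0 := by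
    intro q
    rw [sum_boole, Nat.cast_id, ← Fin.card_Iic q]
    congr 1
    ext
    simp
  have hsplit : (∑ q, if IsExc (l + 1) σ q then (q : ℕ) + 1 else 0) =
      (∑ p, ∑ q, if q ≤ l ∧ IsExc (l + 1) σ q ∧ p ≤ q then 1 else 0) +
        ∑ q, if l < q ∧ IsExc (l + 1) σ q then (q : ℕ) + 1 else 0 := by
    rw [sum_comm, ← sum_add_distrib]
    refine sum_congr rfl fun q _ => ?_
    by_cases hq : IsExc (l + 1) σ q <;> by_cases hl : q ≤ l
    · simp [hq, hl, hl.not_gt, ← hpos]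
    · simp [hq, hl, not_le.1 hl]
    · simp [hq]
    · simp [hq]
  have hlarge := two_mul_sum_pairs fun p : Fin n => (p : ℕ) < l + 1 ∧ l + 1 ≤ (σ p : ℕ)
  rw [numLarge, ← hlarge, ← mul_add, denLvl_eq_sum, hsplit, firstInv, denRest]
  congr 1
  have hsum := sum_congr rfl fun p (_ : p ∈ univ) => sum_congr rfl fun q (_ : q ∈ univ) => hpair p q
  simp only [sum_add_distrib] at hsum
  omega

lemma isExc_mul_iff {n : ℕ} {l : Fin n} {π : Equiv.Perm (Fin n)} (hπ : ∀ p, l < p → π p = p)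
    (σ : Equiv.Perm (Fin n)) (p : Fin n) :
    IsExc (l + 1) (σ * π) p ↔ IsExc (l + 1) σ (π p) := by
  by_cases hp : l < p
  · simp only [IsExc, Equiv.Perm.mul_apply, hπ p hp]
  · have hp' : ¬ l < π p := fun h => hp (by rwa [← π.injective (hπ _ h)])
    simp only [IsExc, Equiv.Perm.mul_apply]
    omega

lemma lt_apply_iff_of_fixed {n : ℕ} {l : Fin n} {π : Equiv.Perm (Fin n)}
    (hπ : ∀ p, l < p → π p = p) (p : Fin n) : l < π p ↔ l < p :=
  ⟨fun h => by rwa [← π.injective (hπ _ h)], fun h => by rwa [hπ p h]⟩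

lemma numLarge_mul {n : ℕ} {l : Fin n} {π : Equiv.Perm (Fin n)} (hπ : ∀ p, l < p → π p = p)
    (σ : Equiv.Perm (Fin n)) : numLarge (l + 1) (σ * π) = numLarge (l + 1) σ := by
  rw [numLarge, numLarge, eq_comm, ← Equiv.sum_comp π]
  refine sum_congr rfl fun p _ => ?_
  have := lt_apply_iff_of_fixed hπ p
  simp only [Fin.lt_def] at this
  simp only [Equiv.Perm.mul_apply, Nat.lt_succ_iff, ← not_lt, this]

lemma excLvl_mul {n : ℕ} {l : Fin n} {π : Equiv.Perm (Fin n)} (hπ : ∀ p, l < p → π p = p)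
    (σ : Equiv.Perm (Fin n)) : excLvl (l + 1 + 1) (σ * π) = excLvl (l + 1 + 1) σ := by
  rw [excLvl_eq_sum, excLvl_eq_sum, eq_comm, ← Equiv.sum_comp π]
  refine sum_congr rfl fun p _ => ?_
  have := lt_apply_iff_of_fixed hπ p
  simp only [Fin.lt_def] at this
  simp only [isExc_mul_iff hπ, Nat.succ_le_iff, this]

lemma denRest_mul {n : ℕ} {l : Fin n} {π : Equiv.Perm (Fin n)} (hπ : ∀ p, l < p → π p = p)
    (σ : Equiv.Perm (Fin n)) : denRest l (σ * π) = denRest l σ := by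
  rw [denRest, denRest]
  congr 1
  · refine sum_congr rfl fun q _ => ?_
    by_cases hq : l < q
    · simp only [isExc_mul_iff hπ, hπ q hq]
    · simp [hq]
  · rw [eq_comm, ← Equiv.sum_comp π]
    refine sum_congr rfl fun p _ => sum_congr rfl fun q _ => ?_
    by_cases hq : l < q
    · have hp : π p < q ↔ p < q := by
        by_cases hp : l < p
        · rw [hπ p hp]
        · have := mt (lt_apply_iff_of_fixed hπ p).1 hp
          omega
      simp only [isExc_mul_iff hπ, Equiv.Perm.mul_apply, hπ q hq, hp]
    · simp [hq]

lemma firstInv_mul_swap {n : ℕ} {l i : Fin n} (hi : i < l) {σ : Equiv.Perm (Fin n)}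
    (hlt : key l (σ i) < key l (σ l))
    (hadj : ∀ p ≤ l, key l (σ i) < key l (σ p) → key l (σ l) ≤ key l (σ p)) :
    firstInv l (σ * Equiv.swap i l) = firstInv l σ + 1 := by
  have hone : (∑ p, ∑ q, if p = i ∧ q = l then 1 else 0) = 1 := by
    simp [ite_and]
  have hne : ∀ {p q : Fin n}, p ≠ q → key l (σ p) ≠ key l (σ q) := fun hpq h =>
    hpq (σ.injective (key_injective l h))
  rw [firstInv, firstInv, ← hone]
  simp only [← sum_add_distrib]
  refine sum_congr rfl fun p _ => sum_congr rfl fun q _ => ?_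
  simp only [Equiv.Perm.mul_apply, Equiv.swap_apply_def]
  have hp := hadj p
  have hq := hadj q
  have hpi := @hne p i
  have hpl := @hne p l
  have hqi := @hne q i
  have hql := @hne q l
  grind

/-- The number of letters in positions up to `l` which follow the letter at position `i` with
respect to `key l`. -/
def firstRank {n : ℕ} (l : Fin n) (σ : Equiv.Perm (Fin n)) (i : Fin n) : ℕ :=
  #{p | p ≤ l ∧ key l (σ i) < key l (σ p)}

lemma firstRank_lt_firstRank {n : ℕ} {l : Fin n} {σ : Equiv.Perm (Fin n)} {i j : Fin n}
    (hj : j ≤ l) (hij : key l (σ i) < key l (σ j)) : firstRank l σ j < firstRank l σ i := by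
  refine card_lt_card ((ssubset_iff_of_subset fun p hp => ?_).2 ⟨j, ?_, ?_⟩)
  · simp only [mem_filter, mem_univ, true_and] at hp ⊢
    exact ⟨hp.1, hij.trans hp.2⟩
  · simpa using ⟨hj, hij⟩
  · simp

lemma firstRank_injOn {n : ℕ} (l : Fin n) (σ : Equiv.Perm (Fin n)) :
    Set.InjOn (firstRank l σ) (Set.Iic l) := by
  intro i hi j hj hij
  by_contra hne
  rcases lt_or_gt_of_ne fun h => hne (σ.injective (key_injective l h)) with h | h
  · exact (firstRank_lt_firstRank hj h).ne' hij
  · exact (firstRank_lt_firstRank hi h).ne hij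

lemma firstRank_le {n : ℕ} {l i : Fin n} (hi : i ≤ l) (σ : Equiv.Perm (Fin n)) :
    firstRank l σ i ≤ l := by
  have h : firstRank l σ i < #(Iic l) := by
    refine card_lt_card ((ssubset_iff_of_subset fun p hp => ?_).2 ⟨i, ?_, ?_⟩)
    · simp only [mem_filter, mem_univ, true_and] at hp
      simpa using hp.1
    · simpa using hi
    · simp
  rw [Fin.card_Iic] at h
  omega

lemma exists_firstRank_eq {n : ℕ} {l : Fin n} (σ : Equiv.Perm (Fin n)) {q : ℕ} (hq : q ≤ l) :
    ∃ i ≤ l, firstRank l σ i = q := by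
  have himage : (Iic l).image (firstRank l σ) = range (l + 1) := by
    refine eq_of_subset_of_card_le (fun j hj => ?_) ?_
    · obtain ⟨i, hi, rfl⟩ := mem_image.1 hj
      exact mem_range.2 (Nat.lt_succ_of_le (firstRank_le (mem_Iic.1 hi) σ))
    · rw [card_image_of_injOn (by simpa using firstRank_injOn l σ)]
      simp
  obtain ⟨i, hi, hiq⟩ := mem_image.1 (himage ▸ mem_range.2 (Nat.lt_succ_of_le hq))
  exact ⟨i, mem_Iic.1 hi, hiq⟩

lemma firstRank_mul_swap {n : ℕ} {l i : Fin n} (hi : i ≤ l) (σ : Equiv.Perm (Fin n))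
    (p : Fin n) :
    firstRank l (σ * Equiv.swap i l) p = firstRank l σ (Equiv.swap i l p) := by
  rw [firstRank, firstRank]
  refine card_equiv (Equiv.swap i l) fun q => ?_
  rw [mem_filter, mem_filter]
  simp only [mem_univ, true_and, Equiv.Perm.mul_apply]
  refine and_congr_left fun _ => ?_
  rw [Equiv.swap_apply_def]
  split_ifs <;> simp_all

/-- Exchange the letter at position `l` with the letter of rank `q`. -/
noncomputable def moveRank {n : ℕ} (l : Fin n) (q : ℕ) (σ : Equiv.Perm (Fin n)) :
    Equiv.Perm (Fin n) := by
  classical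
  exact if h : ∃ i ≤ l, firstRank l σ i = q then σ * Equiv.swap h.choose l else σ

lemma moveRank_firstRank {n : ℕ} {l i : Fin n} (hi : i ≤ l) (σ : Equiv.Perm (Fin n)) :
    moveRank l (firstRank l σ i) σ = σ * Equiv.swap i l := by
  have h : ∃ j ≤ l, firstRank l σ j = firstRank l σ i := ⟨i, hi, rfl⟩
  rw [moveRank, dif_pos h, firstRank_injOn l σ h.choose_spec.1 hi h.choose_spec.2]

lemma firstRank_moveRank {n : ℕ} {l : Fin n} {q : ℕ} (hq : q ≤ l) (σ : Equiv.Perm (Fin n)) :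
    firstRank l (moveRank l q σ) l = q := by
  obtain ⟨i, hi, rfl⟩ := exists_firstRank_eq σ hq
  rw [moveRank_firstRank hi, firstRank_mul_swap hi, Equiv.swap_apply_right]

lemma moveRank_moveRank {n : ℕ} {l : Fin n} {q : ℕ} (hq : q ≤ l) (σ : Equiv.Perm (Fin n)) :
    moveRank l (firstRank l σ l) (moveRank l q σ) = σ := by
  obtain ⟨i, hi, rfl⟩ := exists_firstRank_eq σ hq
  have h := moveRank_firstRank hi (σ * Equiv.swap i l)
  rw [firstRank_mul_swap hi, Equiv.swap_apply_left] at h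
  rw [moveRank_firstRank hi, h, mul_assoc, Equiv.swap_mul_self, mul_one]

lemma exists_moveRank_succ_eq {n : ℕ} {l : Fin n} {σ : Equiv.Perm (Fin n)}
    (hσ : firstRank l σ l < l) :
    ∃ i < l, moveRank l (firstRank l σ l + 1) σ = σ * Equiv.swap i l ∧
      firstRank l σ i = firstRank l σ l + 1 := by
  obtain ⟨i, hi, hrank⟩ := exists_firstRank_eq σ (Nat.succ_le_of_lt hσ)
  rw [← Nat.succ_eq_add_one, ← hrank]
  refine ⟨i, lt_of_le_of_ne hi ?_, moveRank_firstRank hi σ, rfl⟩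
  rintro rfl
  omega

lemma denLvl_mul_swap {n : ℕ} {l i : Fin n} {σ : Equiv.Perm (Fin n)} (hi : i < l)
    (hrank : firstRank l σ i = firstRank l σ l + 1) :
    denLvl (l + 1 + 1) (σ * Equiv.swap i l) = denLvl (l + 1 + 1) σ + 1 := by
  have hπ : ∀ p, l < p → Equiv.swap i l p = p := fun p hp =>
    Equiv.swap_apply_of_ne_of_ne (hi.trans hp).ne' hp.ne'
  have hlt : key l (σ i) < key l (σ l) := by
    rcases lt_trichotomy (key l (σ i)) (key l (σ l)) with h | h | h
    · exact h
    · exact absurd (σ.injective (key_injective l h)) hi.ne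
    · have := firstRank_lt_firstRank hi.le h
      omega
  have hinv := firstInv_mul_swap hi hlt fun p hp hip => by
    by_contra! hpl
    have h₁ := firstRank_lt_firstRank hp hip
    have h₂ := firstRank_lt_firstRank le_rfl hpl
    omega
  have h₁ := two_mul_denLvl l σ
  have h₂ := two_mul_denLvl l (σ * Equiv.swap i l)
  rw [hinv, denRest_mul hπ, numLarge_mul hπ] at h₂
  omega

/-- The statistics which are not changed by `moveRank`, as long as the rank increases by one. -/
def invariants {n : ℕ} (l : Fin n) (σ : Equiv.Perm (Fin n)) : ℕ × ℕ × ℤ :=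
  (excLvl (l + 1 + 1) σ, numLarge (l + 1) σ, (denLvl (l + 1 + 1) σ : ℤ) - firstRank l σ l)

lemma invariants_moveRank {n : ℕ} {l : Fin n} {σ : Equiv.Perm (Fin n)}
    (hσ : firstRank l σ l < l) :
    invariants l (moveRank l (firstRank l σ l + 1) σ) = invariants l σ := by
  obtain ⟨i, hi, heq, hrank⟩ := exists_moveRank_succ_eq hσ
  have hπ : ∀ p, l < p → Equiv.swap i l p = p := fun p hp =>
    Equiv.swap_apply_of_ne_of_ne (hi.trans hp).ne' hp.ne'
  rw [heq, invariants, invariants, excLvl_mul hπ, numLarge_mul hπ, denLvl_mul_swap hi hrank,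
    firstRank_mul_swap hi.le, Equiv.swap_apply_right, hrank]
  congr 2
  push_cast
  ring

lemma card_invariants_succ {n : ℕ} (l : Fin n) (t : ℕ × ℕ × ℤ) {j : ℕ} (hj : j < l) :
    #{σ | invariants l σ = t ∧ firstRank l σ l = j + 1} =
      #{σ | invariants l σ = t ∧ firstRank l σ l = j} := by
  refine card_nbij' (moveRank l j) (moveRank l (j + 1)) ?_ ?_ ?_ ?_
  · intro τ hτ
    simp only [coe_filter, mem_univ, true_and, Set.mem_ofPred_eq] at hτ ⊢
    have hrank := firstRank_moveRank hj.le τ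
    refine ⟨?_, hrank⟩
    have h := invariants_moveRank (hrank.trans_lt hj)
    rw [hrank, ← hτ.2, moveRank_moveRank hj.le, hτ.1] at h
    exact h.symm
  · intro σ hσ
    simp only [coe_filter, mem_univ, true_and, Set.mem_ofPred_eq] at hσ ⊢
    refine ⟨?_, firstRank_moveRank hj σ⟩
    rw [← hσ.2, invariants_moveRank (hσ.2.trans_lt hj), hσ.1]
  · intro τ hτ
    simp only [coe_filter, mem_univ, true_and, Set.mem_ofPred_eq] at hτ
    rw [← hτ.2, moveRank_moveRank hj.le]
  · intro σ hσ
    simp only [coe_filter, mem_univ, true_and, Set.mem_ofPred_eq] at hσ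
    rw [← hσ.2, moveRank_moveRank (hσ.2.trans_lt hj)]

lemma sum_eq_of_card_fiber {α β : Type*} [Fintype α] [DecidableEq β] (I : α → β) (ρ : α → ℕ)
    {h : ℕ} (hρ : ∀ a, ρ a < h)
    (hcard : ∀ t, ∀ j < h, #{a | I a = t ∧ ρ a = j} = #{a | I a = t ∧ ρ a = 0})
    (G : β → ℕ → ℕ) :
    ∑ a, G (I a) (ρ a) =
      ∑ t ∈ univ.image I, #{a | I a = t ∧ ρ a = 0} * ∑ j ∈ range h, G t j := by
  rw [← sum_fiberwise_of_maps_to (s := univ) (t := univ.image I) (g := I)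
    fun a _ => mem_image_of_mem I (mem_univ a)]
  refine sum_congr rfl fun t _ => ?_
  rw [← sum_fiberwise_of_maps_to (t := range h) (g := ρ) fun a _ => mem_range.2 (hρ a), mul_sum]
  refine sum_congr rfl fun j hj => ?_
  rw [← hcard t j (mem_range.1 hj), filter_filter, ← smul_eq_mul, ← sum_const]
  refine sum_congr rfl fun a ha => ?_
  rw [mem_filter] at ha
  rw [ha.2.1, ha.2.2]

lemma sum_exchange {α β : Type*} [Fintype α] [DecidableEq β] (I : α → β) (ρ : α → ℕ)
    {h : ℕ} (hρ : ∀ a, ρ a < h)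
    (hcard : ∀ t, ∀ j < h, #{a | I a = t ∧ ρ a = j} = #{a | I a = t ∧ ρ a = 0})
    (Φ : β → ℕ → ℕ → ℕ) :
    ∑ a, ∑ x ∈ range h, Φ (I a) (ρ a) x = ∑ a, ∑ x ∈ range h, Φ (I a) x (ρ a) := by
  rw [sum_eq_of_card_fiber I ρ hρ hcard fun t j => ∑ x ∈ range h, Φ t j x,
    sum_eq_of_card_fiber I ρ hρ hcard fun t j => ∑ x ∈ range h, Φ t x j]
  refine sum_congr rfl fun t _ => ?_
  rw [sum_comm]

lemma succ_le_apply_iff {n : ℕ} (l : Fin n) (σ : Equiv.Perm (Fin n)) :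
    (l : ℕ) + 1 ≤ σ l ↔ (l : ℕ) + 1 ≤ firstRank l σ l + numLarge (l + 1) σ := by
  have hl : (l : ℕ) + 1 = ∑ p, if p ≤ l then 1 else 0 := by
    rw [sum_boole, Nat.cast_id, ← Fin.card_Iic l]
    congr 1
    ext
    simp
  have hrank : firstRank l σ l = ∑ p, if p ≤ l ∧ key l (σ l) < key l (σ p) then 1 else 0 := by
    rw [firstRank, card_filter]
  have hkey : ∀ p, key l (σ p) = if (l : ℕ) + 1 ≤ σ p then (σ p : ℕ) else σ p + n := fun p => rfl
  constructor
  · intro hlarge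
    rw [hrank, numLarge, ← sum_add_distrib]
    refine hl.trans_le (sum_le_sum fun p _ => ?_)
    have h₁ := hkey p
    have h₂ := hkey l
    have h₃ := (σ l).is_lt
    clear hl hrank hkey
    simp only [Fin.le_def]
    grind
  · contrapose!
    intro hsmall
    have hone : (∑ p, if p = l then 1 else 0) = 1 := by simp
    have hle : ∀ p, (if p ≤ l ∧ key l (σ l) < key l (σ p) then 1 else 0) +
        (if (p : ℕ) < l + 1 ∧ l + 1 ≤ (σ p : ℕ) then 1 else 0) + (if p = l then 1 else 0) ≤
        if p ≤ l then 1 else 0 := by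
      intro p
      have h₁ := hkey p
      have h₂ := hkey l
      have h₃ := (σ p).is_lt
      clear hl hrank hkey hone
      simp only [Fin.le_def, Fin.ext_iff]
      grind
    have hsum := sum_le_sum fun p (_ : p ∈ univ) => hle p
    simp only [sum_add_distrib, hone] at hsum
    rw [← hrank, ← hl] at hsum
    exact Nat.lt_of_succ_le hsum

lemma sum_first_places {n : ℕ} (l : Fin n) (f : ℕ → ℕ → ℕ) :
    (∑ σ : Equiv.Perm (Fin n), ∑ x ∈ range (l + 1),
      f (excLvl (l + 1 + 1) σ + if (l : ℕ) + 1 ≤ σ l then 1 else 0)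
        (denLvl (l + 1 + 1) σ + (excLvl (l + 1 + 1) σ + numLarge (l + 1) σ + 1 + x))) =
    ∑ σ : Equiv.Perm (Fin n), ∑ x ∈ range (l + 1),
      f (excLvl (l + 1 + 1) σ + if (l : ℕ) + 1 ≤ x + numLarge (l + 1) σ then 1 else 0)
        (denLvl (l + 1 + 1) σ + (excLvl (l + 1 + 1) σ + numLarge (l + 1) σ + 1 + x)) := by
  have hcard : ∀ t, ∀ j < (l : ℕ) + 1, #{σ | invariants l σ = t ∧ firstRank l σ l = j} =
      #{σ | invariants l σ = t ∧ firstRank l σ l = 0} := by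
    intro t j
    induction j with
    | zero => exact fun _ => rfl
    | succ j ih => exact fun hj => (card_invariants_succ l t (by omega)).trans (ih (by omega))
  have hex := sum_exchange (invariants l) (fun σ => firstRank l σ l)
    (fun σ => Nat.lt_succ_of_le (firstRank_le le_rfl σ)) hcard fun t ρ x =>
      f (t.1 + if (l : ℕ) + 1 ≤ ρ + t.2.1 then 1 else 0)
        (t.2.2 + ρ + (t.1 + t.2.1 + 1 + x)).toNat
  convert hex using 4 with σ _ x _ σ _ x _
  · simp only [succ_le_apply_iff, invariants]
    congr
  · simp only [invariants]
    omega
  · rfl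
  · simp only [invariants]
    omega

lemma sum_ite_lt {m h : ℕ} (hm : h ≤ m) (G : ℕ → ℕ) :
    (∑ x : Fin m, if (x : ℕ) < h then G x else 0) = ∑ x ∈ range h, G x := by
  rw [Fin.sum_univ_eq_sum_range (fun x => if x < h then G x else 0) m, ← sum_filter]
  congr 1
  ext x
  simp only [mem_filter, mem_range]
  omega

lemma sum_insertExc {n h : ℕ} (hn : h ≤ n) (f : ℕ → ℕ → ℕ) :
    (∑ σ : Equiv.Perm (Fin n), ∑ x,
      f (excLvl (h + 1) (insertExc h σ x)) (denLvl (h + 1) (insertExc h σ x))) =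
    ∑ σ : Equiv.Perm (Fin n), ∑ j ∈ range (n + 1),
      f (excLvl (h + 1) σ + if excLvl (h + 1) σ + h < j then 1 else 0)
        (denLvl (h + 1) σ + j) := by
  have hsplit : ∀ F : Fin (n + 1) → ℕ, ∑ x, F x =
      (∑ x : Fin (n + 1), if (x : ℕ) < h then F x else 0) +
        ∑ x : Fin (n + 1), if (x : ℕ) < h then 0 else F x := by
    intro F
    rw [← sum_add_distrib]
    refine sum_congr rfl fun x _ => ?_
    split_ifs <;> simp
  have hgap : ∀ σ : Equiv.Perm (Fin n), ∑ j ∈ range (n + 1),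
      f (excLvl (h + 1) σ + if excLvl (h + 1) σ + h < j then 1 else 0) (denLvl (h + 1) σ + j) =
      ∑ x, f (excLvl (h + 1) σ + if excLvl (h + 1) σ + h < gap (excLetters h σ) x then 1 else 0)
        (denLvl (h + 1) σ + gap (excLetters h σ) x) := fun σ =>
    (sum_gap (excLetters h σ) fun j =>
      f (excLvl (h + 1) σ + if excLvl (h + 1) σ + h < j then 1 else 0)
        (denLvl (h + 1) σ + j)).symm
  simp only [hgap, denLvl_insertExc hn]
  refine (sum_congr rfl fun σ _ => hsplit _).trans
    (Eq.trans ?_ (sum_congr rfl fun σ _ => (hsplit _).symm))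
  rw [sum_add_distrib, sum_add_distrib]
  congr 1
  · rcases Nat.eq_zero_or_pos h with rfl | hpos
    · simp
    obtain ⟨l, rfl⟩ : ∃ l : Fin n, h = l + 1 := ⟨⟨h - 1, by omega⟩, by simp only; omega⟩
    have hfirst := sum_first_places l f
    simp only [← sum_ite_lt (hn.trans n.le_succ)] at hfirst
    refine (sum_congr rfl fun σ _ => sum_congr rfl fun x _ => ite_congr rfl (fun hx => ?_)
      fun _ => rfl).trans (hfirst.trans (sum_congr rfl fun σ _ => sum_congr rfl fun x _ =>
        ite_congr rfl (fun hx => ?_) fun _ => rfl))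
    · rw [excLvl_insertExc_of_lt σ rfl hx, gap_excLetters_of_lt hn σ hx]
    · rw [gap_excLetters_of_lt hn σ hx]
      congr 2
      refine if_congr ?_ rfl rfl
      omega
  · refine sum_congr rfl fun σ _ => sum_congr rfl fun x _ => ite_congr rfl (fun _ => rfl)
      fun hx => ?_
    rw [excLvl_insertExc_of_le_eq_gap hn σ (not_lt.1 hx)]

lemma excLvl_eq_rdes_of_le {n h : ℕ} (hn : n ≤ h) (σ : Equiv.Perm (Fin n)) :
    excLvl (h + 1) σ = rdes (h + 1) σ := by
  rw [excLvl_eq_sum, rdes_eq_sum]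
  refine sum_congr rfl fun i _ => if_congr (iff_of_false ?_ ?_) rfl rfl
  · rintro ⟨-, hi⟩
    omega
  · intro hi
    have := hi.add_le
    omega

lemma denLvl_eq_rmaj_of_le {n h : ℕ} (hn : n ≤ h) (σ : Equiv.Perm (Fin n)) :
    denLvl (h + 1) σ = rmaj (h + 1) σ := by
  have hE : ∀ i, ¬ IsExc h σ i := by
    rintro i ⟨-, hi⟩
    omega
  have hD : ∀ j, ¬ IsDescBottom (h + 1) σ j := by
    intro j hj
    have := hj.add_le
    omega
  rw [denLvl_eq_sum, rmaj_eq_sum]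
  simp only [hE, hD, if_false, true_and]
  congr 1
  refine sum_congr rfl fun i _ => sum_congr rfl fun j _ => if_congr ?_ rfl rfl
  have := (σ i).is_lt
  omega

lemma sum_excLvl_denLvl (h n : ℕ) (f : ℕ → ℕ → ℕ) :
    ∑ σ : Equiv.Perm (Fin n), f (excLvl (h + 1) σ) (denLvl (h + 1) σ) =
      ∑ σ : Equiv.Perm (Fin n), f (rdes (h + 1) σ) (rmaj (h + 1) σ) := by
  induction n generalizing f with
  | zero => simp only [excLvl_eq_rdes_of_le h.zero_le, denLvl_eq_rmaj_of_le h.zero_le]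
  | succ n ih =>
    rcases le_or_gt h n with hn | hn
    · rw [sum_perm_eq_sum_insert (insertExc_injective hn),
        sum_perm_eq_sum_insert insertMax_injective, sum_insertExc hn]
      simp only [sum_insertMax hn]
      exact ih fun k d => ∑ j ∈ range (n + 1), f (k + if k + h < j then 1 else 0) (d + j)
    · simp only [excLvl_eq_rdes_of_le hn, denLvl_eq_rmaj_of_le hn]

/-- Theorem 1.1 (Huang–Lin–Yan): the pair `(exc_r, den_r)` is `r`-Euler–Mahonian. -/
theorem excLvl_denLvl_r_is_r_euler_mahonian (r n : ℕ) (hr : 1 ≤ r) (hn : 1 ≤ n) (a b : ℕ) :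
    ((univ : Finset (Equiv.Perm (Fin n))).filter fun σ =>
        excLvl r σ = a ∧ denLvl r σ = b).card
      = ((univ : Finset (Equiv.Perm (Fin n))).filter fun σ =>
          rdes r σ = a ∧ rmaj r σ = b).card := by
  obtain ⟨h, rfl⟩ := Nat.exists_eq_add_of_le' hr
  rw [card_filter, card_filter]
  exact sum_excLvl_denLvl h n fun k d => if k = a ∧ d = b then 1 else 0

end PaperStmt
end

section
/- For all integers g, ℓ ≥ 1 and every n ≥ 1, the pair (g exc_ℓ, g den_ℓ) is equidistributed with (rdes, rmaj) over S_n where r = g + ℓ − 1; that is, for all integers a, b, the number of σ ∈ S_n with g exc_ℓ(σ) = a and g den_ℓ(σ) = b equals the number of σ ∈ S_n with rdes(σ) = a and rmaj(σ) = b. (Theorem 1.2(1), Huang–Yan: (g exc_ℓ, g den_ℓ) is (g+ℓ−1)-Euler–Mahonian.) -/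
open Finset

namespace PaperStmt

/-- The sum of `R σ_p σ_q` over the pairs of positions `p < q`. -/
def pairSum {n : ℕ} (R : ℕ → ℕ → ℤ) (τ : Equiv.Perm (Fin n)) : ℤ :=
  ∑ p, ∑ q, if p < q then R (τ p) (τ q) else 0

/-- The sum of `F i σ_i` over the (0-based) positions `i`. -/
def rowSum {n : ℕ} (F : ℕ → ℕ → ℤ) (τ : Equiv.Perm (Fin n)) : ℤ :=
  ∑ i : Fin n, F i (τ i)

theorem rowSum_mul_swap {n : ℕ} (F : ℕ → ℕ → ℤ) (τ : Equiv.Perm (Fin n)) {i j : Fin n}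
    (hij : i ≠ j) :
    rowSum F (τ * Equiv.swap i j)
      = rowSum F τ - F i (τ i) - F j (τ j) + F i (τ j) + F j (τ i) := by
  have key : ∀ k : Fin n, F k ((τ * Equiv.swap i j) k) = F k (τ k)
      + (if k = i then F i (τ j) - F i (τ i) else 0)
      + (if k = j then F j (τ i) - F j (τ j) else 0) := by
    intro k
    rw [Equiv.Perm.mul_apply]
    by_cases h1 : k = i
    · subst h1; simp [hij]
    · by_cases h2 : k = j
      · subst h2; simp [h1]
      · simp [h1, h2, Equiv.swap_apply_of_ne_of_ne]
  unfold rowSum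
  rw [Finset.sum_congr rfl fun k _ => key k]
  simp only [Finset.sum_add_distrib, Finset.sum_ite_eq', Finset.mem_univ, if_true]
  ring

theorem pairSum_mul_swap {n : ℕ} (R : ℕ → ℕ → ℤ) (τ : Equiv.Perm (Fin n)) {i j : Fin n}
    (hij : i < j) :
    pairSum R (τ * Equiv.swap i j)
      = pairSum R τ + R (τ j) (τ i) - R (τ i) (τ j)
        + ∑ k, if i < k ∧ k < j then
            R (τ j) (τ k) + R (τ k) (τ i) - R (τ i) (τ k) - R (τ k) (τ j) else 0 := by
  have reindex : pairSum R (τ * Equiv.swap i j)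
      = ∑ p, ∑ q, if Equiv.swap i j p < Equiv.swap i j q then R (τ p) (τ q) else 0 := by
    unfold pairSum
    rw [← Equiv.sum_comp (Equiv.swap i j)]
    refine Finset.sum_congr rfl fun p _ => ?_
    rw [← Equiv.sum_comp (Equiv.swap i j)]
    refine Finset.sum_congr rfl fun q _ => ?_
    simp
  have key : ∀ p q : Fin n,
      (if Equiv.swap i j p < Equiv.swap i j q then R (τ p) (τ q) else 0)
      = (if p < q then R (τ p) (τ q) else 0)
        + (if p = i then (if q = j then - R (τ i) (τ j) else 0) else 0)
        + (if p = j then (if q = i then R (τ j) (τ i) else 0) else 0)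
        + (if p = i then (if i < q ∧ q < j then - R (τ i) (τ q) else 0) else 0)
        + (if p = j then (if i < q ∧ q < j then R (τ j) (τ q) else 0) else 0)
        + (if q = i then (if i < p ∧ p < j then R (τ p) (τ i) else 0) else 0)
        + (if q = j then (if i < p ∧ p < j then - R (τ p) (τ j) else 0) else 0) := by
    intro p q
    have hji : j ≠ i := hij.ne'
    have hnot : ¬ j < i := hij.not_gt
    by_cases p1 : p = i
    · subst p1
      by_cases q1 : q = p
      · subst q1; simp [hij.ne]
      · by_cases q2 : q = j
        · subst q2; simp [hij, hnot, hji, hij.ne]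
        · rw [Equiv.swap_apply_left, Equiv.swap_apply_of_ne_of_ne q1 q2]
          simp only [q1, q2, hij.ne, if_true, if_false, add_zero]
          split_ifs <;> first | (exfalso; omega) | simp
    · by_cases p2 : p = j
      · subst p2
        by_cases q1 : q = i
        · subst q1; simp [hij, hnot, hji, hij.ne]
        · by_cases q2 : q = p
          · subst q2; simp [hji]
          · rw [Equiv.swap_apply_right, Equiv.swap_apply_of_ne_of_ne q1 q2]
            simp only [q1, q2, hji, if_true, if_false, add_zero]
            split_ifs <;> first | (exfalso; omega) | simp
      · rw [Equiv.swap_apply_of_ne_of_ne p1 p2]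
        by_cases q1 : q = i
        · subst q1
          rw [Equiv.swap_apply_left]
          simp only [p1, p2, hij.ne, if_true, if_false, add_zero]
          split_ifs <;> first | (exfalso; omega) | simp
        · by_cases q2 : q = j
          · subst q2
            rw [Equiv.swap_apply_right]
            simp only [p1, p2, q1, if_true, if_false, add_zero]
            split_ifs <;> first | (exfalso; omega) | simp
          · rw [Equiv.swap_apply_of_ne_of_ne q1 q2]
            simp [p1, p2, q1, q2]
  have swapcond : ∀ (c : Fin n) (G : Fin n → ℤ),
      ∑ p, ∑ q, (if p = c then G q else 0) = ∑ q, G q := by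
    intro c G
    rw [Finset.sum_comm]
    simp
  rw [reindex, Finset.sum_congr rfl fun p _ => Finset.sum_congr rfl fun q _ => key p q]
  simp only [Finset.sum_add_distrib, swapcond, Finset.sum_ite_eq', Finset.mem_univ, if_true]
  have expand : (∑ k, if i < k ∧ k < j then
            R (τ j) (τ k) + R (τ k) (τ i) - R (τ i) (τ k) - R (τ k) (τ j) else 0)
      = (∑ k, if i < k ∧ k < j then - R (τ i) (τ k) else 0)
        + (∑ k, if i < k ∧ k < j then R (τ j) (τ k) else 0)
        + (∑ k, if i < k ∧ k < j then R (τ k) (τ i) else 0)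
        + (∑ k, if i < k ∧ k < j then - R (τ k) (τ j) else 0) := by
    simp only [← Finset.sum_add_distrib]
    refine Finset.sum_congr rfl fun k _ => ?_
    split_ifs <;> ring
  rw [expand]
  unfold pairSum
  ring

theorem pairSum_mul_swap_adj {n : ℕ} (R : ℕ → ℕ → ℤ) (τ : Equiv.Perm (Fin n)) {i j : Fin n}
    (hij : (i : ℕ) + 1 = j) :
    pairSum R (τ * Equiv.swap i j) = pairSum R τ + R (τ j) (τ i) - R (τ i) (τ j) := by
  rw [pairSum_mul_swap R τ (show i < j by omega), Finset.sum_eq_zero, add_zero]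
  intro k _
  rw [if_neg (by omega)]

/-- The number of inversions as an integer. -/
def invZ {n : ℕ} (τ : Equiv.Perm (Fin n)) : ℤ :=
  pairSum (fun a b => if b < a then 1 else 0) τ

/-- The weight of the letter `v` at position `i` (both 0-based) in `gden`. -/
def excWeight (g h i v : ℕ) : ℤ :=
  if i + g ≤ v ∧ h ≤ v then 2 * (i : ℤ) + g - v else 0

/-- A closed form of `gden g (h + 1)`. -/
def excDen {n : ℕ} (g h : ℕ) (τ : Equiv.Perm (Fin n)) : ℤ :=
  invZ τ + rowSum (excWeight g h) τ

/-- An integer version of `gexc g (L + 1)`. -/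
def excNum {n : ℕ} (g L : ℕ) (τ : Equiv.Perm (Fin n)) : ℤ :=
  rowSum (fun i v => if L ≤ i ∧ i + g ≤ v then 1 else 0) τ

theorem sum_lt_val {n : ℕ} (p : Fin n) : ∑ q : Fin n, (if q < p then (1 : ℤ) else 0) = p := by
  rw [Finset.sum_boole, Finset.filter_gt_eq_Iio, Fin.card_Iio]

theorem gexc_eq_excNum {n : ℕ} (g l : ℕ) (hl : 1 ≤ l) (σ : Equiv.Perm (Fin n)) :
    (gexc g l σ : ℤ) = excNum g (l - 1) σ := by
  unfold gexc excNum rowSum pos1 val1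
  rw [Finset.card_filter]
  push_cast
  refine Finset.sum_congr rfl fun i _ => ?_
  split_ifs <;> first | rfl | (exfalso; omega)

theorem invOn_eq {n : ℕ} (σ : Equiv.Perm (Fin n)) (P : Fin n → Prop) [DecidablePred P] :
    (invOn σ P : ℤ)
      = ∑ p, ∑ q, if p < q ∧ P p ∧ P q ∧ σ q < σ p then (1 : ℤ) else 0 := by
  unfold invOn val1
  rw [Finset.card_filter, Fintype.sum_prod_type]
  push_cast
  refine Finset.sum_congr rfl fun p _ => Finset.sum_congr rfl fun q _ => ?_
  simp only [Nat.add_lt_add_iff_right, Fin.val_fin_lt]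

theorem gden_eq_excDen {n : ℕ} (g l : ℕ) (hl : 1 ≤ l) (σ : Equiv.Perm (Fin n)) :
    (gden g l σ : ℤ) = excDen g (l - 1) σ := by
  set e : Fin n → Prop := fun i => (i : ℕ) + g ≤ σ i ∧ l - 1 ≤ (σ i : ℕ) with he
  have hP : ∀ i : Fin n, (pos1 i + g ≤ val1 σ i ∧ l ≤ val1 σ i) ↔ e i := by
    intro i; simp only [he, pos1, val1]; omega
  have hup : ∀ p q : Fin n, p < q → σ q < σ p → e q → e p := by
    intro p q h1 h2 h3
    simp only [he] at *
    rw [Fin.lt_def] at h1 h2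
    omega
  unfold gden
  push_cast
  rw [invOn_eq, invOn_eq]
  simp only [hP]
  have hsum : ∑ i with e i, ((pos1 i + g - 1 : ℕ) : ℤ)
      = ∑ i, if e i then ((i : ℤ) + g) else 0 := by
    rw [Finset.sum_filter]
    refine Finset.sum_congr rfl fun i _ => ?_
    split_ifs
    · simp only [pos1]; push_cast [show i.val + 1 + g - 1 = i.val + g by omega]; ring
    · rfl
  have hval : ∀ p : Fin n, ((σ p : ℕ) : ℤ) - p
      = (∑ q, if p < q ∧ σ q < σ p then (1 : ℤ) else 0)
        - ∑ q, if q < p ∧ σ p < σ q then (1 : ℤ) else 0 := by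
    intro p
    rw [← sum_lt_val p, ← sum_lt_val (σ p), ← Equiv.sum_comp σ, ← Finset.sum_sub_distrib,
      ← Finset.sum_sub_distrib]
    refine Finset.sum_congr rfl fun q _ => ?_
    rcases lt_trichotomy p q with h | h | h
    · simp [h, h.not_gt]
    · subst h; simp
    · have : σ q ≠ σ p := fun hh => h.ne (σ.injective hh)
      rcases lt_or_gt_of_ne this with h2 | h2
      · simp [h, h.not_gt, h2, h2.not_gt]
      · simp [h, h.not_gt, h2, h2.not_gt]
  have hmix : (∑ p, ∑ q, if p < q ∧ σ q < σ p ∧ e p ∧ ¬ e q then (1 : ℤ) else 0)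
      = ∑ p, if e p then ((σ p : ℕ) : ℤ) - p else 0 := by
    have h1 : ∀ p, (if e p then ((σ p : ℕ) : ℤ) - p else 0)
        = (∑ q, if p < q ∧ σ q < σ p ∧ e p ∧ ¬ e q then (1 : ℤ) else 0)
          + (∑ q, if p < q ∧ σ q < σ p ∧ e p ∧ e q then (1 : ℤ) else 0)
          - ∑ q, if q < p ∧ σ p < σ q ∧ e q ∧ e p then (1 : ℤ) else 0 := by
      intro p
      by_cases hp : e p
      · rw [if_pos hp, hval, ← Finset.sum_add_distrib]
        congr 1
        · refine Finset.sum_congr rfl fun q _ => ?_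
          by_cases hq : e q <;> simp [hp, hq]
        · refine Finset.sum_congr rfl fun q _ => ?_
          by_cases hh : q < p ∧ σ p < σ q
          · simp [hh.1, hh.2, hp, hup q p hh.1 hh.2 hp]
          · rw [if_neg hh, if_neg (by tauto)]
      · simp [hp]
    rw [Finset.sum_congr rfl fun p _ => h1 p, Finset.sum_sub_distrib, Finset.sum_add_distrib]
    rw [Finset.sum_comm (f := fun p q => if q < p ∧ σ p < σ q ∧ e q ∧ e p then (1 : ℤ) else 0)]
    ring
  have hinv : invZ σ = (∑ p, ∑ q, if p < q ∧ e p ∧ e q ∧ σ q < σ p then (1 : ℤ) else 0)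
      + (∑ p, ∑ q, if p < q ∧ ¬ e p ∧ ¬ e q ∧ σ q < σ p then (1 : ℤ) else 0)
      + (∑ p, ∑ q, if p < q ∧ σ q < σ p ∧ e p ∧ ¬ e q then (1 : ℤ) else 0) := by
    unfold invZ pairSum
    simp only [← Finset.sum_add_distrib]
    refine Finset.sum_congr rfl fun p _ => Finset.sum_congr rfl fun q _ => ?_
    by_cases h1 : p < q
    · by_cases h2 : σ q < σ p
      · have := hup p q h1 h2
        by_cases hp : e p
        · by_cases hq : e q <;> simp only [h1, h2, hp, hq] <;> simpa using h2
        · have hq : ¬ e q := fun hq => hp (this hq)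
          simp only [h1, h2, hp, hq]; simpa using h2
      · simp [h2]
    · simp [h1]
  have hw : rowSum (excWeight g (l - 1)) σ
      = (∑ i, if e i then ((i : ℤ) + g) else 0) - ∑ p, if e p then ((σ p : ℕ) : ℤ) - p else 0 := by
    unfold rowSum excWeight
    rw [← Finset.sum_sub_distrib]
    refine Finset.sum_congr rfl fun i _ => ?_
    simp only [he]
    split_ifs <;> ring
  unfold excDen
  rw [hinv, hw, hmix, hsum]
  ring

/-- The code of the slot `s` relative to the set `A` of slots: the slots in `A` are numbered from
right to left by `0, 1, …`, and then the remaining ones from left to right. -/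
def slotCode (A : Finset ℕ) (s : ℕ) : ℕ :=
  (A.filter fun a => s < a).card + if s ∈ A then 0 else s

theorem slotCode_of_notMem {A : Finset ℕ} {s : ℕ} (hs : s ∉ A) :
    slotCode A s = A.card + ((range s).filter fun b => b ∉ A).card := by
  have h1 := Finset.card_filter_add_card_filter_not (s := A) (fun a => s < a)
  have h2 := Finset.card_filter_add_card_filter_not (s := range s) (fun b => b ∉ A)
  have h3 : (A.filter fun a => ¬ s < a) = (range s).filter fun b => ¬ b ∉ A := by
    ext a
    simp only [mem_filter, mem_range, not_not, not_lt]
    constructor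
    · rintro ⟨h, h'⟩
      exact ⟨lt_of_le_of_ne h' fun hh => hs (hh ▸ h), h⟩
    · rintro ⟨h, h'⟩
      exact ⟨h', h.le⟩
  rw [h3] at h1
  rw [card_range] at h2
  rw [slotCode, if_neg hs]
  omega

theorem slotCode_lt_card {A : Finset ℕ} {s : ℕ} (hs : s ∈ A) : slotCode A s < A.card := by
  rw [slotCode, if_pos hs, add_zero]
  exact Finset.card_lt_card (Finset.filter_ssubset.2 ⟨s, hs, lt_irrefl s⟩)

theorem card_add_le_slotCode {A : Finset ℕ} {s m : ℕ} (hs : s ∉ A) (hms : m ≤ s)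
    (hm : ∀ b < m, b ∉ A) : A.card + m ≤ slotCode A s := by
  rw [slotCode_of_notMem hs]
  have : range m ⊆ (range s).filter fun b => b ∉ A := by
    intro b hb
    rw [mem_range] at hb
    exact mem_filter.2 ⟨mem_range.2 (by omega), hm b hb⟩
  simpa using Finset.card_le_card this

theorem slotCode_eq_of_forall_lt {A : Finset ℕ} {s : ℕ} (hs : ∀ b ≤ s, b ∉ A) :
    slotCode A s = A.card + s := by
  rw [slotCode, if_neg (hs s le_rfl), Finset.filter_true_of_mem]
  intro a ha
  by_contra h
  exact hs a (not_lt.1 h) ha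

theorem slotCode_le {A : Finset ℕ} {N s : ℕ} (hA : A ⊆ range (N + 1)) (hs : s ≤ N) :
    slotCode A s ≤ N := by
  by_cases h : s ∈ A
  · have h1 := slotCode_lt_card h
    have h2 := Finset.card_le_card hA
    rw [card_range] at h2
    omega
  · rw [slotCode_of_notMem h, ← Finset.card_union_of_disjoint]
    · have : A ∪ (range s).filter (fun b => b ∉ A) ⊆ (range (N + 1)).erase s := by
        intro b hb
        rw [mem_union, mem_filter, mem_range] at hb
        rw [mem_erase, mem_range]
        rcases hb with hb | hb
        · exact ⟨fun hh => h (hh ▸ hb), mem_range.1 (hA hb)⟩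
        · omega
      have := Finset.card_le_card this
      rw [Finset.card_erase_of_mem (mem_range.2 (by omega)), card_range] at this
      exact this
    · rw [Finset.disjoint_left]
      intro b hb hb'
      exact (mem_filter.1 hb').2 hb

theorem slotCode_ne {A : Finset ℕ} {s t : ℕ} (hst : s < t) : slotCode A s ≠ slotCode A t := by
  by_cases hs : s ∈ A <;> by_cases ht : t ∈ A
  · rw [slotCode, slotCode, if_pos hs, if_pos ht, add_zero, add_zero]
    refine (Finset.card_lt_card ⟨?_, ?_⟩).ne'
    · intro a ha
      rw [mem_filter] at *
      exact ⟨ha.1, by omega⟩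
    · intro h
      exact absurd (mem_filter.1 (h (mem_filter.2 ⟨ht, hst⟩))).2 (lt_irrefl t)
  · have h1 := slotCode_lt_card hs
    have h2 := slotCode_of_notMem ht
    omega
  · have h1 := slotCode_lt_card ht
    have h2 := slotCode_of_notMem hs
    omega
  · rw [slotCode_of_notMem hs, slotCode_of_notMem ht]
    have : (range s).filter (fun b => b ∉ A) ⊂ (range t).filter fun b => b ∉ A := by
      refine ⟨?_, ?_⟩
      · intro a ha
        rw [mem_filter, mem_range] at *
        exact ⟨by omega, ha.2⟩
      · intro h
        exact absurd (mem_range.1 (mem_filter.1 (h (mem_filter.2 ⟨mem_range.2 hst, hs⟩))).1)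
          (lt_irrefl s)
    have := Finset.card_lt_card this
    omega

theorem slotCode_injOn {A : Finset ℕ} : Function.Injective (slotCode A) := by
  intro s t h
  rcases lt_trichotomy s t with hst | hst | hst
  · exact absurd h (slotCode_ne hst)
  · exact hst
  · exact absurd h.symm (slotCode_ne hst)

/-- How the code changes when moving one slot to the left. -/
theorem slotCode_pred (A : Finset ℕ) (s : ℕ) :
    (slotCode A s : ℤ) = slotCode A (s + 1)
      + (if s + 1 ∈ A then 1 else -(s + 1 : ℤ)) + if s ∈ A then 0 else (s : ℤ) := by
  have h : (A.filter fun a => s < a).card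
      = (A.filter fun a => s + 1 < a).card + if s + 1 ∈ A then 1 else 0 := by
    have : (A.filter fun a => s < a)
        = (A.filter fun a => s + 1 < a) ∪ A.filter fun a => a = s + 1 := by
      rw [← Finset.filter_or]
      exact Finset.filter_congr fun a _ => by omega
    rw [this, Finset.card_union_of_disjoint]
    · congr 1
      rw [Finset.filter_eq']
      split_ifs <;> rfl
    · exact Finset.disjoint_filter.2 fun a _ h1 h2 => by omega
  rw [slotCode, slotCode, h]
  push_cast
  split_ifs <;> ring

theorem slotCode_self {A : Finset ℕ} {N : ℕ} (hA : A ⊆ range (N + 1)) (hN : N ∈ A) :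
    slotCode A N = 0 := by
  rw [slotCode, if_pos hN, add_zero, Finset.card_eq_zero, Finset.filter_eq_empty_iff]
  intro a ha
  have := mem_range.1 (hA ha)
  omega

/-- `IsInsertion r k d k' d'` : the permutations of `N + 1` letters arise from those of `N`
letters by insertions that change the pair of statistics `(k, d)` into `(k', d')`
in the standard `r`-Euler–Mahonian way. -/
def IsInsertion {N : ℕ} (r : ℕ) (k d : Equiv.Perm (Fin N) → ℤ)
    (k' d' : Equiv.Perm (Fin (N + 1)) → ℤ) : Prop :=
  ∃ G : Equiv.Perm (Fin N) × Fin (N + 1) ≃ Equiv.Perm (Fin (N + 1)), ∀ σ c,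
    d' (G (σ, c)) = d σ + (c : ℕ) ∧
    k' (G (σ, c)) = k σ + if k σ + r ≤ (c : ℕ) then 1 else 0

theorem isInsertion_of_slots {N r : ℕ} {k d : Equiv.Perm (Fin N) → ℤ}
    {k' d' : Equiv.Perm (Fin (N + 1)) → ℤ} (A : Equiv.Perm (Fin N) → Finset ℕ)
    (hA : ∀ σ, A σ ⊆ range (N + 1))
    (F : Fin (N + 1) → Equiv.Perm (Fin N) → Equiv.Perm (Fin (N + 1)))
    (hF : ∀ s, Function.Injective (F s))
    (hdisj : ∀ s t σ τ, F s σ = F t τ → s = t)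
    (hd : ∀ s σ, d' (F s σ) = d σ + slotCode (A σ) s)
    (hk : ∀ s σ, k' (F s σ) = k σ + if k σ + r ≤ slotCode (A σ) s then 1 else 0) :
    IsInsertion r k d k' d' := by
  have hcinj : ∀ σ, Function.Injective
      fun s : Fin (N + 1) => (⟨slotCode (A σ) s,
        Nat.lt_succ_of_le (slotCode_le (hA σ) (Nat.le_of_lt_succ s.2))⟩ : Fin (N + 1)) := by
    intro σ s t hst
    exact Fin.ext (slotCode_injOn (Fin.mk.inj_iff.1 hst))
  let c : ∀ σ : Equiv.Perm (Fin N), Fin (N + 1) ≃ Fin (N + 1) := fun σ =>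
    Equiv.ofBijective _ (Finite.injective_iff_bijective.1 (hcinj σ))
  have hc : ∀ σ s, ((c σ s : Fin (N + 1)) : ℕ) = slotCode (A σ) s := fun σ s => rfl
  let H : Equiv.Perm (Fin N) × Fin (N + 1) → Equiv.Perm (Fin (N + 1)) :=
    fun p => F ((c p.1).symm p.2) p.1
  have hH : Function.Bijective H := by
    rw [Fintype.bijective_iff_injective_and_card]
    constructor
    · rintro ⟨σ, x⟩ ⟨τ, y⟩ h
      have h1 := hdisj _ _ _ _ h
      have h2 : σ = τ := by
        refine hF ((c σ).symm x) ?_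
        conv_rhs => rw [show (c σ).symm x = (c τ).symm y from h1]
        exact h
      subst h2
      simpa using h1
    · simp [Fintype.card_perm, Nat.factorial_succ, mul_comm]
  refine ⟨Equiv.ofBijective H hH, fun σ x => ?_⟩
  have hx : slotCode (A σ) ((c σ).symm x) = x := by rw [← hc, Equiv.apply_symm_apply]
  refine ⟨?_, ?_⟩
  · rw [Equiv.ofBijective_apply, hd, hx]
  · rw [Equiv.ofBijective_apply, hk, hx]

theorem exists_equiv_of_isInsertion (r : ℕ) (k₁ d₁ k₂ d₂ : ∀ n, Equiv.Perm (Fin n) → ℤ)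
    (hbase : ∀ n ≤ r, k₁ n = k₂ n ∧ d₁ n = d₂ n)
    (h₁ : ∀ N, r ≤ N → IsInsertion r (k₁ N) (d₁ N) (k₁ (N + 1)) (d₁ (N + 1)))
    (h₂ : ∀ N, r ≤ N → IsInsertion r (k₂ N) (d₂ N) (k₂ (N + 1)) (d₂ (N + 1))) (n : ℕ) :
    ∃ e : Equiv.Perm (Equiv.Perm (Fin n)), ∀ σ, k₂ n (e σ) = k₁ n σ ∧ d₂ n (e σ) = d₁ n σ := by
  rcases le_total n r with hn | hn
  · exact ⟨Equiv.refl _, fun σ => by simp [hbase n hn]⟩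
  induction n, hn using Nat.le_induction with
  | base => exact ⟨Equiv.refl _, fun σ => by simp [hbase r le_rfl]⟩
  | succ N hN ih =>
    obtain ⟨e, he⟩ := ih
    obtain ⟨G₁, hG₁⟩ := h₁ N hN
    obtain ⟨G₂, hG₂⟩ := h₂ N hN
    refine ⟨G₁.symm.trans ((e.prodCongr (Equiv.refl _)).trans G₂), fun σ => ?_⟩
    obtain ⟨⟨τ, c⟩, rfl⟩ := G₁.surjective σ
    have h1 := hG₁ τ c
    have h2 := hG₂ (e τ) c
    have h3 := he τ
    simp only [Equiv.trans_apply, Equiv.symm_apply_apply, Equiv.prodCongr_apply, Prod.map_apply,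
      Equiv.refl_apply]
    rw [h1.1, h1.2, h2.1, h2.2, h3.1, h3.2]
    exact ⟨rfl, rfl⟩

theorem invZ_mul_swap_adj {n : ℕ} (τ : Equiv.Perm (Fin n)) {i j : Fin n}
    (hij : (i : ℕ) + 1 = j) :
    invZ (τ * Equiv.swap i j) = invZ τ + if (τ i : ℕ) < τ j then 1 else -1 := by
  have hne : (τ i : ℕ) ≠ τ j := fun h => by
    have := τ.injective (Fin.ext h)
    rw [this] at hij
    omega
  unfold invZ
  rw [pairSum_mul_swap_adj _ τ hij]
  split_ifs <;> first | (exfalso; omega) | ring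

theorem excNum_mul_swap_of_lt {n : ℕ} {g L : ℕ} (τ : Equiv.Perm (Fin n)) {i j : Fin n}
    (hi : (i : ℕ) < L) (hj : (j : ℕ) < L) :
    excNum g L (τ * Equiv.swap i j) = excNum g L τ := by
  by_cases hij : i = j
  · subst hij; simp [← Equiv.Perm.one_def]
  unfold excNum
  rw [rowSum_mul_swap _ τ hij]
  simp [hi.not_ge, hj.not_ge]

theorem excDen_succ {n : ℕ} (g v : ℕ) (hv : v < n) (τ : Equiv.Perm (Fin n)) :
    excDen g v τ = excDen g (v + 1) τ
      + if (τ.symm ⟨v, hv⟩ : ℕ) + g ≤ v then 2 * ((τ.symm ⟨v, hv⟩ : ℕ) : ℤ) + g - v else 0 := by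
  unfold excDen
  rw [add_assoc]
  congr 1
  have : ∀ i : Fin n, excWeight g v i (τ i) = excWeight g (v + 1) i (τ i)
      + if i = τ.symm ⟨v, hv⟩ then
          (if (τ.symm ⟨v, hv⟩ : ℕ) + g ≤ v then 2 * ((τ.symm ⟨v, hv⟩ : ℕ) : ℤ) + g - v else 0)
        else 0 := by
    intro i
    by_cases h : i = τ.symm ⟨v, hv⟩
    · have h' : (τ i : ℕ) = v := by rw [h, Equiv.apply_symm_apply]
      rw [if_pos h, ← h]
      unfold excWeight
      rw [h']
      simp
    · have h' : (τ i : ℕ) ≠ v := by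
        intro hh
        exact h (by rw [Equiv.eq_symm_apply]; exact Fin.ext hh)
      rw [if_neg h]
      unfold excWeight
      split_ifs <;> first | (exfalso; omega) | simp
  unfold rowSum
  rw [Finset.sum_congr rfl fun i _ => this i, Finset.sum_add_distrib, Finset.sum_ite_eq',
    if_pos (Finset.mem_univ _)]

theorem card_excDen_row_succ {n g L v : ℕ} (hv : v < n) (hvr : v < g + L) {i : ℕ}
    (hi : i + 1 + g ≤ v) (a b : ℤ) :
    #{τ : Equiv.Perm (Fin n) | (τ.symm ⟨v, hv⟩ : ℕ) = i ∧ excNum g L τ = a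
        ∧ excDen g (v + 1) τ = b}
      = #{τ : Equiv.Perm (Fin n) | (τ.symm ⟨v, hv⟩ : ℕ) = i + 1 ∧ excNum g L τ = a
        ∧ excDen g (v + 1) τ = b - 1} := by
  let p : Fin n := ⟨i, by omega⟩
  let q : Fin n := ⟨i + 1, by omega⟩
  have hpq : p ≠ q := fun h => by simp [p, q] at h
  refine Finset.card_equiv (Equiv.mulRight (Equiv.swap p q)) fun τ => ?_
  rw [mem_filter_univ, mem_filter_univ, Equiv.coe_mulRight,
    excNum_mul_swap_of_lt τ (show i < L by omega) (show i + 1 < L by omega)]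
  have hrow : ((τ * Equiv.swap p q).symm ⟨v, hv⟩ : ℕ) = i + 1 ↔ (τ.symm ⟨v, hv⟩ : ℕ) = i := by
    have h1 : ((τ * Equiv.swap p q).symm ⟨v, hv⟩ : ℕ) = i + 1
        ↔ (τ * Equiv.swap p q).symm ⟨v, hv⟩ = q := by simp [Fin.ext_iff, q]
    have h2 : (τ.symm ⟨v, hv⟩ : ℕ) = i ↔ τ.symm ⟨v, hv⟩ = p := by simp [Fin.ext_iff, p]
    rw [h1, h2, Equiv.symm_apply_eq, Equiv.symm_apply_eq, Equiv.Perm.mul_apply,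
      Equiv.swap_apply_right]
  rw [hrow]
  refine and_congr_right fun h => and_congr_right fun _ => ?_
  have hp : (τ p : ℕ) = v := by
    rw [show p = τ.symm ⟨v, hv⟩ from Fin.ext h.symm, Equiv.apply_symm_apply]
  have hq : (τ q : ℕ) ≠ v := fun hh => hpq (τ.injective (Fin.ext (hp.trans hh.symm)))
  have : excDen g (v + 1) (τ * Equiv.swap p q) = excDen g (v + 1) τ - 1 := by
    unfold excDen
    rw [invZ_mul_swap_adj τ (show (p : ℕ) + 1 = q from rfl), rowSum_mul_swap _ τ hpq, hp]
    unfold excWeight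
    simp only [p, q]
    split_ifs <;> first | (exfalso; omega) | (push_cast; ring)
  rw [this]
  omega

theorem card_excDen_row {n g L v : ℕ} (hv : v < n) (hvr : v < g + L) {i : ℕ}
    (hi : i + g ≤ v) (a b : ℤ) :
    #{τ : Equiv.Perm (Fin n) | (τ.symm ⟨v, hv⟩ : ℕ) = i ∧ excNum g L τ = a
        ∧ excDen g (v + 1) τ = b}
      = #{τ : Equiv.Perm (Fin n) | (τ.symm ⟨v, hv⟩ : ℕ) = 0 ∧ excNum g L τ = a
        ∧ excDen g (v + 1) τ = b + i} := by
  induction i generalizing b with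
  | zero => simp
  | succ i ih =>
    have := card_excDen_row_succ (n := n) hv hvr hi a (b + 1)
    rw [add_sub_cancel_right] at this
    rw [← this, ih (by omega)]
    push_cast
    rw [show b + 1 + (i : ℤ) = b + (i + 1) by ring]

theorem card_excDen_level_succ {n g L v : ℕ} (hvr : v < g + L) (a b : ℤ) :
    #{τ : Equiv.Perm (Fin n) | excNum g L τ = a ∧ excDen g v τ = b}
      = #{τ : Equiv.Perm (Fin n) | excNum g L τ = a ∧ excDen g (v + 1) τ = b} := by
  by_cases hv : v < n
  swap
  · have : ∀ τ : Equiv.Perm (Fin n), excDen g v τ = excDen g (v + 1) τ := by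
      intro τ
      unfold excDen rowSum
      congr 1
      refine Finset.sum_congr rfl fun i _ => ?_
      have := (τ i).2
      rw [excWeight, excWeight, if_neg (by omega), if_neg (by omega)]
    simp only [this]
  have split : ∀ w, #{τ : Equiv.Perm (Fin n) | excNum g L τ = a ∧ excDen g w τ = b}
      = ∑ i ∈ range n, #{τ : Equiv.Perm (Fin n) | (τ.symm ⟨v, hv⟩ : ℕ) = i ∧ excNum g L τ = a
        ∧ excDen g w τ = b} := by
    intro w
    rw [Finset.card_eq_sum_card_fiberwise (f := fun τ => (τ.symm ⟨v, hv⟩ : ℕ)) (t := range n)]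
    · refine Finset.sum_congr rfl fun i _ => congrArg _ ?_
      rw [Finset.filter_filter]
      exact Finset.filter_congr fun τ _ => by tauto
    · intro τ _
      simp
  rw [split, split]
  by_cases hgv : g ≤ v
  swap
  · refine Finset.sum_congr rfl fun i _ => congrArg _ (Finset.filter_congr fun τ _ => ?_)
    rw [excDen_succ g v hv, if_neg (by omega), add_zero]
  have hsplit : ∀ f : ℕ → ℕ, ∑ i ∈ range n, f i
      = ∑ i ∈ range (v - g + 1), f i + ∑ i ∈ Ico (v - g + 1) n, f i := by
    intro f
    rw [Finset.range_eq_Ico, Finset.range_eq_Ico,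
      Finset.sum_Ico_consecutive _ (Nat.zero_le _) (by omega)]
  rw [hsplit, hsplit]
  congr 1
  · rw [← Finset.sum_range_reflect]
    refine Finset.sum_congr rfl fun i hi => ?_
    have hi' := mem_range.1 hi
    rw [card_excDen_row hv hvr (show i + g ≤ v by omega)]
    have hj : v - g + 1 - 1 - i + g ≤ v := by omega
    generalize hjj : v - g + 1 - 1 - i = j at hj
    have : ∀ τ : Equiv.Perm (Fin n), ((τ.symm ⟨v, hv⟩ : ℕ) = j ∧ excNum g L τ = a
        ∧ excDen g v τ = b) ↔ ((τ.symm ⟨v, hv⟩ : ℕ) = j ∧ excNum g L τ = a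
        ∧ excDen g (v + 1) τ = b - (2 * j + g - v)) := by
      intro τ
      refine and_congr_right fun h => and_congr_right fun _ => ?_
      rw [excDen_succ g v hv, h, if_pos hj]
      omega
    simp only [this]
    rw [card_excDen_row hv hvr hj]
    have : b - (2 * (j : ℤ) + g - v) + j = b + i := by omega
    rw [this]
  · refine Finset.sum_congr rfl fun i hi => congrArg _ (Finset.filter_congr fun τ _ => ?_)
    refine and_congr_right fun h => ?_
    have := mem_Ico.1 hi
    rw [excDen_succ g v hv, if_neg (by omega), add_zero]

theorem card_excDen_level {n g L : ℕ} (a b : ℤ) :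
    #{τ : Equiv.Perm (Fin n) | excNum g L τ = a ∧ excDen g L τ = b}
      = #{τ : Equiv.Perm (Fin n) | excNum g L τ = a ∧ excDen g (g + L) τ = b} := by
  have : ∀ m ≤ g, #{τ : Equiv.Perm (Fin n) | excNum g L τ = a ∧ excDen g L τ = b}
      = #{τ : Equiv.Perm (Fin n) | excNum g L τ = a ∧ excDen g (m + L) τ = b} := by
    intro m hm
    induction m with
    | zero => rw [Nat.zero_add]
    | succ m ih =>
      rw [ih (by omega), card_excDen_level_succ (by omega), Nat.add_right_comm]
  exact this g le_rfl

/-- The permutation of `N + 1` letters obtained by appending the largest letter. -/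
def append {N : ℕ} (σ : Equiv.Perm (Fin N)) : Equiv.Perm (Fin (N + 1)) :=
  finSuccEquivLast.symm.permCongr (Equiv.optionCongr σ)

theorem append_castSucc {N : ℕ} (σ : Equiv.Perm (Fin N)) (i : Fin N) :
    append σ i.castSucc = (σ i).castSucc := by
  simp [append, Equiv.permCongr_apply]

theorem append_last {N : ℕ} (σ : Equiv.Perm (Fin N)) : append σ (Fin.last N) = Fin.last N := by
  simp [append, Equiv.permCongr_apply]

theorem append_injective {N : ℕ} :
    Function.Injective (append : Equiv.Perm (Fin N) → Equiv.Perm (Fin (N + 1))) := by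
  intro σ τ h
  ext i
  have := congrArg (fun ρ => ((ρ i.castSucc : Fin (N + 1)) : ℕ)) h
  simpa [append_castSucc] using this

theorem rowSum_append {N : ℕ} (F : ℕ → ℕ → ℤ) (σ : Equiv.Perm (Fin N)) :
    rowSum F (append σ) = rowSum F σ + F N N := by
  unfold rowSum
  rw [Fin.sum_univ_castSucc]
  simp [append_castSucc, append_last]

theorem pairSum_append {N : ℕ} (R : ℕ → ℕ → ℤ) (hR : ∀ a < N, R a N = 0)
    (σ : Equiv.Perm (Fin N)) : pairSum R (append σ) = pairSum R σ := by
  unfold pairSum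
  rw [Fin.sum_univ_castSucc]
  simp only [Fin.sum_univ_castSucc, append_castSucc, append_last, Fin.castSucc_lt_castSucc_iff,
    Fin.val_castSucc, Fin.val_last, Fin.castSucc_lt_last, if_true, lt_irrefl, if_false,
    (Fin.castSucc_lt_last _).not_gt, Finset.sum_const_zero, add_zero]
  refine Finset.sum_congr rfl fun p _ => ?_
  rw [hR _ (σ p).2, add_zero]

/-- The letter at the 1-based position `i`, with `0` on the left of the word and a sentinel `K`
on its right. -/
def letter {n : ℕ} (K : ℕ) (τ : Equiv.Perm (Fin n)) (i : ℕ) : ℕ :=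
  if i = 0 then 0 else if h : i - 1 < n then (τ ⟨i - 1, h⟩ : ℕ) else K

theorem letter_zero {n K : ℕ} (τ : Equiv.Perm (Fin n)) : letter K τ 0 = 0 := rfl

theorem letter_succ {n K : ℕ} (τ : Equiv.Perm (Fin n)) (i : Fin n) :
    letter K τ (i + 1) = τ i := by
  simp [letter]

theorem letter_succ_of_le {n K i : ℕ} (τ : Equiv.Perm (Fin n)) (hi : n ≤ i) :
    letter K τ (i + 1) = K := by
  simp [letter, hi]

theorem letter_lt {n K i : ℕ} (τ : Equiv.Perm (Fin n)) (hi : i ≤ n) (hn : 0 < n) :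
    letter K τ i < n := by
  cases i with
  | zero => exact hn
  | succ i => rw [letter_succ τ ⟨i, hi⟩]; exact (τ _).2

theorem letter_append {N : ℕ} (σ : Equiv.Perm (Fin N)) {i : ℕ} (hi : i ≤ N) :
    letter (N + 1) (append σ) i = letter (N + 1) σ i := by
  cases i with
  | zero => rfl
  | succ i =>
    have h := letter_succ (K := N + 1) (append σ) (Fin.castSucc ⟨i, hi⟩)
    rw [append_castSucc] at h
    rw [letter_succ σ ⟨i, hi⟩]
    exact h

theorem letter_append_self {N : ℕ} (σ : Equiv.Perm (Fin N)) :
    letter (N + 1) (append σ) (N + 1) = N := by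
  have h := letter_succ (K := N + 1) (append σ) (Fin.last N)
  rw [append_last] at h
  exact h

theorem letter_mul_swap {n K : ℕ} (τ : Equiv.Perm (Fin n)) (p q : Fin n) (i : ℕ) :
    letter K (τ * Equiv.swap p q) i
      = if i = p + 1 then letter K τ (q + 1)
        else if i = q + 1 then letter K τ (p + 1) else letter K τ i := by
  rw [letter_succ, letter_succ]
  cases i with
  | zero => simp [letter_zero]
  | succ i =>
    by_cases hi : i < n
    · rw [letter_succ _ ⟨i, hi⟩, letter_succ _ ⟨i, hi⟩, Equiv.Perm.mul_apply, Equiv.swap_apply_def]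
      simp only [Fin.ext_iff, Nat.add_right_cancel_iff]
      split_ifs <;> rfl
    · rw [letter_succ_of_le _ (not_lt.1 hi), letter_succ_of_le _ (not_lt.1 hi),
        if_neg (by omega), if_neg (by omega)]

/-- The sum of `C i` over the `r`-descents `i`. -/
def desSum {n : ℕ} (r K : ℕ) (C : ℕ → ℤ) (τ : Equiv.Perm (Fin n)) : ℤ :=
  ∑ i ∈ range (n + 1), if letter K τ (i + 1) + r ≤ letter K τ i then C i else 0

theorem sum_rdesPairs_s4 {n r K : ℕ} (hr : 1 ≤ r) (hK : n ≤ K) (C : ℕ → ℤ)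
    (τ : Equiv.Perm (Fin n)) : ∑ p ∈ rdesPairs r τ, C (pos1 p.1) = desSum r K C τ := by
  unfold desSum rdesPairs
  rw [Finset.sum_filter, Fintype.sum_prod_type, Finset.sum_range_succ', letter_zero,
    if_neg (by omega), add_zero, Finset.sum_range]
  refine Finset.sum_congr rfl fun p _ => ?_
  rw [letter_succ]
  simp only [pos1, val1]
  by_cases hp : (p : ℕ) + 1 < n
  · rw [letter_succ τ ⟨p + 1, hp⟩, Finset.sum_eq_single ⟨p + 1, hp⟩]
    · simp only [true_and]
      congr 1
      exact propext ⟨fun h => by omega, fun h => by omega⟩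
    · intro q _ hq
      refine if_neg fun h => hq (Fin.ext ?_)
      have := h.1
      simp only
      omega
    · simp
  · rw [letter_succ_of_le _ (not_lt.1 hp)]
    have := (τ p).2
    rw [if_neg (by omega)]
    refine Finset.sum_eq_zero fun q _ => if_neg ?_
    omega

/-- The number of pairs `i < j` with `σ_j < σ_i < σ_j + r`. -/
def closePairs {n : ℕ} (r : ℕ) (τ : Equiv.Perm (Fin n)) : ℤ :=
  pairSum (fun a b => if b < a ∧ a < b + r then 1 else 0) τ

theorem rdes_eq {n r K : ℕ} (hr : 1 ≤ r) (hK : n ≤ K) (τ : Equiv.Perm (Fin n)) :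
    (rdes r τ : ℤ) = desSum r K (fun _ => 1) τ := by
  rw [← sum_rdesPairs_s4 hr hK, rdes]
  simp

theorem rmaj_eq {n r K : ℕ} (hr : 1 ≤ r) (hK : n ≤ K) (τ : Equiv.Perm (Fin n)) :
    (rmaj r τ : ℤ) = desSum r K (fun i => i) τ + closePairs r τ := by
  rw [← sum_rdesPairs_s4 hr hK, rmaj, closePairs, pairSum, Finset.card_filter,
    Fintype.sum_prod_type]
  push_cast
  congr 1
  refine Finset.sum_congr rfl fun p _ => Finset.sum_congr rfl fun q _ => ?_
  simp only [val1]
  rw [← ite_and]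
  exact if_congr (by omega) rfl rfl

theorem sum_range_eq_of_eq_off_three {M t : ℕ} (ht : t + 2 < M) {f f' : ℕ → ℤ}
    (h : ∀ i, i ≠ t → i ≠ t + 1 → i ≠ t + 2 → f' i = f i) :
    ∑ i ∈ range M, f' i = ∑ i ∈ range M, f i + (f' t - f t) + (f' (t + 1) - f (t + 1))
      + (f' (t + 2) - f (t + 2)) := by
  have : ∀ i, f' i = f i + (if i = t then f' t - f t else 0)
      + (if i = t + 1 then f' (t + 1) - f (t + 1) else 0)
      + (if i = t + 2 then f' (t + 2) - f (t + 2) else 0) := by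
    intro i
    by_cases h1 : i = t
    · subst h1; simp
    by_cases h2 : i = t + 1
    · subst h2; simp
    by_cases h3 : i = t + 2
    · subst h3; simp
    simp [h1, h2, h3, h i h1 h2 h3]
  rw [Finset.sum_congr rfl fun i _ => this i]
  simp only [Finset.sum_add_distrib, Finset.sum_ite_eq', mem_range]
  rw [if_pos (by omega), if_pos (by omega), if_pos ht]

/-- The slots of `σ` at which inserting the largest letter creates no new `r`-descent. -/
def majSlots {N : ℕ} (r : ℕ) (σ : Equiv.Perm (Fin N)) : Finset ℕ :=
  {s ∈ range (N + 1) | N < letter (N + 1) σ (s + 1) + r ∨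
    letter (N + 1) σ (s + 1) + r ≤ letter (N + 1) σ s}

theorem card_majSlots {N r : ℕ} (hr : 1 ≤ r) (hN : r ≤ N) (σ : Equiv.Perm (Fin N)) :
    ((majSlots r σ).card : ℤ) = desSum r (N + 1) (fun _ => 1) σ + r := by
  have h1 : ((majSlots r σ).card : ℤ) = desSum r (N + 1) (fun _ => 1) σ
      + ∑ s ∈ range (N + 1), if N < letter (N + 1) σ (s + 1) + r then (1 : ℤ) else 0 := by
    unfold majSlots desSum
    rw [Finset.card_filter, ← Finset.sum_add_distrib]
    push_cast
    refine Finset.sum_congr rfl fun s hs => ?_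
    have := letter_lt (K := N + 1) σ (Nat.le_of_lt_succ (mem_range.1 hs)) (by omega)
    split_ifs <;> first | rfl | (exfalso; omega)
  rw [h1, Finset.sum_range_succ, letter_succ_of_le _ le_rfl, if_pos (by omega), Finset.sum_range]
  have h2 : ∑ i : Fin N, (if N < letter (N + 1) σ (i + 1) + r then (1 : ℤ) else 0)
      = ∑ i : Fin N, if N < (i : ℕ) + r then (1 : ℤ) else 0 := by
    rw [← Equiv.sum_comp σ (fun i : Fin N => if N < (i : ℕ) + r then (1 : ℤ) else 0)]
    simp only [letter_succ]
  have h3 : ∑ i ∈ range N, (if N < i + r then (1 : ℤ) else 0) = (r : ℤ) - 1 := by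
    rw [Finset.sum_boole]
    have : (range N).filter (fun i => N < i + r) = Ico (N + 1 - r) N := by
      ext i
      rw [mem_filter, mem_range, mem_Ico]
      omega
    rw [this, Nat.card_Ico]
    omega
  rw [h2, ← Finset.sum_range (fun i => if N < i + r then (1 : ℤ) else 0), h3]
  ring

theorem exists_rmaj_insertion {N r : ℕ} (hr : 1 ≤ r) (hN : r ≤ N) (t s : ℕ) (hts : t + s = N) :
    ∃ F : Equiv.Perm (Fin N) → Equiv.Perm (Fin (N + 1)), Function.Injective F ∧ ∀ σ,
      (∀ i ≤ s, letter (N + 1) (F σ) i = letter (N + 1) σ i) ∧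
      letter (N + 1) (F σ) (s + 1) = N ∧
      letter (N + 1) (F σ) (s + 2) = letter (N + 1) σ (s + 1) ∧
      desSum r (N + 1) (fun _ => 1) (F σ)
        = desSum r (N + 1) (fun _ => 1) σ + (if s ∈ majSlots r σ then 0 else 1) ∧
      desSum r (N + 1) (fun i => i) (F σ) + closePairs r (F σ)
        = desSum r (N + 1) (fun i => i) σ + closePairs r σ + slotCode (majSlots r σ) s := by
  have hsub : ∀ σ : Equiv.Perm (Fin N), majSlots r σ ⊆ range (N + 1) :=
    fun σ => Finset.filter_subset _ _
  have hmem : ∀ (σ : Equiv.Perm (Fin N)) {s : ℕ}, s ≤ N → (s ∈ majSlots r σ ↔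
      N < letter (N + 1) σ (s + 1) + r ∨ letter (N + 1) σ (s + 1) + r ≤ letter (N + 1) σ s) := by
    intro σ s hs
    rw [majSlots, mem_filter, mem_range]
    exact and_iff_right (by omega)
  induction t generalizing s with
  | zero =>
    obtain rfl : s = N := by omega
    refine ⟨append, append_injective, fun σ => ?_⟩
    have hl := letter_append_self σ
    have hself : s ∈ majSlots r σ := by
      rw [hmem σ le_rfl, letter_succ_of_le _ le_rfl]
      omega
    have hdes : ∀ C, desSum r (s + 1) C (append σ) = desSum r (s + 1) C σ := by
      intro C
      unfold desSum
      rw [Finset.sum_range_succ, letter_succ_of_le _ le_rfl, if_neg (by omega), add_zero]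
      refine Finset.sum_congr rfl fun i hi => ?_
      have hi := mem_range.1 hi
      have h1 := letter_append σ (show i ≤ s by omega)
      have h2 := letter_lt (K := s + 1) σ (show i ≤ s by omega) (by omega)
      rw [h1]
      by_cases h : i = s
      · subst h
        rw [hl, letter_succ_of_le _ le_rfl, if_neg (by omega), if_neg (by omega)]
      · rw [letter_append σ (show i + 1 ≤ s by omega)]
    refine ⟨fun i hi => letter_append σ hi, hl, ?_, ?_, ?_⟩
    · rw [letter_succ_of_le _ le_rfl, letter_succ_of_le _ le_rfl]
    · rw [hdes, if_pos hself, add_zero]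
    · rw [hdes, slotCode_self (hsub σ) hself, closePairs, pairSum_append, closePairs]
      · simp
      · intro a ha
        rw [if_neg (by omega)]
  | succ t ih =>
    obtain ⟨F, hinj, hF⟩ := ih (s + 1) (by omega)
    let p : Fin (N + 1) := ⟨s, by omega⟩
    let q : Fin (N + 1) := ⟨s + 1, by omega⟩
    refine ⟨fun σ => F σ * Equiv.swap p q, fun σ τ h => hinj (mul_right_cancel h), fun σ => ?_⟩
    obtain ⟨h1, h2, h3, h4, h5⟩ := hF σ
    have hlet : ∀ i, letter (N + 1) (F σ * Equiv.swap p q) i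
        = if i = s + 1 then N else if i = s + 2 then letter (N + 1) σ (s + 1)
          else letter (N + 1) (F σ) i := by
      intro i
      rw [letter_mul_swap]
      simp only [p, q]
      rw [h2, h1 (s + 1) le_rfl]
    have hu := letter_lt (K := N + 1) σ (show s + 1 ≤ N by omega) (by omega)
    have hx := letter_lt (K := N + 1) σ (show s ≤ N by omega) (by omega)
    have hm1 := hmem σ (show s ≤ N by omega)
    have hm2 : s + 1 ∈ majSlots r σ ↔ N < letter (N + 1) σ (s + 2) + r ∨
        letter (N + 1) σ (s + 2) + r ≤ letter (N + 1) σ (s + 1) := hmem σ (by omega)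
    have hdes : ∀ C : ℕ → ℤ, desSum r (N + 1) C (F σ * Equiv.swap p q)
        = desSum r (N + 1) C (F σ)
          + (0 - if letter (N + 1) σ (s + 1) + r ≤ letter (N + 1) σ s then C s else 0)
          + ((if letter (N + 1) σ (s + 1) + r ≤ N then C (s + 1) else 0) - 0)
          + ((if letter (N + 1) σ (s + 2) + r ≤ letter (N + 1) σ (s + 1) then C (s + 2) else 0)
            - if letter (N + 1) σ (s + 2) + r ≤ N then C (s + 2) else 0) := by
      intro C
      unfold desSum
      rw [sum_range_eq_of_eq_off_three (t := s) (by omega)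
        (f := fun i => if letter (N + 1) (F σ) (i + 1) + r ≤ letter (N + 1) (F σ) i
          then C i else 0)]
      · have e1 := h1 s (by omega)
        have e2 := h1 (s + 1) (by omega)
        have e3 : letter (N + 1) (F σ) (s + 2) = N := h2
        have e4 : letter (N + 1) (F σ) (s + 2 + 1) = letter (N + 1) σ (s + 2) := h3
        have g1 := hlet s
        have g2 := hlet (s + 1)
        have g3 := hlet (s + 2)
        have g4 := hlet (s + 2 + 1)
        simp at g1 g2 g3 g4
        rw [show s + 1 + 1 = s + 2 from rfl, g1, g2, g3, g4, e1, e2, e3, e4,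
          if_neg (show ¬ N + r ≤ letter (N + 1) σ s by omega),
          if_neg (show ¬ N + r ≤ letter (N + 1) σ (s + 1) by omega)]
      · intro i i1 i2 i3
        rw [hlet i, hlet (i + 1)]
        rw [if_neg i2, if_neg i3, if_neg (show ¬ i + 1 = s + 1 by omega),
          if_neg (show ¬ i + 1 = s + 2 by omega)]
    have hclose : closePairs r (F σ * Equiv.swap p q) = closePairs r (F σ)
        + if letter (N + 1) σ (s + 1) + r ≤ N then 0 else 1 := by
      have ep : (F σ p : ℕ) = letter (N + 1) σ (s + 1) := by
        rw [← h1 (s + 1) le_rfl, ← letter_succ (K := N + 1)]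
      have eq : (F σ q : ℕ) = N := by
        rw [← letter_succ (K := N + 1)]; exact h2
      unfold closePairs
      rw [pairSum_mul_swap_adj _ _ (show (p : ℕ) + 1 = q from rfl), ep, eq]
      split_ifs <;> first | (exfalso; omega) | ring
    refine ⟨fun i hi => ?_, ?_, ?_, ?_, ?_⟩
    · rw [hlet, if_neg (by omega), if_neg (by omega), h1 i (by omega)]
    · rw [hlet, if_pos rfl]
    · rw [hlet, if_neg (by omega), if_pos rfl]
    · rw [hdes, h4]
      simp only [hm1, hm2]
      split_ifs <;> first | (exfalso; omega) | ring
    · have hpred := slotCode_pred (majSlots r σ) s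
      simp only [hm1, hm2] at hpred
      rw [hdes, hclose]
      have : desSum r (N + 1) (fun i => i) (F σ) = desSum r (N + 1) (fun i => i) σ
        + closePairs r σ + slotCode (majSlots r σ) (s + 1) - closePairs r (F σ) := by
        rw [← h5]; ring
      rw [this, hpred]
      push_cast
      split_ifs <;> first | (exfalso; omega) | ring

theorem rmaj_isInsertion {N r : ℕ} (hr : 1 ≤ r) (hN : r ≤ N) :
    IsInsertion r (fun σ : Equiv.Perm (Fin N) => (rdes r σ : ℤ)) (fun σ => (rmaj r σ : ℤ))
      (fun σ => (rdes r σ : ℤ)) (fun σ => (rmaj r σ : ℤ)) := by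
  choose F hinj hF using fun s : Fin (N + 1) =>
    exists_rmaj_insertion hr hN (N - s) s (by omega)
  have key : ∀ s σ, ((F s σ) s : ℕ) = N := by
    intro s σ
    rw [← letter_succ (K := N + 1)]
    exact (hF s σ).2.1
  refine isInsertion_of_slots (majSlots r) (fun σ => Finset.filter_subset _ _) F hinj ?_ ?_ ?_
  · intro s t σ τ h
    refine (F s σ).injective (Fin.ext ?_)
    rw [key, h, key]
  · intro s σ
    rw [rmaj_eq hr le_rfl, rmaj_eq hr (Nat.le_succ N)]
    exact (hF s σ).2.2.2.2
  · intro s σ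
    rw [rdes_eq hr le_rfl, rdes_eq hr (Nat.le_succ N), (hF s σ).2.2.2.1,
      ← card_majSlots hr hN σ]
    by_cases h : (s : ℕ) ∈ majSlots r σ
    · have := slotCode_lt_card h
      rw [if_pos h, if_neg (by omega)]
    · have := slotCode_of_notMem h
      rw [if_neg h, if_pos (by omega)]

/-- The letter at position `j` is a possible position for the letter that is inserted last. -/
def IsPointer {n : ℕ} (g r : ℕ) (τ : Equiv.Perm (Fin n)) (j : Fin n) : Prop :=
  r ≤ (τ j : ℕ) ∧ ((j : ℕ) + g ≤ τ j + 1 ∨ (τ j : ℕ) + 1 = n) ∧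
    ∀ i : Fin n, (i : ℕ) + g ≤ τ i → r ≤ (τ i : ℕ) → (j : ℕ) + g ≤ τ i + 1 → (τ j : ℕ) ≤ τ i

/-- The last pointer of `τ` is at position `x`. -/
def IsLastPointer {n : ℕ} (g r : ℕ) (τ : Equiv.Perm (Fin n)) (x : Fin n) : Prop :=
  IsPointer g r τ x ∧ ∀ j, x < j → ¬ IsPointer g r τ j

/-- `v` is one of the letters of the subsequence `gEXCL` of `τ`. -/
def IsExcLetter {n : ℕ} (g r : ℕ) (τ : Equiv.Perm (Fin n)) (v : ℕ) : Prop :=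
  ∃ i : Fin n, (τ i : ℕ) = v ∧ (i : ℕ) + g ≤ v ∧ r ≤ v

/-- The number of letters that are at least `r` in the first `L` positions. -/
def lowCount {n : ℕ} (r L : ℕ) (τ : Equiv.Perm (Fin n)) : ℤ :=
  rowSum (fun i v => if i < L ∧ r ≤ v then 1 else 0) τ

theorem val_ne_val {n : ℕ} (τ : Equiv.Perm (Fin n)) {i j : Fin n} (h : i ≠ j) :
    (τ i : ℕ) ≠ τ j := fun h' => h (τ.injective (Fin.ext h'))

theorem excDen_mul_swap_adj {n : ℕ} (g r : ℕ) (τ : Equiv.Perm (Fin n)) {p q : Fin n}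
    (hpq : (p : ℕ) + 1 = q) :
    excDen g r (τ * Equiv.swap p q) = excDen g r τ + (if (τ p : ℕ) < τ q then 1 else -1)
      - excWeight g r p (τ p) - excWeight g r q (τ q)
      + excWeight g r p (τ q) + excWeight g r q (τ p) := by
  unfold excDen
  rw [invZ_mul_swap_adj τ hpq, rowSum_mul_swap _ τ (fun h => by rw [h] at hpq; omega)]
  ring

theorem invZ_mul_swap_of_forall {n : ℕ} (τ : Equiv.Perm (Fin n)) {i j : Fin n} (hij : i < j)
    (h : (τ i : ℕ) < τ j)
    (hk : ∀ k, i < k → k < j → (τ k : ℕ) < τ i ∨ (τ j : ℕ) < τ k) :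
    invZ (τ * Equiv.swap i j) = invZ τ + 1 := by
  unfold invZ
  rw [pairSum_mul_swap _ τ hij, Finset.sum_eq_zero, if_pos h, if_neg (by omega)]
  · ring
  · intro k _
    by_cases hk' : i < k ∧ k < j
    · rw [if_pos hk']
      have := hk k hk'.1 hk'.2
      split_ifs <;> first | (exfalso; omega) | ring
    · rw [if_neg hk']

section Step

variable {n g L : ℕ} {τ : Equiv.Perm (Fin n)} {p q : Fin n}

theorem lt_of_isPointer (hpq : (p : ℕ) + 1 = q) (h : IsPointer g (g + L) τ q)
    (h1 : (p : ℕ) + g ≤ τ p) (h2 : g + L ≤ (τ p : ℕ)) :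
    (τ q : ℕ) < τ p ∧ (q : ℕ) + g ≤ τ p ∧ (q : ℕ) + g ≤ τ q + 1 := by
  have hne := val_ne_val τ (show p ≠ q from fun h => by rw [h] at hpq; omega)
  have := h.2.2 p h1 h2 (by omega)
  have := h.2.1
  have := (τ p).2
  omega

theorem row_swap_excLetter (hpq : (p : ℕ) + 1 = q)
    (h : IsPointer g (g + L) τ q) {v : ℕ} (hv : v + 1 < p + g) :
    IsExcLetter g (g + L) (τ * Equiv.swap p q) v ↔ IsExcLetter g (g + L) τ v := by
  have hf := h.2.1
  unfold IsExcLetter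
  constructor
  · rintro ⟨i, h1, h2, h3⟩
    rw [Equiv.Perm.mul_apply] at h1
    refine ⟨_, h1, ?_, h3⟩
    rw [Equiv.swap_apply_def] at *
    split_ifs at * with h4 h5
    · subst h4
      omega
    · subst h5
      omega
    · exact h2
  · rintro ⟨i, h1, h2, h3⟩
    refine ⟨Equiv.swap p q i, ?_, ?_, h3⟩
    · rw [Equiv.Perm.mul_apply, Equiv.swap_apply_self]; exact h1
    · rw [Equiv.swap_apply_def]
      split_ifs with h4 h5
      · subst h4
        have := lt_of_isPointer hpq h (by omega) (by omega)
        omega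
      · subst h5
        omega
      · exact h2

theorem row_swap_isLastPointer (hpq : (p : ℕ) + 1 = q)
    (h : IsLastPointer g (g + L) τ q) (hV : ¬ IsExcLetter g (g + L) τ (p + g - 1)) :
    IsLastPointer g (g + L) (τ * Equiv.swap p q) p := by
  obtain ⟨h, hlast⟩ := h
  have hne : p ≠ q := fun h => by rw [h] at hpq; omega
  have hp : (τ * Equiv.swap p q) p = τ q := by simp
  have hq : (τ * Equiv.swap p q) q = τ p := by simp
  have hk : ∀ k, k ≠ p → k ≠ q → (τ * Equiv.swap p q) k = τ k := fun k h1 h2 => by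
    rw [Equiv.Perm.mul_apply, Equiv.swap_apply_of_ne_of_ne h1 h2]
  have hu := lt_of_isPointer hpq h
  have hval := val_ne_val τ hne
  obtain ⟨hf1, hf2, hf3⟩ := h
  refine ⟨⟨by rw [hp]; exact hf1, by rw [hp]; omega, ?_⟩, ?_⟩
  · intro i h1 h2 h3
    rw [hp]
    by_cases ip : i = p
    · rw [ip, hp]
    by_cases iq : i = q
    · subst iq
      rw [hq] at *
      have := hu (by omega) (by omega)
      omega
    rw [hk i ip iq] at *
    refine hf3 i h1 h2 ?_
    by_contra hc
    exact hV ⟨i, by omega, by omega, by omega⟩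
  · rintro j hj ⟨c1, c2, c3⟩
    by_cases jq : j = q
    · subst jq
      rw [hq] at *
      have := (τ p).2
      have h1 : (p : ℕ) + g ≤ τ p := by omega
      have h2 := hu h1 c1
      have h3 := c3 p
      rw [hp] at h3
      have := h3 (by omega) hf1 (by omega)
      omega
    have jp : j ≠ p := hj.ne'
    have hqj : (q : ℕ) < j := by
      have : (q : ℕ) ≠ j := fun h => jq (Fin.ext h.symm)
      have : (p : ℕ) < j := hj
      omega
    rw [hk j jp jq] at *
    refine hlast j hqj ⟨c1, c2, fun i h1 h2 h3 => ?_⟩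
    by_cases ip : i = p
    · subst ip
      have := hu h1 h2
      have h4 := c3 q
      rw [hq] at h4
      exact h4 (by omega) h2 h3
    by_cases iq : i = q
    · subst iq
      have h4 := c3 p
      rw [hp] at h4
      exact h4 (by omega) h2 h3
    have h4 := c3 i
    rw [hk i ip iq] at h4
    exact h4 h1 h2 h3

theorem row_swap_excDen (hpq : (p : ℕ) + 1 = q)
    (h : IsPointer g (g + L) τ q) (hL : L ≤ p) :
    excDen g (g + L) (τ * Equiv.swap p q) = excDen g (g + L) τ
      + (if (τ q : ℕ) < q + g then 1 else -(p + 1 : ℤ)) + if n ≤ p + g then 0 else (p : ℤ) := by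
  have hu := lt_of_isPointer hpq h
  have hval := val_ne_val τ (show p ≠ q from fun h => by rw [h] at hpq; omega)
  obtain ⟨hf1, hf2, hf3⟩ := h
  have := (τ p).2
  have := (τ q).2
  rw [excDen_mul_swap_adj g _ τ hpq]
  unfold excWeight
  by_cases hE : (p : ℕ) + g ≤ τ p ∧ g + L ≤ (τ p : ℕ)
  · have := hu hE.1 hE.2
    split_ifs <;> omega
  · split_ifs <;> omega

theorem row_swap_excNum (hpq : (p : ℕ) + 1 = q)
    (h : IsPointer g (g + L) τ q) (hL : L ≤ p) :
    excNum g L (τ * Equiv.swap p q) = excNum g L τ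
      - (if (τ q : ℕ) < q + g then 0 else 1) + if n ≤ p + g then 0 else 1 := by
  have hu := lt_of_isPointer hpq h
  have hval := val_ne_val τ (show p ≠ q from fun h => by rw [h] at hpq; omega)
  obtain ⟨hf1, hf2, hf3⟩ := h
  have := (τ p).2
  have := (τ q).2
  unfold excNum
  rw [rowSum_mul_swap _ τ (fun h => by rw [h] at hpq; omega)]
  by_cases hE : (p : ℕ) + g ≤ τ p ∧ g + L ≤ (τ p : ℕ)
  · have := hu hE.1 hE.2
    split_ifs <;> omega
  · split_ifs <;> omega

theorem row_swap_lowCount (hpq : (p : ℕ) + 1 = q) (hL : L ≤ p) (r : ℕ) :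
    lowCount r L (τ * Equiv.swap p q) = lowCount r L τ := by
  unfold lowCount
  rw [rowSum_mul_swap _ τ (fun h => by rw [h] at hpq; omega)]
  split_ifs <;> omega

theorem row_swap_pointer_lt (h : IsPointer g (g + L) τ q) (hpq : (p : ℕ) + 1 = q) :
    (((τ * Equiv.swap p q) p : Fin n) : ℕ) < p + g ↔ n ≤ p + g := by
  rw [Equiv.Perm.mul_apply, Equiv.swap_apply_left]
  have := (τ q).2
  have := h.2.1
  omega

end Step

section ValueStep

variable {n g L : ℕ} {τ : Equiv.Perm (Fin n)} {i p q : Fin n}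

theorem value_swap_lt (hpq : (p : ℕ) + 1 = q) (h : IsPointer g (g + L) τ q)
    (h1 : (i : ℕ) + g ≤ τ i) (h3 : (τ i : ℕ) + 1 = p + g) :
    i < p ∧ (τ i : ℕ) < τ q := by
  have hip : (i : ℕ) < p := by omega
  have hval := val_ne_val τ (show i ≠ q from fun h => by rw [h] at hip; omega)
  have := h.2.1
  have := (τ i).2
  exact ⟨hip, by omega⟩

theorem value_swap_apply (hpq : (p : ℕ) + 1 = q) (hip : i < p) :
    (τ * Equiv.swap i q * Equiv.swap p q) i = τ q ∧
    (τ * Equiv.swap i q * Equiv.swap p q) p = τ i ∧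
    (τ * Equiv.swap i q * Equiv.swap p q) q = τ p ∧
    ∀ k, k ≠ i → k ≠ p → k ≠ q → (τ * Equiv.swap i q * Equiv.swap p q) k = τ k := by
  have h1 : p ≠ q := fun h => by rw [h] at hpq; omega
  have h2 : i ≠ p := hip.ne
  have h3 : i ≠ q := fun h => by rw [h] at hip; omega
  refine ⟨?_, ?_, ?_, fun k k1 k2 k3 => ?_⟩
  · simp [Equiv.swap_apply_of_ne_of_ne h2 h3]
  · simp
  · simp [Equiv.swap_apply_of_ne_of_ne h2.symm h1]
  · simp [Equiv.swap_apply_of_ne_of_ne k2 k3, Equiv.swap_apply_of_ne_of_ne k1 k3]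

theorem value_swap_excLetter (hpq : (p : ℕ) + 1 = q)
    (h : IsPointer g (g + L) τ q) (h1 : (i : ℕ) + g ≤ τ i)
    (h3 : (τ i : ℕ) + 1 = p + g) {v : ℕ} (hv : v + 1 < p + g) :
    IsExcLetter g (g + L) (τ * Equiv.swap i q * Equiv.swap p q) v
      ↔ IsExcLetter g (g + L) τ v := by
  obtain ⟨hip, hlt⟩ := value_swap_lt hpq h h1 h3
  obtain ⟨vi, vp, vq, vk⟩ := value_swap_apply (τ := τ) hpq hip
  have hf := h.2.1
  unfold IsExcLetter
  constructor
  · rintro ⟨k, k1, k2, k3⟩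
    by_cases ki : k = i
    · subst ki; rw [vi] at k1; omega
    by_cases kp : k = p
    · subst kp; rw [vp] at k1; omega
    by_cases kq : k = q
    · subst kq; rw [vq] at k1; exact ⟨p, k1, by omega, k3⟩
    rw [vk k ki kp kq] at k1
    exact ⟨k, k1, k2, k3⟩
  · rintro ⟨k, k1, k2, k3⟩
    by_cases ki : k = i
    · subst ki; omega
    by_cases kp : k = p
    · subst kp; omega
    by_cases kq : k = q
    · subst kq; omega
    exact ⟨k, by rw [vk k ki kp kq]; exact k1, k2, k3⟩

theorem value_swap_isLastPointer (hpq : (p : ℕ) + 1 = q) (h : IsLastPointer g (g + L) τ q)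
    (h1 : (i : ℕ) + g ≤ τ i) (h2 : g + L ≤ (τ i : ℕ)) (h3 : (τ i : ℕ) + 1 = p + g) :
    IsLastPointer g (g + L) (τ * Equiv.swap i q * Equiv.swap p q) p := by
  obtain ⟨h, hlast⟩ := h
  obtain ⟨hip, hlt⟩ := value_swap_lt hpq h h1 h3
  obtain ⟨vi, vp, vq, vk⟩ := value_swap_apply (τ := τ) hpq hip
  generalize τ * Equiv.swap i q * Equiv.swap p q = τ' at *
  have hu := lt_of_isPointer hpq h
  obtain ⟨hf1, hf2, hf3⟩ := h
  have hip' : (i : ℕ) < p := hip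
  have hnp := val_ne_val τ hip.ne
  refine ⟨⟨by rw [vp]; exact h2, by rw [vp]; omega, ?_⟩, ?_⟩
  · intro k k1 k2 k3
    rw [vp]
    omega
  · rintro j hj ⟨c1, c2, c3⟩
    by_cases jq : j = q
    · subst jq
      have h4 := c3 i
      rw [vi] at h4
      rw [vq] at c1 c2 h4
      have := (τ p).2
      have := (τ j).2
      have := hu (by omega) c1
      have := h4 (by omega) hf1 (by omega)
      omega
    have jp : j ≠ p := hj.ne'
    have ji : j ≠ i := (hip.trans hj).ne'
    have hqj : (q : ℕ) < j := by
      have : (q : ℕ) ≠ j := fun h => jq (Fin.ext h.symm)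
      have : (p : ℕ) < j := hj
      omega
    rw [vk j ji jp jq] at c1 c2 c3
    refine hlast j hqj ⟨c1, c2, fun k k1 k2 k3 => ?_⟩
    by_cases ki : k = i
    · subst ki; omega
    by_cases kp : k = p
    · subst kp
      have := hu k1 k2
      have h4 := c3 q
      rw [vq] at h4
      exact h4 (by omega) k2 k3
    by_cases kq : k = q
    · subst kq
      have h4 := c3 i
      rw [vi] at h4
      exact h4 (by omega) k2 k3
    have h4 := c3 k
    rw [vk k ki kp kq] at h4
    exact h4 k1 k2 k3

theorem value_swap_excDen (hpq : (p : ℕ) + 1 = q)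
    (h : IsPointer g (g + L) τ q) (h1 : (i : ℕ) + g ≤ τ i) (h2 : g + L ≤ (τ i : ℕ))
    (h3 : (τ i : ℕ) + 1 = p + g) :
    excDen g (g + L) (τ * Equiv.swap i q * Equiv.swap p q) = excDen g (g + L) τ
      + if (τ q : ℕ) < q + g then 1 else -(p + 1 : ℤ) := by
  obtain ⟨hip, hlt⟩ := value_swap_lt hpq h h1 h3
  have hip' : (i : ℕ) < p := hip
  have hne : i ≠ q := fun h => by rw [h] at hip'; omega
  have hpq' : p ≠ q := fun h => by rw [h] at hpq; omega
  have hu := lt_of_isPointer hpq h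
  have hval := val_ne_val τ hpq'
  have hval' := val_ne_val τ hip.ne
  have hD : excDen g (g + L) (τ * Equiv.swap i q) = excDen g (g + L) τ + 1
      - excWeight g (g + L) i (τ i) - excWeight g (g + L) q (τ q)
      + excWeight g (g + L) i (τ q) + excWeight g (g + L) q (τ i) := by
    unfold excDen
    rw [invZ_mul_swap_of_forall τ (show (i : ℕ) < q by omega) hlt, rowSum_mul_swap _ τ hne]
    · ring
    · intro k hk1 hk2
      have hk1' : (i : ℕ) < k := hk1
      have hk2' : (k : ℕ) < q := hk2
      have n1 := val_ne_val τ hk1.ne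
      have n2 := val_ne_val τ hk2.ne
      have h4 := h.2.2 k
      omega
  obtain ⟨hf1, hf2, hf3⟩ := h
  have e1 : (τ * Equiv.swap i q) p = τ p := by
    rw [Equiv.Perm.mul_apply, Equiv.swap_apply_of_ne_of_ne hip.ne' hpq']
  have e2 : (τ * Equiv.swap i q) q = τ i := by
    rw [Equiv.Perm.mul_apply, Equiv.swap_apply_right]
  have := (τ p).2
  have := (τ q).2
  rw [excDen_mul_swap_adj g _ _ hpq, hD, e1, e2]
  clear hD e1 e2
  unfold excWeight
  rw [if_pos ⟨h1, h2⟩, if_pos (show (i : ℕ) + g ≤ τ q ∧ g + L ≤ (τ q : ℕ) by omega),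
    if_neg (show ¬ ((q : ℕ) + g ≤ τ i ∧ g + L ≤ (τ i : ℕ)) by omega),
    if_neg (show ¬ ((p : ℕ) + g ≤ τ i ∧ g + L ≤ (τ i : ℕ)) by omega)]
  by_cases hE : (p : ℕ) + g ≤ τ p ∧ g + L ≤ (τ p : ℕ)
  · have := hu hE.1 hE.2
    rw [if_neg (show ¬ (τ p : ℕ) < τ i by omega), if_pos hE,
      if_pos (show (q : ℕ) + g ≤ τ p ∧ g + L ≤ (τ p : ℕ) by omega)]
    split_ifs <;> omega
  · rw [if_neg hE, if_neg (show ¬ ((q : ℕ) + g ≤ τ p ∧ g + L ≤ (τ p : ℕ)) by omega)]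
    split_ifs <;> omega

theorem value_swap_excNum (hpq : (p : ℕ) + 1 = q)
    (h : IsPointer g (g + L) τ q) (h1 : (i : ℕ) + g ≤ τ i)
    (h3 : (τ i : ℕ) + 1 = p + g) (hL : L ≤ p) :
    excNum g L (τ * Equiv.swap i q * Equiv.swap p q) = excNum g L τ
      - if (τ q : ℕ) < q + g then 0 else 1 := by
  obtain ⟨hip, hlt⟩ := value_swap_lt hpq h h1 h3
  have hip' : (i : ℕ) < p := hip
  have hne : i ≠ q := fun h => by rw [h] at hip'; omega
  have hpq' : p ≠ q := fun h => by rw [h] at hpq; omega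
  have hu := lt_of_isPointer hpq h
  have hval := val_ne_val τ hpq'
  have hval' := val_ne_val τ hip.ne
  obtain ⟨hf1, hf2, hf3⟩ := h
  have e1 : (τ * Equiv.swap i q) p = τ p := by
    rw [Equiv.Perm.mul_apply, Equiv.swap_apply_of_ne_of_ne hip.ne' hpq']
  have e2 : (τ * Equiv.swap i q) q = τ i := by
    rw [Equiv.Perm.mul_apply, Equiv.swap_apply_right]
  have := (τ p).2
  have := (τ q).2
  unfold excNum
  rw [rowSum_mul_swap _ _ hpq', rowSum_mul_swap _ τ hne, e1, e2]
  clear e1 e2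
  rw [if_neg (show ¬ (L ≤ (q : ℕ) ∧ (q : ℕ) + g ≤ τ i) by omega),
    if_neg (show ¬ (L ≤ (p : ℕ) ∧ (p : ℕ) + g ≤ τ i) by omega)]
  by_cases hE : (p : ℕ) + g ≤ τ p ∧ g + L ≤ (τ p : ℕ)
  · have := hu hE.1 hE.2
    rw [if_pos (show L ≤ (p : ℕ) ∧ (p : ℕ) + g ≤ τ p by omega),
      if_pos (show L ≤ (q : ℕ) ∧ (q : ℕ) + g ≤ τ p by omega)]
    split_ifs <;> omega
  · rw [if_neg (show ¬ (L ≤ (p : ℕ) ∧ (p : ℕ) + g ≤ τ p) by omega),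
      if_neg (show ¬ (L ≤ (q : ℕ) ∧ (q : ℕ) + g ≤ τ p) by omega)]
    split_ifs <;> omega

theorem value_swap_lowCount (hpq : (p : ℕ) + 1 = q)
    (h : IsPointer g (g + L) τ q) (h1 : (i : ℕ) + g ≤ τ i) (h2 : g + L ≤ (τ i : ℕ))
    (h3 : (τ i : ℕ) + 1 = p + g) (hL : L ≤ p) :
    lowCount (g + L) L (τ * Equiv.swap i q * Equiv.swap p q) = lowCount (g + L) L τ := by
  obtain ⟨hip, hlt⟩ := value_swap_lt hpq h h1 h3
  have hip' : (i : ℕ) < p := hip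
  have hne : i ≠ q := fun h => by rw [h] at hip'; omega
  rw [row_swap_lowCount hpq hL]
  unfold lowCount
  rw [rowSum_mul_swap _ τ hne]
  split_ifs <;> omega

end ValueStep

open Classical in
/-- Moves the last pointer of `τ` from position `q = p + 1` to position `p`. -/
noncomputable def pointerStep {n : ℕ} (g r : ℕ) (p q : Fin n) (τ : Equiv.Perm (Fin n)) :
    Equiv.Perm (Fin n) :=
  if h : IsExcLetter g r τ (p + g - 1) then τ * Equiv.swap h.choose q * Equiv.swap p q
  else τ * Equiv.swap p q

theorem pointerStep_cases {n g r : ℕ} (hg : 1 ≤ g) (p q : Fin n) (τ : Equiv.Perm (Fin n)) :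
    (¬ IsExcLetter g r τ (p + g - 1) ∧ pointerStep g r p q τ = τ * Equiv.swap p q) ∨
    ∃ i : Fin n, IsExcLetter g r τ (p + g - 1) ∧
      (i : ℕ) + g ≤ τ i ∧ r ≤ (τ i : ℕ) ∧ (τ i : ℕ) + 1 = p + g ∧
      pointerStep g r p q τ = τ * Equiv.swap i q * Equiv.swap p q := by
  by_cases h : IsExcLetter g r τ (p + g - 1)
  · right
    refine ⟨h.choose, h, ?_⟩
    obtain ⟨h1, h2, h3⟩ := h.choose_spec
    rw [pointerStep, dif_pos h]
    exact ⟨by omega, by omega, by omega, rfl⟩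
  · left
    rw [pointerStep, dif_neg h]
    exact ⟨h, rfl⟩

theorem pointerStep_injOn {n g L : ℕ} (hg : 1 ≤ g) {p q : Fin n} (hpq : (p : ℕ) + 1 = q) :
    Set.InjOn (pointerStep g (g + L) p q) {τ | IsLastPointer g (g + L) τ q} := by
  have hne : p ≠ q := fun h => by rw [h] at hpq; omega
  have key : ∀ (σ τ : Equiv.Perm (Fin n)) (i j : Fin n), IsPointer g (g + L) σ q →
      IsPointer g (g + L) τ q → i < p → j < p → (j : ℕ) + g ≤ τ j → (τ j : ℕ) + 1 = p + g →
      σ * Equiv.swap i q = τ * Equiv.swap j q → (σ q : ℕ) ≤ τ q := by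
    intro σ τ i j hσ hτ hi hj h1 h3 h
    have hj' : (j : ℕ) < p := hj
    have hi' : (i : ℕ) < p := hi
    have hjq : j ≠ q := fun h => by rw [h] at hj'; omega
    by_cases hij : i = j
    · subst hij
      rw [mul_right_cancel h]
    have hv : σ j = τ q := by
      have := congrArg (fun ρ => ρ j) h
      simpa [Equiv.swap_apply_of_ne_of_ne (Ne.symm hij) hjq] using this
    have h4 := hσ.2.2 j
    have := value_swap_lt hpq hτ h1 h3
    have h5 := hτ.2.1
    have h6 := hτ.1
    rw [hv] at h4
    have := (τ j).2
    have := (σ q).2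
    by_cases h7 : (p : ℕ) + g ≤ τ q
    · exact h4 (by omega) h6 (by omega)
    · omega
  have mixed : ∀ (σ τ : Equiv.Perm (Fin n)) (i : Fin n), IsPointer g (g + L) σ q →
      IsPointer g (g + L) τ q → (i : ℕ) + g ≤ τ i → (τ i : ℕ) + 1 = p + g →
      σ * Equiv.swap p q ≠ τ * Equiv.swap i q * Equiv.swap p q := by
    intro σ τ i hσ hτ h1 h3 h
    have hv : σ q = τ i := by
      have := congrArg (fun ρ => ρ p) h
      simpa using this
    have := value_swap_lt hpq hτ h1 h3
    have := hσ.2.1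
    rw [hv] at this
    have := (τ q).2
    omega
  intro σ hσ τ hτ h
  replace hσ := hσ.1
  replace hτ := hτ.1
  rcases pointerStep_cases (r := g + L) hg p q σ with ⟨-, hs⟩ | ⟨i, -, i1, i2, i3, hs⟩ <;>
  rcases pointerStep_cases (r := g + L) hg p q τ with ⟨-, ht⟩ | ⟨j, -, j1, j2, j3, ht⟩ <;>
  rw [hs, ht] at h
  · exact mul_right_cancel h
  · exact absurd h (mixed σ τ j hσ hτ j1 j3)
  · exact absurd h.symm (mixed τ σ i hτ hσ i1 i3)
  · have h' := mul_right_cancel h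
    have hi := (value_swap_lt hpq hσ i1 i3).1
    have hj := (value_swap_lt hpq hτ j1 j3).1
    have e := le_antisymm (key σ τ i j hσ hτ hi hj j1 j3 h') (key τ σ j i hτ hσ hj hi i1 i3 h'.symm)
    have hij : i = j := by
      refine (σ * Equiv.swap i q).injective ?_
      conv_rhs => rw [h']
      simpa using Fin.ext e
    subst hij
    exact mul_right_cancel h'

theorem append_isExcLetter {N g r : ℕ} (hg : 1 ≤ g) (σ : Equiv.Perm (Fin N)) (v : ℕ) :
    IsExcLetter g r (append σ) v ↔ IsExcLetter g r σ v := by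
  unfold IsExcLetter
  constructor
  · rintro ⟨i, h1, h2, h3⟩
    induction i using Fin.lastCases with
    | last =>
      rw [append_last, Fin.val_last] at h1
      rw [Fin.val_last] at h2
      omega
    | cast i =>
      rw [append_castSucc] at h1
      exact ⟨i, h1, h2, h3⟩
  · rintro ⟨i, h1, h2, h3⟩
    exact ⟨i.castSucc, by rw [append_castSucc]; exact h1, h2, h3⟩

theorem append_isLastPointer {N g r : ℕ} (hg : 1 ≤ g) (hr : r ≤ N) (σ : Equiv.Perm (Fin N)) :
    IsLastPointer g r (append σ) (Fin.last N) := by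
  refine ⟨⟨?_, ?_, ?_⟩, fun j hj => absurd hj (Fin.le_last j).not_gt⟩
  · rw [append_last]; exact hr
  · right; rw [append_last]; rfl
  · intro i h1 h2 h3
    rw [append_last]
    rw [Fin.val_last] at *
    omega

theorem append_excDen {N g r : ℕ} (hg : 1 ≤ g) (σ : Equiv.Perm (Fin N)) :
    excDen g r (append σ) = excDen g r σ := by
  unfold excDen invZ excWeight
  rw [rowSum_append, pairSum_append, if_neg (by omega), add_zero]
  intro a ha
  rw [if_neg (by omega)]

theorem append_excNum {N g L : ℕ} (hg : 1 ≤ g) (σ : Equiv.Perm (Fin N)) :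
    excNum g L (append σ) = excNum g L σ := by
  unfold excNum
  rw [rowSum_append, if_neg (by omega), add_zero]

theorem append_lowCount {N r L : ℕ} (hL : L ≤ N) (σ : Equiv.Perm (Fin N)) :
    lowCount r L (append σ) = lowCount r L σ := by
  unfold lowCount
  rw [rowSum_append, if_neg (by omega), add_zero]

open Classical in
/-- The positions at which the insertion does not increase the number of excedances. -/
noncomputable def excSlots {N : ℕ} (g r : ℕ) (σ : Equiv.Perm (Fin N)) : Finset ℕ :=
  {s ∈ range (N + 1) | N < s + g ∨ IsExcLetter g r σ (s + g - 1)}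

theorem mem_excSlots {N g r s : ℕ} (σ : Equiv.Perm (Fin N)) (hs : s ≤ N) :
    s ∈ excSlots g r σ ↔ N < s + g ∨ IsExcLetter g r σ (s + g - 1) := by
  simp only [excSlots, mem_filter, mem_range]
  exact ⟨fun h => h.2, fun h => ⟨by omega, h⟩⟩

theorem excSlots_subset {N g r : ℕ} (σ : Equiv.Perm (Fin N)) :
    excSlots g r σ ⊆ range (N + 1) := by
  simp only [excSlots, filter_subset]

theorem exists_insertPointer {N g L : ℕ} (hg : 1 ≤ g) (hN : g + L ≤ N) :
    ∀ t s, t + s = N → L ≤ s → ∀ x : Fin (N + 1), (x : ℕ) = s →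
      ∃ F : Equiv.Perm (Fin N) → Equiv.Perm (Fin (N + 1)), Function.Injective F ∧ ∀ σ,
        IsLastPointer g (g + L) (F σ) x ∧
        (∀ v, v + 1 < s + g → (IsExcLetter g (g + L) (F σ) v ↔ IsExcLetter g (g + L) σ v)) ∧
        ((F σ x : ℕ) < s + g ↔ s ∈ excSlots g (g + L) σ) ∧
        excDen g (g + L) (F σ) = excDen g (g + L) σ + slotCode (excSlots g (g + L) σ) s ∧
        excNum g L (F σ) = excNum g L σ + (if s ∈ excSlots g (g + L) σ then 0 else 1) ∧
        lowCount (g + L) L (F σ) = lowCount (g + L) L σ := by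
  intro t
  induction t with
  | zero =>
    intro s hs hL x hx
    obtain rfl : s = N := by omega
    obtain rfl : x = Fin.last s := Fin.ext hx
    refine ⟨append, append_injective, fun σ => ?_⟩
    have hmem : s ∈ excSlots g (g + L) σ := by
      rw [mem_excSlots σ le_rfl]
      omega
    refine ⟨append_isLastPointer hg hN σ, fun v _ => append_isExcLetter hg σ v, ?_, ?_, ?_,
      append_lowCount hL σ⟩
    · rw [append_last, Fin.val_last]
      exact ⟨fun _ => hmem, fun _ => by omega⟩
    · rw [append_excDen hg, slotCode_self (excSlots_subset σ) hmem]
      simp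
    · rw [append_excNum hg, if_pos hmem, add_zero]
  | succ t ih =>
    intro s hs hL p hp
    subst hp
    let q : Fin (N + 1) := ⟨p + 1, by omega⟩
    have hpq : (p : ℕ) + 1 = q := rfl
    obtain ⟨F, hinj, hF⟩ := ih (p + 1) (by omega) (by omega) q rfl
    refine ⟨fun σ => pointerStep g (g + L) p q (F σ), fun σ τ h => hinj
      (pointerStep_injOn hg hpq (hF σ).1 (hF τ).1 h), fun σ => ?_⟩
    obtain ⟨f1, f2, f3, f4, f5, f6⟩ := hF σ
    have hV := f2 (p + g - 1) (by omega)
    have hmem := mem_excSlots (g := g) (r := g + L) σ (show (p : ℕ) ≤ N by omega)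
    rw [← hV] at hmem
    have hpred := slotCode_pred (excSlots g (g + L) σ) p
    simp only [hpq] at f2 f3 f4 f5 hpred
    rcases pointerStep_cases (r := g + L) hg p q (F σ) with
      ⟨hn, he⟩ | ⟨i, hE, i1, i2, i3, he⟩ <;> beta_reduce <;> rw [he]
    · have hmem' : (p : ℕ) ∈ excSlots g (g + L) σ ↔ N + 1 ≤ p + g := by
        rw [hmem]; exact ⟨fun h => h.resolve_right hn, fun h => Or.inl h⟩
      refine ⟨row_swap_isLastPointer hpq f1 hn, fun v hv => ?_, ?_, ?_, ?_, ?_⟩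
      · rw [row_swap_excLetter hpq f1.1 hv, f2 v (by omega)]
      · rw [row_swap_pointer_lt f1.1 hpq, hmem']
      · rw [row_swap_excDen hpq f1.1 hL, f4, hpred]
        simp only [hmem', f3]; ring
      · rw [row_swap_excNum hpq f1.1 hL, f5]
        simp only [hmem', f3]; ring
      · rw [row_swap_lowCount hpq hL, f6]
    · have hmem' : (p : ℕ) ∈ excSlots g (g + L) σ := hmem.2 (Or.inr hE)
      refine ⟨value_swap_isLastPointer hpq f1 i1 i2 i3, fun v hv => ?_, ?_, ?_, ?_, ?_⟩
      · rw [value_swap_excLetter hpq f1.1 i1 i3 hv, f2 v (by omega)]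
      · rw [(value_swap_apply hpq (value_swap_lt hpq f1.1 i1 i3).1).2.1]
        exact ⟨fun _ => hmem', fun _ => by omega⟩
      · rw [value_swap_excDen hpq f1.1 i1 i2 i3, f4, hpred, if_pos hmem']
        simp only [f3]
        ring
      · rw [value_swap_excNum hpq f1.1 i1 i3 hL, f5, if_pos hmem']
        simp only [f3]
        ring
      · rw [value_swap_lowCount hpq f1.1 i1 i2 i3 hL, f6]

theorem card_excSlots {N g L : ℕ} (hg : 1 ≤ g) (hN : g + L ≤ N) (σ : Equiv.Perm (Fin N)) :
    ((excSlots g (g + L) σ).card : ℤ) = g + excNum g L σ + lowCount (g + L) L σ := by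
  have hsum : excNum g L σ + lowCount (g + L) L σ
      = ((univ.filter fun i : Fin N => (i : ℕ) + g ≤ σ i ∧ g + L ≤ (σ i : ℕ)).card : ℤ) := by
    unfold excNum lowCount rowSum
    rw [← sum_add_distrib, ← Finset.sum_boole]
    refine sum_congr rfl fun i _ => ?_
    beta_reduce
    split_ifs <;> omega
  have hsplit : excSlots g (g + L) σ = Ioc (N - g) N ∪
      (univ.filter fun i : Fin N => (i : ℕ) + g ≤ σ i ∧ g + L ≤ (σ i : ℕ)).image
        fun i => (σ i : ℕ) + 1 - g := by
    ext s
    simp only [excSlots, mem_filter, mem_range, mem_union, mem_Ioc, mem_image, mem_univ, true_and]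
    constructor
    · rintro ⟨h1, h2 | ⟨i, i1, i2, i3⟩⟩
      · left; omega
      · right; exact ⟨i, by omega, by omega⟩
    · rintro (h | ⟨i, ⟨i1, i2⟩, i3⟩)
      · exact ⟨by omega, Or.inl (by omega)⟩
      · have := (σ i).2
        exact ⟨by omega, Or.inr ⟨i, by omega, by omega, by omega⟩⟩
  rw [hsplit, card_union_of_disjoint, card_image_of_injOn, Nat.card_Ioc]
  · push_cast
    rw [add_assoc, hsum]
    omega
  · intro i hi j hj h
    simp only [coe_filter, Set.mem_ofPred_eq, mem_univ, true_and] at hi hj h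
    exact σ.injective (Fin.ext (by omega))
  · rw [disjoint_left]
    intro s hs hs'
    simp only [mem_image, mem_filter, mem_Ioc] at hs hs'
    obtain ⟨i, hi, h⟩ := hs'
    have := (σ i).2
    omega

/-- The letters at least `r` in increasing order, followed by the letters less than `r`. -/
def swapKey (r n v : ℕ) : ℕ := if r ≤ v then v else v + n

theorem swapKey_inj {n r : ℕ} (τ : Equiv.Perm (Fin n)) {i j : Fin n}
    (h : swapKey r n (τ i) = swapKey r n (τ j)) : i = j := by
  have := (τ i).2
  have := (τ j).2
  unfold swapKey at h
  exact τ.injective (Fin.ext (by split_ifs at h <;> omega))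

/-- The letter at position `i` has the least key larger than the key of the letter at `x`,
among the positions less than `x`. -/
def IsNextLow {n : ℕ} (r : ℕ) (x : Fin n) (τ : Equiv.Perm (Fin n)) (i : Fin n) : Prop :=
  i < x ∧ swapKey r n (τ x) < swapKey r n (τ i) ∧
    ∀ k < x, swapKey r n (τ x) < swapKey r n (τ k) → swapKey r n (τ i) ≤ swapKey r n (τ k)

/-- The number of positions less than `x` with smaller key than `x`. -/
def lowRank {n : ℕ} (r : ℕ) (x : Fin n) (τ : Equiv.Perm (Fin n)) : ℕ :=
  (univ.filter fun k => k < x ∧ swapKey r n (τ k) < swapKey r n (τ x)).card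

theorem exists_isNextLow {n r : ℕ} {x : Fin n} {τ : Equiv.Perm (Fin n)}
    (h : lowRank r x τ < x) : ∃ i, IsNextLow r x τ i := by
  have hne : (univ.filter fun k => k < x ∧ swapKey r n (τ x) < swapKey r n (τ k)).Nonempty := by
    by_contra hc
    rw [not_nonempty_iff_eq_empty, filter_eq_empty_iff] at hc
    refine h.ne ?_
    unfold lowRank
    rw [← Fin.card_Iio x]
    congr 1
    ext k
    simp only [mem_filter, mem_univ, true_and, mem_Iio, and_iff_left_iff_imp]
    intro hk
    have h1 := hc (mem_univ k)
    have h2 : swapKey r n (τ k) ≠ swapKey r n (τ x) := fun h => hk.ne (swapKey_inj τ h)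
    rw [not_and] at h1
    have := h1 hk
    omega
  obtain ⟨i, hi, hmin⟩ := exists_min_image _ (fun k => swapKey r n (τ k)) hne
  simp only [mem_filter, mem_univ, true_and] at hi hmin
  exact ⟨i, hi.1, hi.2, fun k h1 h2 => hmin k ⟨h1, h2⟩⟩

theorem mul_swap_apply_of_ne {n : ℕ} (τ : Equiv.Perm (Fin n)) {i x k : Fin n} (h1 : k ≠ i)
    (h2 : k ≠ x) : (τ * Equiv.swap i x) k = τ k := by
  rw [Equiv.Perm.mul_apply, Equiv.swap_apply_of_ne_of_ne h1 h2]

theorem mul_swap_apply_left {n : ℕ} (τ : Equiv.Perm (Fin n)) (i x : Fin n) :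
    (τ * Equiv.swap i x) i = τ x := by
  rw [Equiv.Perm.mul_apply, Equiv.swap_apply_left]

theorem mul_swap_apply_right {n : ℕ} (τ : Equiv.Perm (Fin n)) (i x : Fin n) :
    (τ * Equiv.swap i x) x = τ i := by
  rw [Equiv.Perm.mul_apply, Equiv.swap_apply_right]

section LowStep

variable {n g r L : ℕ} {x i : Fin n} {τ : Equiv.Perm (Fin n)}

theorem low_swap_rank (h : IsNextLow r x τ i) :
    lowRank r x (τ * Equiv.swap i x) = lowRank r x τ + 1 := by
  obtain ⟨h1, h2, h3⟩ := h
  unfold lowRank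
  have hi : i ∉ univ.filter fun k => k < x ∧ swapKey r n (τ k) < swapKey r n (τ x) := by
    simp only [mem_filter, mem_univ, true_and]
    omega
  rw [← card_insert_of_notMem hi]
  congr 1
  ext k
  rw [mul_swap_apply_right]
  simp only [mem_insert, mem_filter, mem_univ, true_and]
  by_cases hk : k = i
  · subst hk
    rw [mul_swap_apply_left]
    simp [h1, h2]
  · simp only [hk, false_or, and_congr_right_iff]
    intro hkx
    rw [mul_swap_apply_of_ne τ hk hkx.ne]
    have h4 := h3 k hkx
    have h5 : swapKey r n (τ k) ≠ swapKey r n (τ x) := fun h => hkx.ne (swapKey_inj τ h)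
    omega

theorem low_swap_injective {σ : Equiv.Perm (Fin n)} {j : Fin n} (h : IsNextLow r x τ i)
    (h' : IsNextLow r x σ j) (he : τ * Equiv.swap i x = σ * Equiv.swap j x) : τ = σ := by
  have key : ∀ (τ : Equiv.Perm (Fin n)) (i k : Fin n), IsNextLow r x τ i → k < x →
      swapKey r n ((τ * Equiv.swap i x) k) < swapKey r n ((τ * Equiv.swap i x) x) →
      swapKey r n ((τ * Equiv.swap i x) k) ≤ swapKey r n ((τ * Equiv.swap i x) i) := by
    rintro τ i k ⟨h1, h2, h3⟩ hk hlt
    by_cases hki : k = i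
    · rw [hki]
    rw [mul_swap_apply_right, mul_swap_apply_of_ne τ hki hk.ne] at hlt
    rw [mul_swap_apply_left, mul_swap_apply_of_ne τ hki hk.ne]
    have := h3 k hk
    omega
  have hlt : ∀ (τ : Equiv.Perm (Fin n)) (i : Fin n), IsNextLow r x τ i →
      swapKey r n ((τ * Equiv.swap i x) i) < swapKey r n ((τ * Equiv.swap i x) x) := by
    rintro τ i ⟨h1, h2, h3⟩
    rwa [mul_swap_apply_right, mul_swap_apply_left]
  have k1 := key τ i j h h'.1
  have k2 := key σ j i h' h.1
  have l1 := hlt τ i h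
  have l2 := hlt σ j h'
  rw [← he] at k2 l2
  have hij : i = j := swapKey_inj (τ * Equiv.swap i x) (le_antisymm (k2 l1) (k1 l2))
  subst hij
  exact mul_right_cancel he

theorem low_swap_isPointer (hx : (x : ℕ) = L) (hi : i < x) {j : Fin n} (hj : x < j)
    (h : IsPointer g (g + L) (τ * Equiv.swap i x) j) : IsPointer g (g + L) τ j := by
  obtain ⟨h1, h2, h3⟩ := h
  rw [mul_swap_apply_of_ne τ (hi.trans hj).ne' hj.ne'] at h1 h2 h3
  refine ⟨h1, h2, fun k k1 k2 k3 => ?_⟩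
  have h4 := h3 (Equiv.swap i x k)
  rw [Equiv.Perm.mul_apply, Equiv.swap_apply_self] at h4
  refine h4 ?_ k2 k3
  have hi' : (i : ℕ) < x := hi
  rw [Equiv.swap_apply_def]
  split_ifs <;> omega

theorem low_swap_excNum (hx : (x : ℕ) = L) (hi : i < x) :
    excNum g L (τ * Equiv.swap i x) - (if g + L ≤ (τ i : ℕ) then 1 else 0)
      = excNum g L τ - if g + L ≤ (τ x : ℕ) then 1 else 0 := by
  unfold excNum
  have hi' : (i : ℕ) < x := hi
  rw [rowSum_mul_swap _ τ hi.ne]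
  split_ifs <;> omega

theorem low_swap_lowCount (hi : i < x) :
    lowCount r (x + 1) (τ * Equiv.swap i x) = lowCount r (x + 1) τ := by
  unfold lowCount
  have hi' : (i : ℕ) < x := hi
  rw [rowSum_mul_swap _ τ hi.ne]
  split_ifs <;> omega

theorem lowCount_succ : lowCount r (x + 1) τ = lowCount r x τ + if r ≤ (τ x : ℕ) then 1 else 0 := by
  have : (if r ≤ (τ x : ℕ) then (1 : ℤ) else 0)
      = ∑ k : Fin n, if k = x then (if r ≤ (τ x : ℕ) then (1 : ℤ) else 0) else 0 := by
    rw [sum_ite_eq' univ x, if_pos (mem_univ x)]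
  unfold lowCount rowSum
  rw [this, ← sum_add_distrib]
  refine sum_congr rfl fun k _ => ?_
  by_cases hk : k = x
  · subst hk
    simp
  · have : (k : ℕ) ≠ x := fun h => hk (Fin.ext h)
    rw [if_neg hk]
    beta_reduce
    split_ifs <;> omega

theorem le_iff_lowRank_lt : r ≤ (τ x : ℕ) ↔ (lowRank r x τ : ℤ) < lowCount r (x + 1) τ := by
  have hcount : lowCount r (x + 1) τ
      = ((univ.filter fun k : Fin n => (k : ℕ) < x + 1 ∧ r ≤ (τ k : ℕ)).card : ℤ) := by
    unfold lowCount rowSum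
    rw [Finset.sum_boole]
  rw [hcount, Nat.cast_lt]
  unfold lowRank swapKey
  constructor
  · intro h
    refine card_lt_card ⟨fun k hk => ?_, fun hs => ?_⟩
    · simp only [mem_filter, mem_univ, true_and] at hk ⊢
      have h1 : (k : ℕ) < x := hk.1
      have h2 := hk.2
      have := (τ x).2
      rw [if_pos h] at h2
      split_ifs at h2 <;> omega
    · have := @hs x (by simp [h])
      simp at this
  · intro h
    by_contra hc
    refine h.not_ge (card_le_card fun k hk => ?_)
    simp only [mem_filter, mem_univ, true_and] at hk ⊢
    have hne : k ≠ x := fun h => hc (h ▸ hk.2)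
    have : (k : ℕ) ≠ x := fun h => hne (Fin.ext h)
    have := (τ k).2
    rw [if_pos hk.2, if_neg hc]
    exact ⟨show (k : ℕ) < x by omega, by omega⟩

theorem low_swap_excDen (hx : (x : ℕ) = L) (h : IsNextLow (g + L) x τ i) :
    excDen g (g + L) (τ * Equiv.swap i x) = excDen g (g + L) τ - 1 := by
  obtain ⟨hi, h2, h3⟩ := h
  have hi' : (i : ℕ) < x := hi
  unfold swapKey at h2 h3
  have hlti := (τ i).2
  have hltx := (τ x).2
  by_cases hlt : (τ x : ℕ) < τ i
  · have hinv : invZ (τ * Equiv.swap i x) = invZ τ - 1 := by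
      have := invZ_mul_swap_of_forall (τ * Equiv.swap i x) hi
        (by rwa [mul_swap_apply_right, mul_swap_apply_left]) (fun k k1 k2 => by
          rw [mul_swap_apply_right, mul_swap_apply_left, mul_swap_apply_of_ne τ k1.ne' k2.ne]
          have h4 := h3 k k2
          have := (τ k).2
          have := val_ne_val τ k1.ne'
          have := val_ne_val τ k2.ne
          split_ifs at h2 h4 <;> omega)
      rw [mul_assoc, Equiv.swap_mul_self, mul_one] at this
      omega
    unfold excDen excWeight
    rw [hinv, rowSum_mul_swap _ τ hi.ne]
    split_ifs at h2 ⊢ <;> omega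
  · have hix := val_ne_val τ hi.ne
    have hlow : ¬ g + L ≤ (τ i : ℕ) ∧ g + L ≤ (τ x : ℕ) := by
      split_ifs at h2 <;> omega
    have hinv : invZ (τ * Equiv.swap i x) = invZ τ + 1 + 2 * ((x : ℤ) - i - 1) := by
      unfold invZ
      rw [pairSum_mul_swap _ τ hi, if_pos (by omega), if_neg (by omega)]
      have hterm : ∀ k : Fin n, (if i < k ∧ k < x then
          (if (τ k : ℕ) < τ x then (1 : ℤ) else 0) + (if (τ i : ℕ) < τ k then 1 else 0)
            - (if (τ k : ℕ) < τ i then 1 else 0) - (if (τ x : ℕ) < τ k then 1 else 0) else 0)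
          = if k ∈ Ioo i x then 2 else 0 := by
        intro k
        simp only [mem_Ioo]
        by_cases hk : i < k ∧ k < x
        · rw [if_pos hk, if_pos hk]
          have h4 := h3 k hk.2
          have := (τ k).2
          have := val_ne_val τ hk.1.ne'
          have := val_ne_val τ hk.2.ne
          split_ifs at h2 h4 ⊢ <;> omega
        · rw [if_neg hk, if_neg hk]
      rw [sum_congr rfl fun k _ => hterm k, ← sum_filter, filter_mem_eq_inter, univ_inter,
        sum_const, Fin.card_Ioo, nsmul_eq_mul]
      push_cast [show 1 ≤ (x : ℕ) - i by omega, show (i : ℕ) ≤ x by omega]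
      ring
    unfold excDen excWeight
    rw [hinv, rowSum_mul_swap _ τ hi.ne]
    split_ifs <;> omega

end LowStep

theorem lowRank_eq_zero {n g L : ℕ} {x : Fin n} {τ : Equiv.Perm (Fin n)} (hx : (x : ℕ) = L)
    (h : IsPointer g (g + L) τ x) : lowRank (g + L) x τ = 0 := by
  unfold lowRank swapKey
  rw [card_eq_zero, filter_eq_empty_iff]
  rintro k - ⟨h1, h2⟩
  have h1' : (k : ℕ) < x := h1
  have := (τ x).2
  have h4 := h.2.2 k
  rw [if_pos h.1] at h2
  split_ifs at h2 <;> omega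

open Classical in
/-- Exchanges the letter at position `x` with the next letter to its left in the key order. -/
noncomputable def lowStep {n : ℕ} (r : ℕ) (x : Fin n) (τ : Equiv.Perm (Fin n)) :
    Equiv.Perm (Fin n) :=
  if h : ∃ i, IsNextLow r x τ i then τ * Equiv.swap h.choose x else τ

theorem exists_lowStep_eq {n r : ℕ} {x : Fin n} {τ : Equiv.Perm (Fin n)}
    (h : lowRank r x τ < x) : ∃ i, IsNextLow r x τ i ∧ lowStep r x τ = τ * Equiv.swap i x := by
  have h' := exists_isNextLow h
  exact ⟨h'.choose, h'.choose_spec, by rw [lowStep, dif_pos h']⟩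

theorem notMem_excSlots {N g L b : ℕ} (hg : 1 ≤ g) (hN : g + L ≤ N) (σ : Equiv.Perm (Fin N)) (hb : b ≤ L) :
    b ∉ excSlots g (g + L) σ := by
  rw [mem_excSlots σ (by omega)]
  rintro (h | ⟨i, h1, h2, h3⟩) <;> omega

theorem exists_insertLow {N g L : ℕ} (hg : 1 ≤ g) (hN : g + L ≤ N) (x : Fin (N + 1))
    (hx : (x : ℕ) = L) : ∀ ρ ≤ L,
      ∃ F : Equiv.Perm (Fin N) → Equiv.Perm (Fin (N + 1)), Function.Injective F ∧ ∀ σ,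
        (∀ j, x < j → ¬ IsPointer g (g + L) (F σ) j) ∧ lowRank (g + L) x (F σ) = ρ ∧
        excDen g (g + L) (F σ)
          = excDen g (g + L) σ + (excSlots g (g + L) σ).card + L - ρ ∧
        excNum g L (F σ) = excNum g L σ + (if g + L ≤ (F σ x : ℕ) then 1 else 0) ∧
        lowCount (g + L) (L + 1) (F σ) = lowCount (g + L) L σ + 1 := by
  intro ρ
  induction ρ with
  | zero =>
    intro _
    obtain ⟨F, hinj, hF⟩ := exists_insertPointer hg hN (N - L) L (by omega) le_rfl x hx
    refine ⟨F, hinj, fun σ => ?_⟩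
    obtain ⟨f1, f2, f3, f4, f5, f6⟩ := hF σ
    have hL := notMem_excSlots hg hN σ le_rfl
    refine ⟨f1.2, lowRank_eq_zero hx f1.1, ?_, ?_, ?_⟩
    · rw [f4, slotCode_eq_of_forall_lt fun b hb => notMem_excSlots hg hN σ hb]
      push_cast
      ring
    · rw [f5, if_neg hL, if_pos f1.1.1]
    · rw [← hx, lowCount_succ, if_pos (hx.symm ▸ f1.1.1), hx, f6]
  | succ ρ ih =>
    intro hρ
    obtain ⟨F, hinj, hF⟩ := ih (by omega)
    have hstep := fun σ => exists_lowStep_eq (r := g + L) (x := x) (τ := F σ)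
      (by rw [(hF σ).2.1]; omega)
    refine ⟨fun σ => lowStep (g + L) x (F σ), fun σ τ h => ?_, fun σ => ?_⟩
    · obtain ⟨i, hi, ei⟩ := hstep σ
      obtain ⟨j, hj, ej⟩ := hstep τ
      beta_reduce at h
      rw [ei, ej] at h
      exact hinj (low_swap_injective hi hj h)
    · obtain ⟨i, hi, ei⟩ := hstep σ
      obtain ⟨f1, f2, f3, f4, f5⟩ := hF σ
      beta_reduce
      rw [ei]
      refine ⟨fun j hj h => f1 j hj (low_swap_isPointer hx hi.1 hj h), ?_, ?_, ?_, ?_⟩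
      · rw [low_swap_rank hi, f2]
      · rw [low_swap_excDen hx hi, f3]
        push_cast
        ring
      · have := low_swap_excNum (g := g) (τ := F σ) hx hi.1
        rw [mul_swap_apply_right]
        rw [f4] at this
        linarith
      · rw [← hx, low_swap_lowCount hi.1, hx, f5]

theorem lowCount_le {n : ℕ} (r L : ℕ) (τ : Equiv.Perm (Fin n)) : lowCount r L τ ≤ L := by
  unfold lowCount rowSum
  rw [Finset.sum_boole]
  have h : ((univ.filter fun i : Fin n => (i : ℕ) < L ∧ r ≤ (τ i : ℕ)).image
      (fun i : Fin n => (i : ℕ))).card ≤ (range L).card := card_le_card fun k hk => by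
    simp only [mem_image, mem_filter] at hk
    obtain ⟨i, hi, rfl⟩ := hk
    exact mem_range.2 hi.2.1
  rw [card_image_of_injective _ Fin.val_injective, card_range] at h
  exact_mod_cast h

theorem exc_isInsertion {N g L : ℕ} (hg : 1 ≤ g) (hN : g + L ≤ N) :
    IsInsertion (g + L) (fun σ : Equiv.Perm (Fin N) => excNum g L σ) (excDen g (g + L))
      (excNum g L) (excDen g (g + L)) := by
  let x : Fin (N + 1) := ⟨L, by omega⟩
  have hx : (x : ℕ) = L := rfl
  have hex : ∀ s : Fin (N + 1),
      ∃ F : Equiv.Perm (Fin N) → Equiv.Perm (Fin (N + 1)), Function.Injective F ∧ ∀ σ,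
        (x < s → IsLastPointer g (g + L) (F σ) s) ∧
        (s ≤ x → (∀ j, x < j → ¬ IsPointer g (g + L) (F σ) j) ∧
          lowRank (g + L) x (F σ) = L - s) ∧
        excDen g (g + L) (F σ) = excDen g (g + L) σ + slotCode (excSlots g (g + L) σ) s ∧
        excNum g L (F σ) = excNum g L σ
          + if excNum g L σ + (g + L : ℕ) ≤ slotCode (excSlots g (g + L) σ) s then 1 else 0 := by
    intro s
    rcases lt_or_ge x s with hs | hs
    · have hs' : L < (s : ℕ) := hs
      obtain ⟨F, hinj, hF⟩ := exists_insertPointer hg hN (N - s) s (by omega) hs'.le s rfl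
      refine ⟨F, hinj, fun σ => ?_⟩
      obtain ⟨f1, f2, f3, f4, f5, f6⟩ := hF σ
      refine ⟨fun _ => f1, fun h => absurd hs h.not_gt, f4, ?_⟩
      rw [f5]
      have hcard := card_excSlots hg hN σ
      by_cases hmem : (s : ℕ) ∈ excSlots g (g + L) σ
      · have h1 := slotCode_lt_card hmem
        have h2 := lowCount_le (g + L) L σ
        rw [if_pos hmem, if_neg (by push_cast; omega)]
      · have h1 := card_add_le_slotCode hmem hs'.le
          fun b hb => notMem_excSlots hg hN σ hb.le
        have h2 : 0 ≤ lowCount (g + L) L σ := by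
          unfold lowCount rowSum
          exact sum_nonneg fun i _ => by beta_reduce; split_ifs <;> omega
        rw [if_neg hmem, if_pos (by push_cast; omega)]
    · have hs' : (s : ℕ) ≤ L := hs
      obtain ⟨F, hinj, hF⟩ := exists_insertLow hg hN x hx (L - s) (by omega)
      refine ⟨F, hinj, fun σ => ?_⟩
      obtain ⟨f1, f2, f3, f4, f5⟩ := hF σ
      have hcard := card_excSlots hg hN σ
      have hcode := slotCode_eq_of_forall_lt (A := excSlots g (g + L) σ) (s := s)
        fun b hb => notMem_excSlots hg hN σ (by omega)
      refine ⟨fun h => absurd h hs.not_gt, fun _ => ⟨f1, f2⟩, ?_, ?_⟩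
      · rw [f3, hcode]
        push_cast [hs']
        ring
      · have hlow := le_iff_lowRank_lt (r := g + L) (x := x) (τ := F σ)
        rw [f2, hx, f5] at hlow
        rw [f4]
        congr 1
        refine if_congr (hlow.trans ?_) rfl rfl
        rw [hcode]
        push_cast [hs']
        omega
  choose F hinj hF using hex
  refine isInsertion_of_slots (excSlots g (g + L)) excSlots_subset F hinj ?_
    (fun s σ => (hF s σ).2.2.1) (fun s σ => (hF s σ).2.2.2)
  have key : ∀ s t σ τ, F s σ = F t τ → ¬ s < t := by
    intro s t σ τ h hst
    obtain ⟨a1, a2, -⟩ := hF s σ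
    obtain ⟨b1, b2, -⟩ := hF t τ
    rw [h] at a1 a2
    rcases lt_or_ge x t with ht | ht
    · have hpt := (b1 ht).1
      rcases lt_or_ge x s with hs | hs
      · exact (a1 hs).2 t hst hpt
      · exact (a2 hs).1 t ht hpt
    · have h1 := (b2 ht).2
      have h2 := (a2 (hst.le.trans ht)).2
      have h3 : (t : ℕ) ≤ L := ht
      have h4 : (s : ℕ) < t := hst
      omega
  exact fun s t σ τ h => le_antisymm (not_lt.1 (key t s τ σ h.symm)) (not_lt.1 (key s t σ τ h))

theorem excNum_of_le {n g L : ℕ} (hn : n ≤ g + L) (σ : Equiv.Perm (Fin n)) : excNum g L σ = 0 := by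
  unfold excNum rowSum
  refine sum_eq_zero fun i _ => if_neg ?_
  have := (σ i).2
  omega

theorem excDen_of_le {n g r : ℕ} (hn : n ≤ r) (σ : Equiv.Perm (Fin n)) :
    excDen g r σ = invZ σ := by
  unfold excDen rowSum excWeight
  rw [sum_eq_zero, add_zero]
  intro i _
  have := (σ i).2
  rw [if_neg (by omega)]

theorem rdesPairs_of_le {n r : ℕ} (hn : n ≤ r) (σ : Equiv.Perm (Fin n)) : rdesPairs r σ = ∅ := by
  refine filter_eq_empty_iff.2 ?_
  rintro ⟨p, q⟩ -
  have := (σ p).2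
  unfold val1
  omega

theorem rmaj_of_le {n r : ℕ} (hr : 1 ≤ r) (hn : n ≤ r) (σ : Equiv.Perm (Fin n)) :
    (rmaj r σ : ℤ) = invZ σ := by
  rw [rmaj_eq hr le_rfl, ← sum_rdesPairs_s4 hr le_rfl, rdesPairs_of_le hn, sum_empty, zero_add]
  unfold closePairs invZ pairSum
  refine sum_congr rfl fun p _ => sum_congr rfl fun q _ => if_congr Iff.rfl ?_ rfl
  have := (σ p).2
  exact if_congr (by omega) rfl rfl

theorem exists_equiv_excNum_rdes {g L : ℕ} (hg : 1 ≤ g) (n : ℕ) :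
    ∃ e : Equiv.Perm (Equiv.Perm (Fin n)), ∀ σ,
      (rdes (g + L) (e σ) : ℤ) = excNum g L σ ∧
      (rmaj (g + L) (e σ) : ℤ) = excDen g (g + L) σ := by
  refine exists_equiv_of_isInsertion (g + L) (fun _ σ => excNum g L σ)
    (fun _ σ => excDen g (g + L) σ) (fun _ σ => (rdes (g + L) σ : ℤ))
    (fun _ σ => (rmaj (g + L) σ : ℤ)) ?_ (fun N hN => exc_isInsertion hg hN)
    (fun N hN => rmaj_isInsertion (by omega) hN) n
  refine fun n hn => ⟨funext fun σ => ?_, funext fun σ => ?_⟩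
  · rw [excNum_of_le hn, rdes, rdesPairs_of_le hn]
    rfl
  · rw [excDen_of_le hn, rmaj_of_le (by omega) hn]

/-- Theorem 1.2(1) (Huang–Yan): the pair `(g exc_ℓ, g den_ℓ)` is `(g+ℓ−1)`-Euler–Mahonian. -/
theorem gexc_gdenLvl_l_is_euler_mahonian (g l n : ℕ) (hg : 1 ≤ g) (hl : 1 ≤ l)
    (hn : 1 ≤ n) (a b : ℕ) :
    ((univ : Finset (Equiv.Perm (Fin n))).filter fun σ =>
        gexc g l σ = a ∧ gden g l σ = b).card
      = ((univ : Finset (Equiv.Perm (Fin n))).filter fun σ =>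
          rdes (g + l - 1) σ = a ∧ rmaj (g + l - 1) σ = b).card := by
  obtain ⟨e, he⟩ := exists_equiv_excNum_rdes (L := l - 1) hg n
  have hlevel := card_excDen_level (n := n) (g := g) (L := l - 1) a b
  simp only [← gexc_eq_excNum g l hl, ← gden_eq_excDen g l hl, Nat.cast_inj] at hlevel he
  rw [hlevel]
  refine card_equiv e fun σ => ?_
  obtain ⟨h1, h2⟩ := he σ
  rw [← Nat.add_sub_assoc hl g] at h1 h2
  rw [← Nat.add_sub_assoc hl g]
  simp only [mem_filter, mem_univ, true_and, ← h1, ← h2, Nat.cast_inj]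

end PaperStmt
end
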